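/- arXiv:0807.4996 — 4 statements merged into one kernel-verified Lean document; each statement's English description precedes it below -/
import Mathlib

section
/- Let f ∈ ℝ[[x,y]] be a formal power series in two variables. If f is nonnegative at every ordering of the field ℝ((x,y)) (the quotient field of ℝ[[x,y]]), then f is a sum of squares in ℝ[[x,y]]. -/
noncomputable section

open MvPowerSeries MvPolynomial

/-- `ℝ[[x,y]]` is an integral domain. -/
instance : IsDomain (MvPowerSeries (Fin 2) ℝ) := NoZeroDivisors.to_isDomain _

/-- The ring of formal power series `ℝ[[x,y]]`. -/
abbrev PS : Type := MvPowerSeries (Fin 2) ℝ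

/-- The field `ℝ((x,y))`, the quotient field of `ℝ[[x,y]]`. -/
abbrev FF : Type := FractionRing PS

/-- The canonical embedding `ℝ[[x,y]] → ℝ((x,y))`. -/
abbrev ι : PS →+* FF := algebraMap PS FF

/-- The power series `x`. -/
abbrev psX : PS := MvPowerSeries.X 0

/-- The power series `y`. -/
abbrev psY : PS := MvPowerSeries.X 1

/-- The preordering of a commutative ring `A` generated by a subset `S`:
the smallest subsemiring of `A` containing `S` together with all squares. -/
def preorderingGen {A : Type*} [CommRing A] (S : Set A) : Set A :=
  (Subsemiring.closure (S ∪ {a | ∃ b, a = b ^ 2}) : Set A)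

/-- An ordering of a field `F`: a subset `P` with `P + P ⊆ P`, `P·P ⊆ P`,
`P ∪ (−P) = F` and `P ∩ (−P) = {0}`. -/
def IsOrderingF {F : Type*} [Field F] (P : Set F) : Prop :=
  (∀ a ∈ P, ∀ b ∈ P, a + b ∈ P) ∧ (∀ a ∈ P, ∀ b ∈ P, a * b ∈ P) ∧
  (∀ a : F, a ∈ P ∨ -a ∈ P) ∧ (∀ a : F, a ∈ P → -a ∈ P → a = 0)

/-- Artin's theorem: an element nonnegative at all orderings is a sum of squares. -/
lemma artin_aux {F : Type*} [Field F] (h2 : (2 : F) ≠ 0) (f : F)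
    (hf : ∀ P : Set F, IsOrderingF P → f ∈ P) : IsSumSq f := by
  by_contra hns
  let S : Set (Subsemiring F) := {P | (∀ a, a * a ∈ P) ∧ f ∉ P}
  have h0 : Subsemiring.sumSq F ∈ S := by
    refine ⟨fun a => ?_, ?_⟩
    · simp
    · simpa using hns
  obtain ⟨P, -, hP⟩ := zorn_le_nonempty₀ S (by
    intro c hc hchain Q hQ
    refine ⟨sSup c, ⟨fun a => ?_, ?_⟩, fun z hz => le_sSup hz⟩
    · exact (le_sSup hQ : Q ≤ sSup c) ((hc hQ).1 a)
    · rw [Subsemiring.mem_sSup_of_directedOn ⟨Q, hQ⟩ hchain.directedOn]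
      rintro ⟨R, hR, hfR⟩
      exact (hc hR).2 hfR) _ h0
  have hsq : ∀ a, a * a ∈ P := hP.prop.1
  have hfP : f ∉ P := hP.prop.2
  have hm1 : (-1 : F) ∉ P := by
    intro hm
    apply hfP
    have e : f = ((f + 1) / 2) * ((f + 1) / 2) + (-1) * (((f - 1) / 2) * ((f - 1) / 2)) := by
      field_simp
      ring
    rw [e]
    exact P.add_mem (hsq _) (P.mul_mem hm (hsq _))
  have hanti : ∀ a : F, a ∈ P → -a ∈ P → a = 0 := by
    intro a ha hna
    by_contra h
    apply hm1
    have e : (-1 : F) = a * (-a) * (a⁻¹ * a⁻¹) := by field_simp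
    rw [e]
    exact P.mul_mem (P.mul_mem ha hna) (hsq _)
  have hext : ∀ a : F, a ∉ P → ∃ s ∈ P, ∃ t ∈ P, f = s + t * a := by
    intro a ha
    let Q : Subsemiring F :=
      { carrier := {z | ∃ s ∈ P, ∃ t ∈ P, z = s + t * a}
        mul_mem' := by
          rintro _ _ ⟨s, hs, t, ht, rfl⟩ ⟨s', hs', t', ht', rfl⟩
          exact ⟨s * s' + t * t' * (a * a),
            P.add_mem (P.mul_mem hs hs') (P.mul_mem (P.mul_mem ht ht') (hsq a)),
            s * t' + t * s', P.add_mem (P.mul_mem hs ht') (P.mul_mem ht hs'), by ring⟩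
        one_mem' := ⟨1, P.one_mem, 0, P.zero_mem, by ring⟩
        add_mem' := by
          rintro _ _ ⟨s, hs, t, ht, rfl⟩ ⟨s', hs', t', ht', rfl⟩
          exact ⟨s + s', P.add_mem hs hs', t + t', P.add_mem ht ht', by ring⟩
        zero_mem' := ⟨0, P.zero_mem, 0, P.zero_mem, by ring⟩ }
    have hPQ : P ≤ Q := fun z hz => ⟨z, hz, 0, P.zero_mem, by ring⟩
    have haQ : a ∈ Q := ⟨0, P.zero_mem, 1, P.one_mem, by ring⟩
    by_contra hcon
    have hQS : Q ∈ S := ⟨fun b => hPQ (hsq b), hcon⟩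
    exact ha (hP.le_of_ge hQS hPQ haQ)
  have htot : ∀ a : F, a ∈ P ∨ -a ∈ P := by
    intro a
    by_contra hcon
    push Not at hcon
    obtain ⟨s, hs, t, ht, e1⟩ := hext a hcon.1
    obtain ⟨u, hu, v, hv, e2⟩ := hext (-a) hcon.2
    have hne : t + v ≠ 0 := by
      intro h
      have : t = 0 := hanti t ht (by rw [neg_eq_of_add_eq_zero_right h]; exact hv)
      apply hfP
      rw [e1, this]
      simpa using hs
    apply hfP
    have e : f = (v * s + t * u) * (t + v) * ((t + v)⁻¹ * (t + v)⁻¹) := by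
      field_simp
      linear_combination v * e1 + t * e2
    rw [e]
    exact P.mul_mem (P.mul_mem (P.add_mem (P.mul_mem hv hs) (P.mul_mem ht hu))
      (P.add_mem ht hv)) (hsq _)
  exact hfP (hf (P : Set F) ⟨fun a ha b hb => P.add_mem ha hb,
    fun a ha b hb => P.mul_mem ha hb, htot, hanti⟩)

/-- A sum of squares in the fraction field has a square denominator. -/
lemma clear_denoms (z : FF) (hz : IsSumSq z) :
    ∃ h : PS, h ≠ 0 ∧ ∃ s : PS, IsSumSq s ∧ ι (h * h) * z = ι s := by
  induction hz with
  | zero => exact ⟨1, one_ne_zero, 0, .zero, by simp⟩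
  | @sq_add a s hs ih =>
    obtain ⟨h, hh, s', hs', e⟩ := ih
    obtain ⟨n, d, hd, rfl⟩ := IsFractionRing.div_surjective (A := PS) a
    have hd0 : d ≠ 0 := nonZeroDivisors.ne_zero hd
    have hd1 : ι d ≠ 0 := by simpa using hd0
    refine ⟨h * d, mul_ne_zero hh hd0, (h * n) * (h * n) + d * d * s',
      .sq_add _ ((IsSumSq.mul_self d).mul hs'), ?_⟩
    simp only [map_mul, map_add] at e ⊢
    rw [← e]
    field_simp

lemma isSumSq_exists_fin {R : Type*} [CommRing R] {s : R} (hs : IsSumSq s) :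
    ∃ (n : ℕ) (g : Fin n → R), s = ∑ i, g i * g i := by
  induction hs with
  | zero => exact ⟨0, Fin.elim0, by simp⟩
  | @sq_add a s hs ih =>
    obtain ⟨n, g, rfl⟩ := ih
    exact ⟨n + 1, Fin.cons a g, by simp [Fin.sum_univ_succ]⟩

lemma isSumSq_map {R S : Type*} [CommRing R] [CommRing S] (φ : R →+* S) {s : R}
    (hs : IsSumSq s) : IsSumSq (φ s) := by
  induction hs with
  | zero => simp
  | @sq_add a s hs ih => rw [map_add, map_mul]; exact .sq_add _ ih

/-- `R` is real: a vanishing sum of squares has vanishing terms. -/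
def RealRing (R : Type*) [CommRing R] : Prop :=
  ∀ (n : ℕ) (g : Fin n → R), ∑ i, g i * g i = 0 → ∀ i, g i = 0

lemma realRing_real : RealRing ℝ := by
  intro n g h i
  have := (Finset.sum_eq_zero_iff_of_nonneg (fun i _ => mul_self_nonneg (g i))).1 h i
    (Finset.mem_univ _)
  simpa using this

lemma realRing_powerSeries {R : Type*} [CommRing R] (hR : RealRing R) :
    RealRing (PowerSeries R) := by
  intro n g h
  have key : ∀ m : ℕ, ∀ i, PowerSeries.coeff m (g i) = 0 := by
    intro m
    induction m using Nat.strong_induction_on with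
    | _ m ih =>
      refine hR n (fun i => PowerSeries.coeff m (g i)) ?_
      have h' := congrArg (PowerSeries.coeff (m + m)) h
      rw [map_sum, map_zero] at h'
      rw [← h']
      refine Finset.sum_congr rfl fun i _ => ?_
      rw [PowerSeries.coeff_mul, Finset.sum_eq_single (m, m)]
      · rintro ⟨a, b⟩ hab hne
        rw [Finset.HasAntidiagonal.mem_antidiagonal] at hab
        simp only at hab
        rcases lt_trichotomy a m with h1 | h1 | h1
        · simp [ih a h1 i]
        · exact absurd (by ext <;> simp <;> omega) hne
        · simp [ih b (by omega) i]
      · intro h1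
        simp at h1
  intro i
  ext m
  simp [key m i]

/-- reduction mod `x` -/
abbrev redX : PowerSeries (PowerSeries ℝ) →+* PowerSeries ℝ :=
  PowerSeries.map (PowerSeries.constantCoeff (R := ℝ))

/-- the variable `x` in `ℝ[[x]][[y]]` -/
abbrev cX : PowerSeries (PowerSeries ℝ) := PowerSeries.C (PowerSeries.X : PowerSeries ℝ)

lemma redX_cX : redX cX = 0 := by simp [redX, cX]

lemma cX_ne_zero : cX ≠ 0 := by
  intro h
  have := congrArg (PowerSeries.coeff 0) h
  simp [cX] at this

lemma exists_of_redX_eq_zero (g : PowerSeries (PowerSeries ℝ)) (h : redX g = 0) :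
    ∃ g', g = cX * g' := by
  have : ∀ n, ∃ a, PowerSeries.coeff n g = PowerSeries.X * a := by
    intro n
    have h1 := congrArg (PowerSeries.coeff n) h
    rw [PowerSeries.coeff_map, map_zero] at h1
    exact PowerSeries.X_dvd_iff.2 h1
  choose a ha using this
  refine ⟨PowerSeries.mk a, ?_⟩
  ext1 n
  rw [ha, PowerSeries.coeff_C_mul, PowerSeries.coeff_mk]

lemma exists_pow_cX (h : PowerSeries (PowerSeries ℝ)) (hh : h ≠ 0) :
    ∃ (k : ℕ) (h' : PowerSeries (PowerSeries ℝ)), h = cX ^ k * h' ∧ redX h' ≠ 0 := by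
  have h1 : ∃ n m, PowerSeries.coeff m (PowerSeries.coeff n h) ≠ 0 := by
    by_contra hcon
    push Not at hcon
    apply hh
    ext n m
    simp [hcon]
  obtain ⟨n, m, hnm⟩ := h1
  clear hh
  induction m generalizing h with
  | zero =>
    refine ⟨0, h, by simp, ?_⟩
    intro h0
    apply hnm
    have := congrArg (PowerSeries.coeff n) h0
    simpa using this
  | succ m ih =>
    by_cases h0 : redX h = 0
    · obtain ⟨g', rfl⟩ := exists_of_redX_eq_zero h h0
      rw [PowerSeries.coeff_C_mul, PowerSeries.coeff_succ_X_mul] at hnm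
      obtain ⟨k, h', e, hne⟩ := ih g' hnm
      exact ⟨k + 1, h', by rw [e]; ring, hne⟩
    · exact ⟨0, h, by simp, h0⟩

lemma cancel_cX (n k : ℕ) (z : PowerSeries (PowerSeries ℝ)) (g : Fin n → PowerSeries (PowerSeries ℝ))
    (h : cX ^ k * cX ^ k * z = ∑ i, g i * g i) :
    ∃ g' : Fin n → PowerSeries (PowerSeries ℝ), z = ∑ i, g' i * g' i := by
  induction k generalizing g with
  | zero => exact ⟨g, by simpa using h⟩
  | succ k ih =>
    have h0 : ∀ i, redX (g i) = 0 := by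
      apply realRing_powerSeries realRing_real
      have := congrArg redX h
      simp only [pow_succ, map_mul, redX_cX, map_sum, mul_zero, zero_mul] at this
      exact this.symm
    choose g' hg' using fun i => exists_of_redX_eq_zero (g i) (h0 i)
    apply ih g'
    have hc := mul_ne_zero cX_ne_zero cX_ne_zero
    apply mul_left_cancel₀ hc
    calc cX * cX * (cX ^ k * cX ^ k * z) = cX ^ (k + 1) * cX ^ (k + 1) * z := by ring
      _ = ∑ i, g i * g i := h
      _ = cX * cX * ∑ i, g' i * g' i := by
        rw [Finset.mul_sum]
        refine Finset.sum_congr rfl fun i _ => ?_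
        rw [hg' i]
        ring

/-- Weierstrass division in `ℝ[[x]][[y]]`. -/
lemma weierstrass_div (h g : PowerSeries (PowerSeries ℝ)) (hh : redX h ≠ 0) :
    ∃ (q : PowerSeries (PowerSeries ℝ)) (r : PowerSeries (PowerSeries ℝ)),
      g = h * q + r ∧ ∀ n, (redX h).order.toNat ≤ n → PowerSeries.coeff n r = 0 := by
  let I : Ideal (PowerSeries ℝ) := Ideal.span {PowerSeries.X}
  have hI : ∀ a : PowerSeries ℝ, Ideal.Quotient.mk I a = 0 ↔ PowerSeries.constantCoeff a = 0 := by
    intro a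
    rw [Ideal.Quotient.eq_zero_iff_mem, Ideal.mem_span_singleton, PowerSeries.X_dvd_iff]
  have hord : (h.map (Ideal.Quotient.mk I)).order = (redX h).order := by
    apply le_antisymm
    · apply PowerSeries.le_order
      intro i hi
      have := PowerSeries.coeff_of_lt_order i hi
      rw [PowerSeries.coeff_map] at this ⊢
      exact (hI _).1 this
    · apply PowerSeries.le_order
      intro i hi
      have := PowerSeries.coeff_of_lt_order i hi
      rw [PowerSeries.coeff_map] at this ⊢
      exact (hI _).2 this
  have hdiv : h.IsWeierstrassDivisorAt I := by
    unfold PowerSeries.IsWeierstrassDivisorAt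
    rw [hord, PowerSeries.isUnit_iff_constantCoeff, isUnit_iff_ne_zero]
    have := PowerSeries.coeff_order hh
    rwa [PowerSeries.coeff_map] at this
  have H := hdiv.isWeierstrassDivisionAt_div_mod g
  refine ⟨_, _, H.eq_mul_add, fun n hn => ?_⟩
  rw [Polynomial.coeff_coe]
  apply Polynomial.coeff_eq_zero_of_degree_lt
  refine lt_of_lt_of_le H.degree_lt ?_
  rw [hord]
  exact_mod_cast hn

/-- Cassels descent in `ℝ[[x]][[y]]`. -/
lemma descent (n : ℕ) (f : PowerSeries (PowerSeries ℝ)) (d : ℕ) :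
    ∀ (h : PowerSeries (PowerSeries ℝ)) (g : Fin n → PowerSeries (PowerSeries ℝ)),
      redX h ≠ 0 → (redX h).order.toNat = d → h * h * f = ∑ i, g i * g i → IsSumSq f := by
  induction d using Nat.strong_induction_on with
  | _ d ih =>
  intro h g hh hd e
  have hh0 : h ≠ 0 := by rintro rfl; simp at hh
  choose a r hg hr using fun i => weierstrass_div h (g i) hh
  rw [hd] at hr
  by_cases hall : ∀ i, r i = 0
  · have : f = ∑ i, a i * a i := by
      apply mul_left_cancel₀ (mul_ne_zero hh0 hh0)
      rw [e, Finset.mul_sum]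
      refine Finset.sum_congr rfl fun i _ => ?_
      rw [hg i, hall i]
      ring
    rw [this]
    exact IsSumSq.sum_mul_self _ _
  have hR : ∑ i, r i * r i ≠ 0 := fun h0 =>
    hall (realRing_powerSeries (realRing_powerSeries realRing_real) n r h0)
  set Qa := ∑ i, a i * a i with hQa
  set B := ∑ i, a i * r i with hB
  set Rr := ∑ i, r i * r i with hRr
  have e' : h * h * f = h * h * Qa + 2 * h * B + Rr := by
    rw [e, hQa, hB, hRr, Finset.mul_sum, Finset.mul_sum, ← Finset.sum_add_distrib,
      ← Finset.sum_add_distrib]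
    refine Finset.sum_congr rfl fun i _ => ?_
    rw [hg i]
    ring
  set h' := h * f - 2 * B - h * Qa with hh'
  have ehh' : h * h' = Rr := by
    rw [hh']
    linear_combination e'
  have h'0 : h' ≠ 0 := by
    intro h0
    apply hR
    rw [← ehh', h0, mul_zero]
  have e2 : h' * h' * f = ∑ i, (h' * a i + (Qa - f) * r i) * (h' * a i + (Qa - f) * r i) := by
    have : ∑ i, (h' * a i + (Qa - f) * r i) * (h' * a i + (Qa - f) * r i)
        = h' * h' * Qa + 2 * h' * (Qa - f) * B + (Qa - f) * (Qa - f) * Rr := by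
      rw [hQa, hB, hRr, Finset.mul_sum, Finset.mul_sum, Finset.mul_sum,
        ← Finset.sum_add_distrib, ← Finset.sum_add_distrib]
      refine Finset.sum_congr rfl fun i _ => ?_
      ring
    rw [this, ← ehh']
    linear_combination (-(Qa - f) * h') * hh'
  obtain ⟨k, h'', ek, hne⟩ := exists_pow_cX h' h'0
  have e3 : cX ^ k * cX ^ k * (h'' * h'' * f)
      = ∑ i, (h' * a i + (Qa - f) * r i) * (h' * a i + (Qa - f) * r i) := by
    rw [← e2]
    rw [ek]
    ring
  obtain ⟨g', eg'⟩ := cancel_cX n k _ _ e3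
  refine ih (redX h'').order.toNat ?_ h'' g' hne rfl eg'
  set d' := (redX h'').order.toNat with hd'
  have hcoef : PowerSeries.coeff (d + d') (redX h * redX h'') ≠ 0 := by
    have h1 : (redX h * redX h'').order = ((d + d' : ℕ) : ℕ∞) := by
      rw [PowerSeries.order_mul, ← hd, hd', Nat.cast_add,
        ENat.natCast_toNat (by simpa using hh), ENat.natCast_toNat (by simpa using hne)]
    have h2 := PowerSeries.coeff_order (φ := redX h * redX h'') (mul_ne_zero hh hne)
    rw [h1] at h2
    exact h2
  by_contra hlt
  push Not at hlt
  apply hcoef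
  have hRc : PowerSeries.coeff (d + d') Rr = 0 := by
    rw [hRr, map_sum]
    refine Finset.sum_eq_zero fun i _ => ?_
    rw [PowerSeries.coeff_mul]
    refine Finset.sum_eq_zero ?_
    rintro ⟨p, q⟩ hpq
    rw [Finset.HasAntidiagonal.mem_antidiagonal] at hpq
    simp only at hpq
    rcases le_or_gt d p with hp | hp
    · simp [hr i p hp]
    · simp [hr i q (by omega)]
  have e4 : Rr = PowerSeries.C ((PowerSeries.X : PowerSeries ℝ) ^ k) * (h * h'') := by
    rw [← ehh', ek, map_pow]
    ring
  rw [e4, PowerSeries.coeff_C_mul] at hRc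
  have hz : PowerSeries.coeff (d + d') (h * h'') = 0 :=
    (mul_eq_zero.1 hRc).resolve_left (pow_ne_zero _ PowerSeries.X_ne_zero)
  rw [← map_mul, PowerSeries.coeff_map, hz, map_zero]

/-- `ℝ[[x,y]] ≃ ℝ[[x]][[y]]` -/
def psEquiv : PS ≃+* PowerSeries (PowerSeries ℝ) :=
  ((MvPowerSeries.renameEquiv (R := ℝ)
    (Fintype.equivOfCardEq (by simp) : Fin 2 ≃ Option Unit)).toRingEquiv).trans
    (MvPowerSeries.optionEquivLeft Unit ℝ).toRingEquiv

/-- If a formal power series `f ∈ ℝ[[x,y]]` is nonnegative at every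
ordering of the field `ℝ((x,y))`, then `f` is a sum of squares in `ℝ[[x,y]]`. -/
theorem psd_implies_sos (f : PS)
    (hf : ∀ P : Set FF, IsOrderingF P → ι f ∈ P) :
    IsSumSq f := by
  have h2 : (2 : FF) ≠ 0 := by
    have h : (2 : PS) ≠ 0 := by
      intro h
      have := congrArg MvPowerSeries.constantCoeff h
      rw [map_ofNat, map_zero] at this
      norm_num at this
    intro h0
    apply h
    apply IsFractionRing.injective PS FF
    rw [map_ofNat, map_zero]
    exact h0
  obtain ⟨h, hh, s, hs, e⟩ := clear_denoms _ (artin_aux h2 (ι f) hf)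
  rw [← map_mul] at e
  have e1 : h * h * f = s := IsFractionRing.injective PS FF e
  have hT : IsSumSq (psEquiv f) := by
    have hh' : psEquiv h ≠ 0 := by simpa using hh
    obtain ⟨k, h', ek, hne⟩ := exists_pow_cX _ hh'
    obtain ⟨n, g, eg⟩ := isSumSq_exists_fin (isSumSq_map psEquiv.toRingHom hs)
    have e2 : cX ^ k * cX ^ k * (h' * h' * psEquiv f) = ∑ i, g i * g i := by
      rw [← eg, ← e1]
      simp only [RingEquiv.toRingHom_eq_coe, RingHom.coe_coe, map_mul]
      rw [ek]
      ring
    obtain ⟨g', eg'⟩ := cancel_cX n k _ _ e2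
    exact descent n _ _ h' g' hne rfl eg'
  simpa using isSumSq_map psEquiv.symm.toRingHom hT
end
end

section
/- Let f ∈ ℝ[[x,y]] be a formal power series in two variables. If f is nonnegative at every ordering of the field ℝ((x,y)) at which x is positive, then f lies in the preordering of ℝ[[x,y]] generated by x; equivalently, f = σ₀ + σ₁·x for some sums of squares σ₀, σ₁ in ℝ[[x,y]]. -/
noncomputable section

open MvPowerSeries MvPolynomial

/-- Proper preorderings of a field, as sets. -/
structure IsPre {F : Type*} [Field F] (S : Set F) : Prop where
  add : ∀ a ∈ S, ∀ b ∈ S, a + b ∈ S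
  mul : ∀ a ∈ S, ∀ b ∈ S, a * b ∈ S
  sq : ∀ a : F, a ^ 2 ∈ S
  neg_one : (-1 : F) ∉ S

lemma IsPre.extend {F : Type*} [Field F] {S : Set F} (hS : IsPre S) (a : F) (ha : -a ∉ S) :
    ∃ S' : Set F, IsPre S' ∧ S ⊆ S' ∧ a ∈ S' := by
  have h0 : (0 : F) ∈ S := by simpa using hS.sq 0
  have h1 : (1 : F) ∈ S := by simpa using hS.sq 1
  refine ⟨{z | ∃ s ∈ S, ∃ t ∈ S, z = s + a * t}, ⟨?_, ?_, ?_, ?_⟩, ?_, ?_⟩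
  · rintro _ ⟨s, hs, t, ht, rfl⟩ _ ⟨s', hs', t', ht', rfl⟩
    exact ⟨s + s', hS.add _ hs _ hs', t + t', hS.add _ ht _ ht', by ring⟩
  · rintro _ ⟨s, hs, t, ht, rfl⟩ _ ⟨s', hs', t', ht', rfl⟩
    exact ⟨s * s' + a ^ 2 * (t * t'), hS.add _ (hS.mul _ hs _ hs') _
      (hS.mul _ (hS.sq a) _ (hS.mul _ ht _ ht')), s * t' + t * s',
      hS.add _ (hS.mul _ hs _ ht') _ (hS.mul _ ht _ hs'), by ring⟩
  · intro z
    exact ⟨z ^ 2, hS.sq z, 0, h0, by ring⟩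
  · rintro ⟨s, hs, t, ht, h⟩
    have ht0 : t ≠ 0 := by
      rintro rfl
      apply hS.neg_one
      rw [h]; simpa using hs
    apply ha
    have : -a = (1 + s) * (t * (t⁻¹) ^ 2) := by
      field_simp
      linear_combination h
    rw [this]
    exact hS.mul _ (hS.add _ h1 _ hs) _ (hS.mul _ ht _ (hS.sq _))
  · intro s hs
    exact ⟨s, hs, 0, h0, by ring⟩
  · exact ⟨0, h0, 1, h1, by ring⟩

lemma IsPre.exists_ordering {F : Type*} [Field F] {S : Set F} (hS : IsPre S) :
    ∃ P : Set F, IsOrderingF P ∧ S ⊆ P := by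
  obtain ⟨M, hSM, hM⟩ := zorn_subset_nonempty {S : Set F | IsPre S} (by
    intro c hc hch hne
    obtain ⟨s0, hs0⟩ := hne
    have key : ∀ a ∈ ⋃₀ c, ∀ b ∈ ⋃₀ c, ∃ s ∈ c, a ∈ s ∧ b ∈ s := by
      rintro a ⟨s, hs, has⟩ b ⟨s', hs', hbs⟩
      rcases hch.total hs hs' with h | h
      · exact ⟨s', hs', h has, hbs⟩
      · exact ⟨s, hs, has, h hbs⟩
    refine ⟨⋃₀ c, ⟨?_, ?_, ?_, ?_⟩, fun s hs => Set.subset_sUnion_of_mem hs⟩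
    · intro a ha b hb
      obtain ⟨s, hs, h1, h2⟩ := key a ha b hb
      exact ⟨s, hs, (hc hs).add _ h1 _ h2⟩
    · intro a ha b hb
      obtain ⟨s, hs, h1, h2⟩ := key a ha b hb
      exact ⟨s, hs, (hc hs).mul _ h1 _ h2⟩
    · intro a
      exact ⟨s0, hs0, (hc hs0).sq a⟩
    · rintro ⟨s, hs, h⟩
      exact (hc hs).neg_one h) S hS
  have hP : IsPre M := hM.prop
  refine ⟨M, ⟨hP.add, hP.mul, ?_, ?_⟩, hSM⟩
  · intro a
    by_contra hcon
    push Not at hcon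
    obtain ⟨S', hS', hsub, ha⟩ := hP.extend a hcon.2
    exact hcon.1 (hM.le_of_ge hS' hsub ha)
  · intro a h1 h2
    by_contra ha
    apply hP.neg_one
    have : (-1 : F) = a * -a * (a⁻¹) ^ 2 := by field_simp
    rw [this]
    exact hP.mul _ (hP.mul _ h1 _ h2) _ (hP.sq _)

/-- Artin: an element outside of a preordering is negative at some ordering. -/
lemma artin {F : Type*} [Field F] (h2 : (2 : F) ≠ 0) (T : Set F)
    (hadd : ∀ a ∈ T, ∀ b ∈ T, a + b ∈ T) (hmul : ∀ a ∈ T, ∀ b ∈ T, a * b ∈ T)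
    (sq : ∀ a : F, a ^ 2 ∈ T) (f : F) (hf : f ∉ T) :
    ∃ P : Set F, IsOrderingF P ∧ T ⊆ P ∧ f ∉ P := by
  have hT : IsPre T := by
    refine ⟨hadd, hmul, sq, fun h => hf ?_⟩
    have : f = ((f + 1) / 2) ^ 2 + (-1) * ((f - 1) / 2) ^ 2 := by field_simp; ring
    rw [this]
    exact hadd _ (sq _) _ (hmul _ h _ (sq _))
  obtain ⟨S', hS', hsub, ha⟩ := hT.extend (-f) (by simpa using hf)
  obtain ⟨P, hP, hSP⟩ := hS'.exists_ordering
  refine ⟨P, hP, hsub.trans hSP, fun h => ?_⟩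
  have := hP.2.2.2 f h (hSP ha)
  apply hf
  rw [this]
  simpa using sq 0

/-- `ℝ[[x]][[y]]`. -/
abbrev BB : Type := PowerSeries (PowerSeries ℝ)

/-- The element `x` of `ℝ[[x]][[y]]`. -/
def tB : BB := PowerSeries.C (PowerSeries.X : PowerSeries ℝ)

/-- Reduction modulo `x`. -/
def redB : BB →+* PowerSeries ℝ := PowerSeries.map PowerSeries.constantCoeff

lemma coeff_tB_mul (n : ℕ) (g : BB) :
    PowerSeries.coeff n (tB * g) = PowerSeries.X * PowerSeries.coeff n g := by
  simp [tB]

lemma coeff_tB_pow_mul (k n : ℕ) (g : BB) :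
    PowerSeries.coeff n (tB ^ k * g) = PowerSeries.X ^ k * PowerSeries.coeff n g := by
  rw [tB, ← map_pow, PowerSeries.coeff_C_mul]

lemma tB_ne_zero : tB ≠ 0 := by
  intro h
  have := congrArg (PowerSeries.coeff 0) h
  simp [tB] at this

lemma redB_tB : redB tB = 0 := by
  simp [redB, tB]

lemma redB_eq_zero_iff (g : BB) : redB g = 0 ↔ tB ∣ g := by
  constructor
  · intro h
    have h' : ∀ n, (PowerSeries.X : PowerSeries ℝ) ∣ PowerSeries.coeff n g := by
      intro n
      have := congrArg (PowerSeries.coeff n) h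
      rw [PowerSeries.X_dvd_iff]
      simpa [redB] using this
    choose c hc using h'
    refine ⟨PowerSeries.mk c, ?_⟩
    ext1 n
    rw [coeff_tB_mul, hc n, PowerSeries.coeff_mk]
  · rintro ⟨c, rfl⟩
    rw [map_mul, redB_tB, zero_mul]

lemma eq_zero_of_tB_pow_dvd (g : BB) (h : ∀ n, tB ^ n ∣ g) : g = 0 := by
  ext n m
  obtain ⟨c, hc⟩ := h (m + 1)
  rw [hc, coeff_tB_pow_mul]
  simp [PowerSeries.coeff_X_pow_mul']

lemma exists_tB_pow (g : BB) (hg : g ≠ 0) : ∃ k h, g = tB ^ k * h ∧ redB h ≠ 0 := by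
  classical
  have hex : ∃ n, ¬ tB ^ n ∣ g := by
    by_contra hcon
    push Not at hcon
    exact hg (eq_zero_of_tB_pow_dvd g hcon)
  have hn := Nat.find_spec hex
  have hmin : ∀ m < Nat.find hex, tB ^ m ∣ g := fun m hm => not_not.1 (Nat.find_min hex hm)
  generalize Nat.find hex = n at hn hmin
  cases n with
  | zero => simp at hn
  | succ k =>
    obtain ⟨h, rfl⟩ := hmin k (Nat.lt_succ_self k)
    refine ⟨k, h, rfl, fun h0 => hn ?_⟩
    rw [redB_eq_zero_iff] at h0
    obtain ⟨c, rfl⟩ := h0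
    exact ⟨c, by ring⟩

/-- `ℝ[[y]]` is formally real. -/
lemma real_sum_sq {m : Type*} (s : Finset m) (g : m → PowerSeries ℝ)
    (h : ∑ i ∈ s, g i ^ 2 = 0) : ∀ i ∈ s, g i = 0 := by
  have key : ∀ n, ∀ k < n, ∀ i ∈ s, PowerSeries.coeff k (g i) = 0 := by
    intro n
    induction n with
    | zero => intro k hk; omega
    | succ n ih =>
      have hd : ∀ i ∈ s, ∃ c, g i = PowerSeries.X ^ n * c := fun i hi =>
        PowerSeries.X_pow_dvd_iff.2 (fun k hk => ih k hk i hi)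
      have hd' : ∀ i, ∃ c, i ∈ s → g i = PowerSeries.X ^ n * c := by
        intro i
        by_cases hi : i ∈ s
        · obtain ⟨c, hc⟩ := hd i hi
          exact ⟨c, fun _ => hc⟩
        · exact ⟨0, fun h => absurd h hi⟩
      choose c hc using hd'
      have h1 : ∑ i ∈ s, c i ^ 2 = 0 := by
        have : (PowerSeries.X : PowerSeries ℝ) ^ (2 * n) * ∑ i ∈ s, c i ^ 2 = 0 := by
          rw [← h, Finset.mul_sum]
          refine Finset.sum_congr rfl fun i hi => ?_
          rw [hc i hi]; ring
        exact (mul_eq_zero.1 this).resolve_left (pow_ne_zero _ PowerSeries.X_ne_zero)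
      have h2 := congrArg PowerSeries.constantCoeff h1
      simp only [map_sum, map_pow, map_zero] at h2
      rw [Finset.sum_eq_zero_iff_of_nonneg (fun i _ => sq_nonneg _)] at h2
      intro k hk i hi
      rcases Nat.lt_succ_iff_lt_or_eq.1 hk with hk | rfl
      · exact ih k hk i hi
      · rw [hc i hi, PowerSeries.coeff_X_pow_mul']
        simpa using h2 i hi
  intro i hi
  ext n
  simpa using key (n + 1) n (Nat.lt_succ_self n) i hi

lemma wdiv (g : BB) (hg : redB g ≠ 0) (f : BB) :
    ∃ q : BB, ∃ r : Polynomial (PowerSeries ℝ),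
      r.degree < (redB g).order.toNat ∧ f = g * q + (r : BB) := by
  set I : Ideal (PowerSeries ℝ) := Ideal.span {PowerSeries.X} with hI
  have hord : (g.map (Ideal.Quotient.mk I)).order = (redB g).order := by
    have hz : ∀ n, PowerSeries.coeff n (g.map (Ideal.Quotient.mk I)) = 0 ↔
        PowerSeries.coeff n (redB g) = 0 := by
      intro n
      rw [PowerSeries.coeff_map, Ideal.Quotient.eq_zero_iff_mem, hI, Ideal.mem_span_singleton,
        PowerSeries.X_dvd_iff, redB, PowerSeries.coeff_map]
    apply le_antisymm
    · exact PowerSeries.le_order _ _ fun i hi => (hz i).1 (PowerSeries.coeff_of_lt_order i hi)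
    · exact PowerSeries.le_order _ _ fun i hi => (hz i).2 (PowerSeries.coeff_of_lt_order i hi)
  have H : g.IsWeierstrassDivisorAt I := by
    rw [PowerSeries.IsWeierstrassDivisorAt, hord, PowerSeries.isUnit_iff_constantCoeff,
      isUnit_iff_ne_zero]
    have := PowerSeries.coeff_order hg
    rwa [redB, PowerSeries.coeff_map] at this
  have := H.isWeierstrassDivisionAt_div_mod f
  refine ⟨_, _, ?_, this.eq_mul_add⟩
  rw [← hord]
  exact this.degree_lt

lemma form_dvd {m : Type*} [Fintype m] (w : m → BB) (hw : ∀ i, w i = 1 ∨ w i = tB)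
    (G : m → BB) (h : tB ^ 2 ∣ ∑ i, w i * G i ^ 2) : ∀ i, tB ∣ G i := by
  classical
  have hsplit : ∑ i, w i * G i ^ 2 =
      ∑ i with w i = 1, G i ^ 2 + tB * ∑ i with ¬ w i = 1, G i ^ 2 := by
    rw [← Finset.sum_filter_add_sum_filter_not Finset.univ (fun i => w i = 1), Finset.mul_sum]
    congr 1
    · refine Finset.sum_congr rfl fun i hi => ?_
      rw [(Finset.mem_filter.1 hi).2, one_mul]
    · refine Finset.sum_congr rfl fun i hi => ?_
      rw [(hw i).resolve_left (Finset.mem_filter.1 hi).2]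
  obtain ⟨c, hc⟩ := h
  rw [hsplit] at hc
  have h1 : ∀ i, w i = 1 → tB ∣ G i := by
    have h0 := congrArg redB hc
    simp only [map_add, map_mul, map_pow, redB_tB, map_sum] at h0
    have := real_sum_sq _ (fun i => redB (G i)) (by simpa using h0)
    intro i hi
    rw [← redB_eq_zero_iff]
    exact this i (by simp [hi])
  have h2 : ∀ i, ¬ w i = 1 → tB ∣ G i := by
    have h3 : tB ^ 2 ∣ ∑ i with w i = 1, G i ^ 2 :=
      Finset.dvd_sum fun i hi => pow_dvd_pow_of_dvd (h1 i (Finset.mem_filter.1 hi).2) 2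
    obtain ⟨e, he⟩ := h3
    rw [he] at hc
    have h4 : ∑ i with ¬ w i = 1, G i ^ 2 = tB * (c - e) := by
      apply mul_left_cancel₀ tB_ne_zero
      linear_combination hc
    have h0 := congrArg redB h4
    simp only [map_mul, map_pow, redB_tB, map_sum] at h0
    have := real_sum_sq _ (fun i => redB (G i)) (by simpa using h0)
    intro i hi
    rw [← redB_eq_zero_iff]
    exact this i (by simp [hi])
  intro i
  by_cases hi : w i = 1
  · exact h1 i hi
  · exact h2 i hi

lemma form_div {m : Type*} [Fintype m] (w : m → BB) (hw : ∀ i, w i = 1 ∨ w i = tB)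
    (k : ℕ) (G : m → BB) (c : BB) (h : ∑ i, w i * G i ^ 2 = (tB ^ k) ^ 2 * c) :
    ∃ G' : m → BB, (∀ i, G i = tB ^ k * G' i) ∧ ∑ i, w i * G' i ^ 2 = c := by
  induction k generalizing G with
  | zero => exact ⟨G, by simp, by simpa using h⟩
  | succ k ih =>
    have := form_dvd w hw G ⟨(tB ^ k) ^ 2 * c, by rw [h]; ring⟩
    choose G1 hG1 using this
    obtain ⟨G', h1, h2⟩ := ih G1 (by
      apply mul_left_cancel₀ (pow_ne_zero 2 tB_ne_zero)
      rw [Finset.mul_sum]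
      calc _ = ∑ i, w i * G i ^ 2 := Finset.sum_congr rfl fun i _ => by rw [hG1 i]; ring
        _ = _ := by rw [h]; ring)
    exact ⟨G', fun i => by rw [hG1, h1]; ring, h2⟩

lemma form_aniso {m : Type*} [Fintype m] (w : m → BB) (hw : ∀ i, w i = 1 ∨ w i = tB)
    (G : m → BB) (h : ∑ i, w i * G i ^ 2 = 0) : ∀ i, G i = 0 := by
  intro i
  apply eq_zero_of_tB_pow_dvd
  intro n
  obtain ⟨G', h1, -⟩ := form_div w hw n G 0 (by simpa using h)
  exact ⟨_, h1 i⟩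

lemma form_degree {m : Type*} [Fintype m] (w : m → BB) (hw : ∀ i, w i = 1 ∨ w i = tB)
    (d : ℕ) (hd : 0 < d) (r : m → Polynomial (PowerSeries ℝ))
    (hr : ∀ i, (r i).degree < d) (n : ℕ) (hn : 2 * d - 1 ≤ n) :
    PowerSeries.coeff n (∑ i, w i * ((r i : BB)) ^ 2) = 0 := by
  rw [map_sum]
  refine Finset.sum_eq_zero fun i _ => ?_
  have h2 : PowerSeries.coeff n ((r i : BB) ^ 2) = 0 := by
    rw [← Polynomial.coe_pow, Polynomial.coeff_coe]
    apply Polynomial.coeff_eq_zero_of_natDegree_lt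
    have h3 : (r i).natDegree < d := by
      by_cases h0 : r i = 0
      · simpa [h0] using hd
      · exact (Polynomial.natDegree_lt_iff_degree_lt h0).2 (hr i)
    have := Polynomial.natDegree_pow_le (p := r i) (n := 2)
    omega
  rcases hw i with h | h
  · rw [h, one_mul, h2]
  · rw [h, coeff_tB_mul, h2, mul_zero]

lemma cassels {m : Type*} [Fintype m] (w : m → BB) (hw : ∀ i, w i = 1 ∨ w i = tB)
    (f : BB) (d : ℕ) : ∀ (h : BB) (G : m → BB), redB h ≠ 0 → (redB h).order.toNat = d →
    ∑ i, w i * G i ^ 2 = h ^ 2 * f → ∃ Q : m → BB, ∑ i, w i * Q i ^ 2 = f := by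
  induction d using Nat.strong_induction_on with
  | _ d ih =>
  intro h G hh hd hG
  have hh0 : h ≠ 0 := by rintro rfl; simp at hh
  choose q r hr hqr using fun i => wdiv h hh (G i)
  by_cases hz : ∑ i, w i * ((r i : BB)) ^ 2 = 0
  · have hr0 := form_aniso w hw _ hz
    refine ⟨q, ?_⟩
    apply mul_left_cancel₀ (pow_ne_zero 2 hh0)
    rw [← hG, Finset.mul_sum]
    refine Finset.sum_congr rfl fun i _ => ?_
    rw [hqr i, hr0 i]; ring
  have hd0 : 0 < d := by
    by_contra hcon
    have : d = 0 := by omega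
    apply hz
    refine Finset.sum_eq_zero fun i _ => ?_
    have h1 := hr i
    rw [hd, this] at h1
    have : r i = 0 := by
      rw [← Polynomial.degree_eq_bot]
      exact Nat.WithBot.lt_zero_iff.1 (by simpa using h1)
    rw [this]; simp
  set a : BB := ∑ i, w i * q i ^ 2 - f with ha
  set b : BB := 2 * (f * h - ∑ i, w i * (G i * q i)) with hb
  set h' : BB := a * h + b with hh'
  have e1 : ∑ i, w i * (a * G i + b * q i) ^ 2 = h' ^ 2 * f := by
    have : ∑ i, w i * (a * G i + b * q i) ^ 2 = a ^ 2 * ∑ i, w i * G i ^ 2 +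
        2 * a * b * ∑ i, w i * (G i * q i) + b ^ 2 * ∑ i, w i * q i ^ 2 := by
      simp only [Finset.mul_sum, ← Finset.sum_add_distrib]
      exact Finset.sum_congr rfl fun i _ => by ring
    rw [this, hG]
    have e2 : ∑ i, w i * q i ^ 2 = a + f := by rw [ha]; ring
    have e3 : 2 * ∑ i, w i * (G i * q i) = 2 * f * h - b := by rw [hb]; ring
    rw [e2, hh']
    linear_combination a * b * e3
  have e4 : h * h' = ∑ i, w i * ((r i : BB)) ^ 2 := by
    have : ∑ i, w i * ((r i : BB)) ^ 2 = ∑ i, w i * G i ^ 2 -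
        2 * h * ∑ i, w i * (G i * q i) + h ^ 2 * ∑ i, w i * q i ^ 2 := by
      simp only [Finset.mul_sum, ← Finset.sum_add_distrib, ← Finset.sum_sub_distrib]
      refine Finset.sum_congr rfl fun i _ => ?_
      have : (r i : BB) = G i - h * q i := by rw [hqr i]; ring
      rw [this]; ring
    rw [this, hG, hh', ha, hb]; ring
  have hh'0 : h' ≠ 0 := by
    intro h0
    apply hz
    rw [← e4, h0, mul_zero]
  obtain ⟨k, h'', hk, hred⟩ := exists_tB_pow h' hh'0
  rw [hk] at e1
  obtain ⟨G', -, hG'⟩ := form_div w hw k _ (h'' ^ 2 * f) (by rw [e1]; ring)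
  refine ih (redB h'').order.toNat ?_ h'' G' hred rfl hG'
  have hprod : redB (h * h'') ≠ 0 := by
    rw [map_mul]; exact mul_ne_zero hh hred
  have hdeg : ∀ n, 2 * d - 1 ≤ n → PowerSeries.coeff n (h * h'') = 0 := by
    intro n hn
    have h1 := form_degree w hw d hd0 r (fun i => by rw [← hd]; exact hr i) n hn
    rw [← e4, hk, show h * (tB ^ k * h'') = tB ^ k * (h * h'') by ring, coeff_tB_pow_mul] at h1
    exact (mul_eq_zero.1 h1).resolve_left (pow_ne_zero _ PowerSeries.X_ne_zero)
  have hlt : (redB (h * h'')).order.toNat < 2 * d - 1 := by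
    by_contra hcon
    push Not at hcon
    apply PowerSeries.coeff_order hprod
    rw [redB, PowerSeries.coeff_map, ← redB, hdeg _ hcon, map_zero]
  rw [map_mul, PowerSeries.order_mul, ENat.toNat_add (by simpa using hh)
    (by simpa using hred), hd] at hlt
  omega

lemma isSumSq_exists {A : Type*} [CommRing A] {a : A} (h : IsSumSq a) :
    ∃ (n : ℕ) (g : Fin n → A), a = ∑ i, g i ^ 2 := by
  induction h with
  | zero => exact ⟨0, Fin.elim0, by simp⟩
  | sq_add b _ ih =>
    obtain ⟨n, g, rfl⟩ := ih
    exact ⟨n + 1, Fin.cons b g, by simp [Fin.sum_univ_succ, sq]⟩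

lemma main_BB (f h s₀ s₁ : BB) (hh : h ≠ 0) (h₀ : IsSumSq s₀) (h₁ : IsSumSq s₁)
    (he : h ^ 2 * f = s₀ + s₁ * tB) :
    ∃ σ₀ σ₁ : BB, IsSumSq σ₀ ∧ IsSumSq σ₁ ∧ f = σ₀ + σ₁ * tB := by
  obtain ⟨n, g, rfl⟩ := isSumSq_exists h₀
  obtain ⟨n', g', rfl⟩ := isSumSq_exists h₁
  let w : Fin n ⊕ Fin n' → BB := Sum.elim (fun _ => 1) (fun _ => tB)
  have hw : ∀ i, w i = 1 ∨ w i = tB := by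
    rintro (i | i)
    · exact Or.inl rfl
    · exact Or.inr rfl
  have hsum : ∀ G : Fin n ⊕ Fin n' → BB, ∑ i, w i * G i ^ 2 =
      ∑ i, G (Sum.inl i) ^ 2 + (∑ i, G (Sum.inr i) ^ 2) * tB := by
    intro G
    rw [Fintype.sum_sum_type, Finset.sum_mul]
    simp [w, mul_comm]
  obtain ⟨k, h', hk, hred⟩ := exists_tB_pow h hh
  obtain ⟨G', -, hG'⟩ := form_div w hw k (Sum.elim g g') (h' ^ 2 * f) (by
    rw [hsum]; simp only [Sum.elim_inl, Sum.elim_inr]; rw [← he, hk]; ring)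
  obtain ⟨Q, hQ⟩ := cassels w hw f _ h' G' hred rfl hG'
  refine ⟨∑ i, Q (Sum.inl i) ^ 2, ∑ i, Q (Sum.inr i) ^ 2, ?_, ?_, ?_⟩
  · exact IsSumSq.sum fun i _ => IsSquare.isSumSq (IsSquare.sq _)
  · exact IsSumSq.sum fun i _ => IsSquare.isSumSq (IsSquare.sq _)
  · rw [← hQ, hsum]

/-- The identification of `ℝ[[x,y]]` with `ℝ[[x]][[y]]`. -/
def eB : PS ≃+* BB :=
  ((MvPowerSeries.renameEquiv ℝ ((Equiv.swap (0 : Fin 2) 1).trans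
    ((finSuccEquiv 1).trans (Equiv.optionCongr (Equiv.equivPUnit (Fin 1)))))).trans
    (MvPowerSeries.optionEquivLeft Unit ℝ)).toRingEquiv

lemma eB_X : eB psX = tB := by
  have h1 : ((Equiv.swap (0 : Fin 2) 1).trans
    ((finSuccEquiv 1).trans (Equiv.optionCongr (Equiv.equivPUnit (Fin 1))))) 0 = some () := by
    rfl
  change MvPowerSeries.optionEquivLeft Unit ℝ (MvPowerSeries.rename _ (MvPowerSeries.X 0)) = _
  rw [MvPowerSeries.rename_X, h1, MvPowerSeries.optionEquivLeft_X_some]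
  rfl

/-- Elements of `ℝ((x,y))` of the form `(σ₀ + σ₁ x) / h²`. -/
def TT : Set FF := {a | ∃ h s₀ s₁ : PS, h ≠ 0 ∧ IsSumSq s₀ ∧ IsSumSq s₁ ∧
  ι h ^ 2 * a = ι (s₀ + s₁ * psX)}

lemma isSumSq_sq {A : Type*} [CommRing A] (a : A) : IsSumSq (a ^ 2) :=
  IsSquare.isSumSq (IsSquare.sq _)

lemma isSumSq_map_s3 {A B : Type*} [CommRing A] [CommRing B] (e : A →+* B) {a : A} (h : IsSumSq a) :
    IsSumSq (e a) := by
  obtain ⟨n, g, rfl⟩ := isSumSq_exists h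
  simp only [map_sum, map_pow]
  exact IsSumSq.sum fun i _ => isSumSq_sq _

lemma TT_add : ∀ a ∈ TT, ∀ b ∈ TT, a + b ∈ TT := by
  rintro a ⟨h, s₀, s₁, h0, hs₀, hs₁, e⟩ b ⟨h', s₀', s₁', h0', hs₀', hs₁', e'⟩
  refine ⟨h * h', h' ^ 2 * s₀ + h ^ 2 * s₀', h' ^ 2 * s₁ + h ^ 2 * s₁', mul_ne_zero h0 h0',
    ((isSumSq_sq _).mul hs₀).add ((isSumSq_sq _).mul hs₀'),
    ((isSumSq_sq _).mul hs₁).add ((isSumSq_sq _).mul hs₁'), ?_⟩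
  simp only [map_add, map_mul, map_pow] at e e' ⊢
  linear_combination ι h' ^ 2 * e + ι h ^ 2 * e'

lemma TT_mul : ∀ a ∈ TT, ∀ b ∈ TT, a * b ∈ TT := by
  rintro a ⟨h, s₀, s₁, h0, hs₀, hs₁, e⟩ b ⟨h', s₀', s₁', h0', hs₀', hs₁', e'⟩
  refine ⟨h * h', s₀ * s₀' + psX ^ 2 * (s₁ * s₁'), s₀ * s₁' + s₁ * s₀', mul_ne_zero h0 h0',
    (hs₀.mul hs₀').add ((isSumSq_sq _).mul (hs₁.mul hs₁')),
    (hs₀.mul hs₁').add (hs₁.mul hs₀'), ?_⟩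
  calc ι (h * h') ^ 2 * (a * b) = (ι h ^ 2 * a) * (ι h' ^ 2 * b) := by rw [map_mul]; ring
    _ = _ := by rw [e, e', ← map_mul]; congr 1; ring

lemma TT_sq : ∀ a : FF, a ^ 2 ∈ TT := by
  intro a
  obtain ⟨p, q, hq, rfl⟩ := IsFractionRing.div_surjective (A := PS) a
  have hq0 : q ≠ 0 := nonZeroDivisors.ne_zero hq
  refine ⟨q, p ^ 2, 0, hq0, isSumSq_sq _, IsSumSq.zero, ?_⟩
  have : ι q ≠ 0 := by simpa using hq0
  rw [zero_mul, add_zero, map_pow]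
  field_simp

/-- If `f ∈ ℝ[[x,y]]` is nonnegative at every ordering of `ℝ((x,y))`
at which `x` is positive, then `f` lies in the preordering of `ℝ[[x,y]]` generated by
`x`; equivalently, `f = σ₀ + σ₁·x` with `σ₀, σ₁` sums of squares in `ℝ[[x,y]]`. -/
theorem psd_halfplane_implies_preordering_x (f : PS)
    (hf : ∀ P : Set FF, IsOrderingF P → (ι psX ∈ P ∧ ι psX ≠ 0) → ι f ∈ P) :
    f ∈ preorderingGen {psX} ∧
      ∃ σ₀ σ₁ : PS, IsSumSq σ₀ ∧ IsSumSq σ₁ ∧ f = σ₀ + σ₁ * psX := by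
  have hX : (psX : PS) ≠ 0 := by
    intro h
    apply tB_ne_zero
    rw [← eB_X, h, map_zero]
  have hfT : ι f ∈ TT := by
    by_contra hcon
    have h2 : (2 : FF) ≠ 0 := by
      have : ι (2 : PS) ≠ 0 := by
        rw [Ne, FaithfulSMul.algebraMap_eq_zero_iff]
        intro h
        have := congrArg MvPowerSeries.constantCoeff h
        rw [map_ofNat, map_zero] at this
        norm_num at this
      rwa [map_ofNat] at this
    obtain ⟨P, hP, hTP, hfP⟩ := artin h2 TT TT_add TT_mul TT_sq _ hcon
    refine hfP (hf P hP ⟨hTP ?_, by simpa using hX⟩)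
    exact ⟨1, 0, 1, one_ne_zero, IsSumSq.zero, by simp, by simp⟩
  have hmain : ∃ σ₀ σ₁ : PS, IsSumSq σ₀ ∧ IsSumSq σ₁ ∧ f = σ₀ + σ₁ * psX := by
    obtain ⟨h, s₀, s₁, h0, hs₀, hs₁, e⟩ := hfT
    have e' : h ^ 2 * f = s₀ + s₁ * psX := by
      apply IsFractionRing.injective PS FF
      rw [map_mul, map_pow]; exact e
    obtain ⟨σ₀, σ₁, h₀, h₁, hσ⟩ := main_BB (eB f) (eB h) (eB s₀) (eB s₁) (by simpa using h0)
      (isSumSq_map_s3 eB.toRingHom hs₀) (isSumSq_map_s3 eB.toRingHom hs₁) (by rw [← eB_X, ← map_pow, ← map_mul, e', map_add, map_mul])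
    refine ⟨eB.symm σ₀, eB.symm σ₁, isSumSq_map_s3 eB.symm.toRingHom h₀,
      isSumSq_map_s3 eB.symm.toRingHom h₁, ?_⟩
    apply eB.injective
    rw [hσ, map_add, map_mul, eB_X]; simp
  refine ⟨?_, hmain⟩
  obtain ⟨σ₀, σ₁, h₀, h₁, rfl⟩ := hmain
  have key : ∀ s : PS, IsSumSq s → s ∈ Subsemiring.closure ({psX} ∪ {a : PS | ∃ b, a = b ^ 2}) := by
    intro s hs
    obtain ⟨n, g, rfl⟩ := isSumSq_exists hs
    exact sum_mem fun i _ => Subsemiring.subset_closure (Or.inr ⟨g i, rfl⟩)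
  exact add_mem (key _ h₀) (mul_mem (key _ h₁) (Subsemiring.subset_closure (Or.inl rfl)))
end
end

section
/- Let f ∈ ℝ[[x,y]] be a formal power series in two variables. If f is nonnegative at every ordering of the field ℝ((x,y)) at which both x and y are positive, then f lies in the preordering of ℝ[[x,y]] generated by x and y; equivalently, f = σ₀ + σ₁·x + σ₂·y + σ₃·xy for some sums of squares σ₀, σ₁, σ₂, σ₃ in ℝ[[x,y]]. -/
noncomputable section

open MvPowerSeries MvPolynomial

namespace QuadSOS

open scoped Polynomial

/-- `ℂ[[x]]`. -/
abbrev RC : Type := PowerSeries ℂ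

instance instAdicRC : IsAdicComplete (IsLocalRing.maximalIdeal RC) RC := by
  rw [PowerSeries.maximalIdeal_eq_span_X]; infer_instance

/-- Distinguished polynomials over `ℂ[[x]]`. -/
abbrev Dist (D : RC[X]) : Prop := D.IsDistinguishedAt (IsLocalRing.maximalIdeal RC)

theorem mem_max_iff (r : RC) : r ∈ IsLocalRing.maximalIdeal RC ↔ PowerSeries.X ∣ r := by
  rw [PowerSeries.maximalIdeal_eq_span_X, Ideal.mem_span_singleton]

theorem dvd_of_coe_dvd {D F : RC[X]} (hD : Dist D)
    (h : (D : PowerSeries RC) ∣ (F : PowerSeries RC)) : D ∣ F := by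
  have h1 : hD.algEquivQuotient (Ideal.Quotient.mk _ F) = 0 := by
    rw [Polynomial.IsDistinguishedAt.algEquivQuotient_apply]
    change Ideal.Quotient.mk _ ((F : PowerSeries RC)) = 0
    · rw [Ideal.Quotient.eq_zero_iff_mem, Ideal.mem_span_singleton]
      exact h
  rw [EmbeddingLike.map_eq_zero_iff, Ideal.Quotient.eq_zero_iff_mem,
    Ideal.mem_span_singleton] at h1
  exact h1

theorem map_residue_ne_zero {g : PowerSeries RC} (h : ¬ PowerSeries.C (PowerSeries.X : RC) ∣ g) :
    g.map (IsLocalRing.residue RC) ≠ 0 := by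
  intro h0
  apply h
  have : ∀ n, ∃ c, PowerSeries.coeff n g = PowerSeries.X * c := by
    intro n
    have := congrArg (PowerSeries.coeff n) h0
    rw [PowerSeries.coeff_map, map_zero, IsLocalRing.residue_eq_zero_iff, mem_max_iff] at this
    exact this
  choose c hc using this
  refine ⟨PowerSeries.mk c, ?_⟩
  ext1 n
  rw [PowerSeries.coeff_C_mul, PowerSeries.coeff_mk, hc]

theorem poly_weierstrass {F : RC[X]} (h : ¬ Polynomial.C (PowerSeries.X : RC) ∣ F) :
    ∃ D U : RC[X], F = D * U ∧ Dist D ∧ IsUnit (U.coeff 0) := by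
  have h' : ¬ PowerSeries.C (PowerSeries.X : RC) ∣ (F : PowerSeries RC) := by
    rintro ⟨g, hg⟩
    apply h
    rw [Polynomial.C_dvd_iff_dvd_coeff]
    intro i
    refine ⟨PowerSeries.coeff i g, ?_⟩
    rw [← Polynomial.coeff_coe, hg, PowerSeries.coeff_C_mul]
  obtain ⟨D, u, hDu⟩ := PowerSeries.exists_isWeierstrassFactorization (map_residue_ne_zero h')
  have hD : Dist D := hDu.isDistinguishedAt
  obtain ⟨U, hU⟩ := dvd_of_coe_dvd hD ⟨u, hDu.eq_mul⟩
  refine ⟨D, U, hU, hD, ?_⟩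
  have h2 : (D : PowerSeries RC) * U = D * u := by
    rw [← hDu.eq_mul, hU, Polynomial.coe_mul]
  have hD0 : (D : PowerSeries RC) ≠ 0 := by
    simpa using hD.monic.ne_zero
  have h3 := mul_left_cancel₀ hD0 h2
  have h4 := hDu.isUnit
  rw [← h3, PowerSeries.isUnit_iff_constantCoeff, Polynomial.constantCoeff_coe] at h4
  exact h4

section core

variable {M : Type*} [Field M] [Algebra RC M] [FaithfulSMul RC M]

theorem integral_or_inv [Algebra.IsAlgebraic RC M] (a : M) :
    IsIntegral RC a ∨ IsIntegral RC a⁻¹ := by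
  by_cases ha : a = 0
  · left; rw [ha]; exact isIntegral_zero
  obtain ⟨F, hF0, hF⟩ := Algebra.IsAlgebraic.isAlgebraic (R := RC) a
  have hnu : ¬ IsUnit (Polynomial.C (PowerSeries.X : RC)) := by
    rw [Polynomial.isUnit_C]; exact PowerSeries.X_prime.not_isUnit
  obtain ⟨G, hG, hGn⟩ := (FiniteMultiplicity.of_not_isUnit hnu hF0).exists_eq_pow_mul_and_not_dvd
  obtain ⟨D, U, hDU, hD, hU⟩ := poly_weierstrass hGn
  have hX : algebraMap RC M PowerSeries.X ≠ 0 := by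
    rw [Ne, FaithfulSMul.algebraMap_eq_zero_iff]; exact PowerSeries.X_ne_zero
  rw [hG, map_mul, map_pow, Polynomial.aeval_C, mul_eq_zero] at hF
  have hGa : Polynomial.aeval a G = 0 := hF.resolve_left (pow_ne_zero _ hX)
  rw [hDU, map_mul, mul_eq_zero] at hGa
  rcases hGa with h | h
  · left; exact ⟨D, hD.monic, h⟩
  · right
    let _ := invertibleOfNonzero ha
    have h2 := (Polynomial.eval₂_reverse_eq_zero_iff (algebraMap RC M) a U).2 h
    rw [invOf_eq_inv] at h2
    have h3 := isIntegral_leadingCoeff_smul U.reverse (a⁻¹) h2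
    rw [Polynomial.reverse_leadingCoeff, Polynomial.trailingCoeff,
      Polynomial.natTrailingDegree_eq_zero.2 (Or.inr hU.ne_zero)] at h3
    obtain ⟨u, hu⟩ := hU
    have h4 := h3.smul (↑u⁻¹ : RC)
    rw [← hu, smul_smul] at h4
    simpa using h4

/-- the integral closure as a valuation ring. -/
def OO (M : Type*) [Field M] [Algebra RC M] [FaithfulSMul RC M] [Algebra.IsAlgebraic RC M] :
    ValuationSubring M :=
  ⟨(integralClosure RC M).toSubring, fun x => integral_or_inv x⟩

variable [Algebra.IsAlgebraic RC M]

theorem mem_OO (a : M) : a ∈ OO M ↔ IsIntegral RC a := Iff.rfl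

theorem val_lt_one_iff (a : M) : (OO M).valuation a < 1 ↔ a = 0 ∨ ¬ IsIntegral RC a⁻¹ := by
  by_cases ha : a = 0
  · simp [ha]
  have h0 : (OO M).valuation a ≠ 0 := by simpa using ha
  rw [← mem_OO, ← ValuationSubring.valuation_le_one_iff, map_inv₀, not_le,
    one_lt_inv₀ (zero_lt_iff.2 h0)]
  simp [ha]

/-- constants -/
def cc (M : Type*) [Field M] [Algebra RC M] : ℂ →+* M := (algebraMap RC M).comp PowerSeries.C

theorem val_algebraMap_le (r : RC) : (OO M).valuation (algebraMap RC M r) ≤ 1 := by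
  rw [ValuationSubring.valuation_le_one_iff, mem_OO]
  exact isIntegral_algebraMap

theorem val_X_lt : (OO M).valuation (algebraMap RC M PowerSeries.X) < 1 := by
  rw [val_lt_one_iff]
  right
  intro h
  have hloc := Algebra.IsIntegral.isLocalHom RC (integralClosure RC M)
  have hu : IsUnit (algebraMap RC (integralClosure RC M) PowerSeries.X) := by
    refine IsUnit.of_mul_eq_one (⟨_, h⟩ : integralClosure RC M) ?_
    apply Subtype.ext
    change algebraMap RC M PowerSeries.X * (algebraMap RC M PowerSeries.X)⁻¹ = 1
    apply mul_inv_cancel₀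
    rw [Ne, FaithfulSMul.algebraMap_eq_zero_iff]; exact PowerSeries.X_ne_zero
  exact PowerSeries.X_prime.not_isUnit (hloc.map_nonunit _ hu)

theorem val_cc {z : ℂ} (hz : z ≠ 0) : ¬ (OO M).valuation (cc M z) < 1 := by
  rw [val_lt_one_iff, ← map_inv₀]
  push Not
  refine ⟨by simpa using hz, isIntegral_algebraMap⟩

theorem exists_residue {b : M} (hb : (OO M).valuation b ≤ 1) :
    ∃ z : ℂ, (OO M).valuation (b - cc M z) < 1 := by
  have hb' := hb
  rw [ValuationSubring.valuation_le_one_iff, mem_OO] at hb'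
  obtain ⟨F, hFm, hF⟩ := hb'
  set G : ℂ[X] := F.map (PowerSeries.constantCoeff (R := ℂ)) with hG
  have hGm : G.Monic := hFm.map _
  have h1 : (OO M).valuation (G.eval₂ (cc M) b) < 1 := by
    have : G.eval₂ (cc M) b = - (Polynomial.aeval b (F - G.map PowerSeries.C)) := by
      have hr : Polynomial.eval₂ (algebraMap RC M) b (G.map PowerSeries.C)
          = Polynomial.eval₂ (cc M) b G := Polynomial.eval₂_map _ _ _
      rw [map_sub, Polynomial.aeval_def, hF, zero_sub, neg_neg, Polynomial.aeval_def, hr]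
    rw [this, Valuation.map_neg, Polynomial.aeval_eq_sum_range]
    apply Valuation.map_sum_lt _ one_ne_zero
    intro i _
    have h2 : PowerSeries.X ∣ (F - G.map PowerSeries.C).coeff i := by
      rw [PowerSeries.X_dvd_iff]
      simp [hG]
    obtain ⟨c, hc⟩ := h2
    rw [hc, Algebra.smul_def, map_mul, map_mul, map_mul, map_pow]
    have e1 := val_X_lt (M := M)
    have e2 := val_algebraMap_le (M := M) c
    calc _ ≤ (OO M).valuation (algebraMap RC M PowerSeries.X) * 1 * 1 := by
          gcongr
          exact pow_le_one' hb i
      _ < 1 := by simpa using e1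
  rw [(IsAlgClosed.splits G).eq_prod_roots_of_monic hGm, ← Polynomial.coe_eval₂RingHom,
    map_multiset_prod, map_multiset_prod] at h1
  by_contra hcon
  push Not at hcon
  apply h1.not_ge
  apply Multiset.one_le_prod
  intro x hx
  simp only [Multiset.map_map, Multiset.mem_map] at hx
  obtain ⟨z, _, rfl⟩ := hx
  simpa using hcon z

variable (σ : M →+* M)

theorem integral_map
    (hσR : ∀ r : RC, σ (algebraMap RC M r) = algebraMap RC M (r.map (starRingEnd ℂ)))
    {a : M} (ha : IsIntegral RC a) : IsIntegral RC (σ a) := by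
  obtain ⟨F, hFm, hF⟩ := ha
  refine ⟨F.map (PowerSeries.map (starRingEnd ℂ)), hFm.map _, ?_⟩
  rw [Polynomial.eval₂_map]
  have := congrArg σ hF
  rw [Polynomial.hom_eval₂, map_zero] at this
  rw [← this]
  congr 1
  ext1 r
  exact (hσR r).symm

theorem val_map
    (hσ : ∀ m, σ (σ m) = m)
    (hσR : ∀ r : RC, σ (algebraMap RC M r) = algebraMap RC M (r.map (starRingEnd ℂ)))
    {a : M} (ha : (OO M).valuation a < 1) : (OO M).valuation (σ a) < 1 := by
  rw [val_lt_one_iff] at ha ⊢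
  rcases ha with h | h
  · left; rw [h, map_zero]
  · right
    intro h2
    apply h
    have := integral_map σ hσR h2
    rwa [map_inv₀, hσ] at this

theorem exists_real_residue
    (hσ : ∀ m, σ (σ m) = m)
    (hσR : ∀ r : RC, σ (algebraMap RC M r) = algebraMap RC M (r.map (starRingEnd ℂ)))
    {b : M} (hb : (OO M).valuation b ≤ 1) (hbσ : σ b = b) :
    ∃ z : ℝ, (OO M).valuation (b - cc M z) < 1 := by
  obtain ⟨z, hz⟩ := exists_residue hb
  have h2 := val_map σ hσ hσR hz
  have h3 : σ (cc M z) = cc M (starRingEnd ℂ z) := by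
    simp [cc, hσR]
  rw [map_sub, hbσ, h3] at h2
  have h4 : (OO M).valuation (cc M (z - starRingEnd ℂ z)) < 1 := by
    have : cc M (z - starRingEnd ℂ z) = (b - cc M (starRingEnd ℂ z)) - (b - cc M z) := by
      rw [map_sub]; ring
    rw [this]
    exact Valuation.map_sub_lt _ h2 hz
  have h5 : z - starRingEnd ℂ z = 0 := by
    by_contra h
    exact val_cc h h4
  rw [sub_eq_zero] at h5
  obtain ⟨r, hr⟩ := Complex.conj_eq_iff_real.1 h5.symm
  exact ⟨r, hr ▸ hz⟩

/-- `s` is a fixed square times a fixed unit with positive real residue. -/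
def Pos (s : M) : Prop := ∃ (b u : M) (r : ℝ), b ≠ 0 ∧ 0 < r ∧ s = b * b * u ∧ σ b = b ∧ σ u = u ∧
  (OO M).valuation (u - cc M r) < 1

theorem val_le_of_res {u : M} {z : ℂ} (h : (OO M).valuation (u - cc M z) < 1) :
    (OO M).valuation u ≤ 1 := by
  have : u = (u - cc M z) + cc M z := by ring
  rw [this]
  exact Valuation.map_add_le _ h.le (val_algebraMap_le _)

theorem res_mul {u v : M} {y z : ℂ} (h : (OO M).valuation (u - cc M z) < 1)
    (h' : (OO M).valuation (v - cc M y) < 1) :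
    (OO M).valuation (u * v - cc M (z * y)) < 1 := by
  have : u * v - cc M (z * y) = (u - cc M z) * v + cc M z * (v - cc M y) := by
    rw [map_mul]; ring
  rw [this]
  apply Valuation.map_add_lt
  · rw [map_mul]
    calc _ ≤ (OO M).valuation (u - cc M z) * 1 := by
          gcongr
          exact val_le_of_res h'
      _ < 1 := by simpa using h
  · rw [map_mul]
    calc _ ≤ 1 * (OO M).valuation (v - cc M y) := by
          gcongr
          exact val_algebraMap_le _
      _ < 1 := by simpa using h'

theorem Pos.add_sq
    (hσ : ∀ m, σ (σ m) = m)
    (hσR : ∀ r : RC, σ (algebraMap RC M r) = algebraMap RC M (r.map (starRingEnd ℂ)))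
    {s a : M} (hs : Pos σ s) (ha : σ a = a) : Pos σ (a * a + s) := by
  obtain ⟨b, u, r, hb, hr, rfl, hbσ, huσ, hu⟩ := hs
  rcases le_total ((OO M).valuation (a / b)) 1 with h | h
  · have hab : σ (a / b) = a / b := by rw [map_div₀, ha, hbσ]
    obtain ⟨z, hz⟩ := exists_real_residue σ hσ hσR h hab
    refine ⟨b, a / b * (a / b) + u, z * z + r, hb,
      add_pos_of_nonneg_of_pos (mul_self_nonneg z) hr, by field_simp, hbσ, ?_, ?_⟩
    · rw [map_add, map_mul, hab, huσ]
    · have : a / b * (a / b) + u - cc M ((z * z + r : ℝ) : ℂ)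
          = (a / b * (a / b) - cc M (z * z)) + (u - cc M r) := by
        push_cast; rw [map_add]; ring
      rw [this]
      exact Valuation.map_add_lt _ (res_mul hz hz) hu
  · have ha0 : a ≠ 0 := by
      rintro rfl
      simp at h
    have h' : (OO M).valuation (b / a) ≤ 1 := by
      rw [← inv_div, map_inv₀]
      exact inv_le_one_of_one_le₀ h
    have hab : σ (b / a) = b / a := by rw [map_div₀, ha, hbσ]
    obtain ⟨z, hz⟩ := exists_real_residue σ hσ hσR h' hab
    refine ⟨a, 1 + b / a * (b / a) * u, 1 + z * z * r, ha0,
      add_pos_of_pos_of_nonneg one_pos (mul_nonneg (mul_self_nonneg z) hr.le), by field_simp, ha,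
      ?_, ?_⟩
    · rw [map_add, map_mul, map_mul, hab, huσ, map_one]
    · have : 1 + b / a * (b / a) * u - cc M ((1 + z * z * r : ℝ) : ℂ)
          = (b / a * (b / a) * u - cc M (z * z * r)) := by
        push_cast; rw [map_add, map_one]; ring
      rw [this]
      exact res_mul (res_mul hz hz) hu

theorem core_real
    (hσ : ∀ m, σ (σ m) = m)
    (hσR : ∀ r : RC, σ (algebraMap RC M r) = algebraMap RC M (r.map (starRingEnd ℂ)))
    {A : Type*} [CommRing A] (ψ : A →+* M) (hψ : ∀ a, σ (ψ a) = ψ a) {a s : A}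
    (hs : IsSumSq s) (h : ψ (a * a + s) = 0) : ψ a = 0 := by
  by_contra ha
  have key : Pos σ (ψ (a * a + s)) := by
    clear h
    induction hs using IsSumSq.rec' with
    | zero =>
      refine ⟨ψ a, 1, 1, ha, one_pos, by simp, hψ a, map_one _, by simp⟩
    | sq_add hx hs ih =>
      rename_i x s
      obtain ⟨c, rfl⟩ := hx
      have : a * a + (c * c + s) = c * c + (a * a + s) := by ring
      rw [this, map_add, map_mul]
      exact ih.add_sq σ hσ hσR (hψ c)
  rw [h] at key
  obtain ⟨b, u, r, hb, hr, h0, -, -, hu⟩ := key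
  have hu0 : u = 0 := by simpa [hb] using h0.symm
  rw [hu0, zero_sub, Valuation.map_neg] at hu
  exact val_cc (by exact_mod_cast hr.ne') hu

end core

end QuadSOS
namespace QuadSOS

section abstract_part

variable {A : Type*} [CommRing A]

/-- real primes -/
def RealPrime (q : A) : Prop := Prime q ∧ ∀ a s : A, IsSumSq s → q ∣ a * a + s → q ∣ a

theorem RealPrime.sumsq {q : A} (hq : RealPrime q) {s : A} (hs : IsSumSq s) (h : q ∣ s) :
    ∃ s', IsSumSq s' ∧ s = q * q * s' := by
  induction hs using IsSumSq.rec' with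
  | zero => exact ⟨0, IsSumSq.zero, by simp⟩
  | sq_add hx hs ih =>
    rename_i x s
    obtain ⟨c, rfl⟩ := hx
    obtain ⟨d, rfl⟩ := hq.2 c s hs h
    have h2 : q ∣ s := by
      have := dvd_sub h (Dvd.intro (d * (q * d)) rfl : q ∣ q * (d * (q * d)))
      convert this using 1
      ring
    obtain ⟨s', hs', rfl⟩ := ih h2
    exact ⟨d * d + s', (IsSumSq.mul_self d).add hs', by ring⟩

variable [IsDomain A] [WfDvdMonoid A]

theorem formally_real {q : A} (hq : RealPrime q) (a : A) :
    ∀ s : A, IsSumSq s → a * a + s = 0 → a = 0 := by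
  induction a using (wellFounded_dvdNotUnit (α := A)).induction with
  | _ a ih =>
    intro s hs h
    by_contra ha
    obtain ⟨d, rfl⟩ := hq.2 a s hs (h ▸ dvd_zero q)
    have hqs : q ∣ s := by
      have : s = q * (- (d * (q * d))) := by linear_combination h
      exact ⟨_, this⟩
    obtain ⟨s', hs', rfl⟩ := hq.sumsq hs hqs
    have hd : d ≠ 0 := right_ne_zero_of_mul ha
    apply hd
    refine ih d ⟨hd, q, hq.1.not_isUnit, mul_comm _ _⟩ s' hs' ?_
    have h2 : (q * q) * (d * d + s') = 0 := by linear_combination h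
    exact (mul_eq_zero.1 h2).resolve_left (mul_ne_zero hq.1.ne_zero hq.1.ne_zero)

theorem descent {q g : A} (hq : RealPrime q) (hg : ¬ q ∣ g) (h : A) :
    h ≠ 0 → ¬ IsSumSq (h * h * (q * g)) := by
  induction h using (wellFounded_dvdNotUnit (α := A)).induction with
  | _ h ih =>
    intro hh hs
    obtain ⟨s', hs', he⟩ := hq.sumsq hs ⟨h * h * g, by ring⟩
    have h2 : h * h * g = q * s' := by
      apply mul_left_cancel₀ hq.1.ne_zero
      linear_combination he
    have h3 : q ∣ h := by
      rcases hq.1.dvd_or_dvd ⟨s', h2⟩ with h4 | h4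
      · exact (hq.1.dvd_or_dvd h4).elim id id
      · exact absurd h4 hg
    obtain ⟨d, rfl⟩ := h3
    have hd : d ≠ 0 := right_ne_zero_of_mul hh
    refine ih d ⟨hd, q, hq.1.not_isUnit, mul_comm _ _⟩ hd ?_
    have : d * d * (q * g) = s' := by
      apply mul_left_cancel₀ hq.1.ne_zero
      linear_combination h2
    rwa [this]

theorem abstract_main
    (hU : ∀ u : A, IsUnit u → IsSquare u ∨ IsSquare (-u))
    (hR : ∀ a s : A, IsSumSq s → a * a + s = 0 → a = 0)
    (hF : ∀ g : A, g ≠ 0 → ¬ IsUnit g →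
      (∃ q, q ∣ g ∧ RealPrime q) ∨ (∃ n, n ∣ g ∧ ¬ IsUnit n ∧ IsSumSq n)) (g : A) :
    ∀ h : A, h ≠ 0 → IsSumSq (h * h * g) → IsSumSq g := by
  induction g using (wellFounded_dvdNotUnit (α := A)).induction with
  | _ g ih =>
    intro h hh hs
    by_cases hg : g = 0
    · rw [hg]; exact IsSumSq.zero
    by_cases hu : IsUnit g
    · rcases hU g hu with hsq | ⟨w, hw⟩
      · exact hsq.isSumSq
      · exfalso
        have := hR (h * w) _ hs (by linear_combination (-(h * h)) * hw)
        rcases mul_eq_zero.1 this with h0 | h0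
        · exact hh h0
        · apply hg
          rw [h0] at hw
          simpa using hw
    rcases hF g hg hu with ⟨q, ⟨g1, rfl⟩, hq⟩ | ⟨n, ⟨g1, rfl⟩, hnu, hn⟩
    · by_cases hq1 : q ∣ g1
      · obtain ⟨g2, rfl⟩ := hq1
        have hg2 : g2 ≠ 0 := by
          rintro rfl
          simp at hg
        have h1 : IsSumSq g2 := by
          refine ih g2 ⟨hg2, q * q, ?_, by ring⟩ (h * q) (mul_ne_zero hh hq.1.ne_zero) ?_
          · intro hqq
            exact hq.1.not_isUnit (isUnit_of_mul_isUnit_left hqq)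
          · convert hs using 1
            ring
        rw [← mul_assoc]
        exact (IsSumSq.mul_self q).mul h1
      · exact absurd hs (descent hq hq1 h hh)
    · have hg1 : g1 ≠ 0 := right_ne_zero_of_mul hg
      have hn0 : n ≠ 0 := left_ne_zero_of_mul hg
      refine hn.mul (ih g1 ⟨hg1, n, hnu, mul_comm _ _⟩ (h * n) (mul_ne_zero hh hn0) ?_)
      convert hn.mul hs using 1
      ring

end abstract_part

section units

theorem sqrt_one {R : Type*} [CommRing R] (h2 : IsUnit (2 : R)) (v : PowerSeries R)
    (hv : PowerSeries.constantCoeff v = 1) : IsSquare v := by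
  have := IsAdicComplete.henselianRing (PowerSeries R) (Ideal.span {PowerSeries.X})
  obtain ⟨a, ha, -⟩ := HenselianRing.is_henselian (I := Ideal.span {(PowerSeries.X : PowerSeries R)})
    (Polynomial.X ^ 2 - Polynomial.C v) (Polynomial.monic_X_pow_sub_C v two_ne_zero) 1
    (by
      rw [Ideal.mem_span_singleton, PowerSeries.X_dvd_iff]
      simp [hv])
    (by
      have e : Polynomial.eval 1 (Polynomial.derivative (Polynomial.X ^ 2 - Polynomial.C v))
        = PowerSeries.C (2 : R) := by
        have e2 : PowerSeries.C (2 : R) = 2 := map_ofNat _ 2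
        rw [e2]
        simp [one_add_one_eq_two]
      rw [e]
      exact ((h2.map PowerSeries.C).map (Ideal.Quotient.mk _)))
  refine ⟨a, ?_⟩
  rw [Polynomial.IsRoot] at ha
  simp at ha
  linear_combination -ha

theorem units_step {R : Type*} [CommRing R] (h2 : IsUnit (2 : R))
    (hU : ∀ u : R, IsUnit u → IsSquare u ∨ IsSquare (-u)) :
    ∀ u : PowerSeries R, IsUnit u → IsSquare u ∨ IsSquare (-u) := by
  have main : ∀ u : PowerSeries R, IsUnit u → IsSquare (PowerSeries.constantCoeff u) →
      IsSquare u := by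
    rintro u hu ⟨w, hw⟩
    have hc := hu.map (PowerSeries.constantCoeff (R := R))
    rw [hw] at hc
    obtain ⟨t, ht⟩ := (isUnit_of_mul_isUnit_left hc).exists_right_inv
    obtain ⟨b, hb⟩ := sqrt_one h2 (PowerSeries.C (t * t) * u) (by
      rw [map_mul, hw]
      simp
      linear_combination (w * t + 1) * ht)
    refine ⟨PowerSeries.C w * b, ?_⟩
    have e : PowerSeries.C w * PowerSeries.C t = (1 : PowerSeries R) := by
      rw [← map_mul, ht, map_one]
    rw [map_mul] at hb
    linear_combination (PowerSeries.C w * PowerSeries.C w) * hb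
      - (PowerSeries.C w * PowerSeries.C t + 1) * u * e
  intro u hu
  rcases hU _ (hu.map (PowerSeries.constantCoeff (R := R))) with h | h
  · exact Or.inl (main u hu h)
  · right
    apply main _ hu.neg
    rwa [map_neg]

/-- `ℝ[[x]][[y]]` -/
abbrev A0 : Type := PowerSeries (PowerSeries ℝ)

theorem units_A0 : ∀ u : A0, IsUnit u → IsSquare u ∨ IsSquare (-u) := by
  have hR : IsUnit (2 : ℝ) := isUnit_iff_ne_zero.2 two_ne_zero
  have hR1 : IsUnit (2 : PowerSeries ℝ) := by
    have e2 : PowerSeries.C (2 : ℝ) = 2 := map_ofNat _ 2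
    rw [← e2]
    exact hR.map (PowerSeries.C (R := ℝ))
  apply units_step hR1
  apply units_step hR
  intro u _
  rcases le_total 0 u with h | h
  · exact Or.inl ⟨√u, (Real.mul_self_sqrt h).symm⟩
  · exact Or.inr ⟨√(-u), (Real.mul_self_sqrt (by linarith)).symm⟩

end units

end QuadSOS
namespace QuadSOS

open scoped Polynomial

/-- `ℂ[[x]][[y]]` -/
abbrev CC : Type := PowerSeries RC

/-- the algebra structure by constants, preferred over the mapped one -/
instance instAlgCC : Algebra RC CC :=
  MvPowerSeries.instAlgebra

/-- inclusion of real into complex power series -/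
def jj : A0 →+* CC := PowerSeries.map (PowerSeries.map Complex.ofRealHom)

/-- coefficientwise conjugation -/
def sg : CC →+* CC := PowerSeries.map (PowerSeries.map (starRingEnd ℂ))

theorem coeff_jj (a : A0) (m n : ℕ) : PowerSeries.coeff m (PowerSeries.coeff n (jj a)) =
    ((PowerSeries.coeff m (PowerSeries.coeff n a) : ℝ) : ℂ) := by
  simp [jj]

theorem coeff_sg (a : CC) (m n : ℕ) : PowerSeries.coeff m (PowerSeries.coeff n (sg a)) =
    (starRingEnd ℂ) (PowerSeries.coeff m (PowerSeries.coeff n a)) := by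
  simp [sg]

theorem sg_sg (c : CC) : sg (sg c) = c := by
  ext n m
  simp [coeff_sg]

theorem sg_jj (a : A0) : sg (jj a) = jj a := by
  ext n m
  simp [coeff_sg, coeff_jj]

theorem jj_injective : Function.Injective jj := by
  intro a b h
  ext n m
  have := congrArg (fun c => PowerSeries.coeff m (PowerSeries.coeff n c)) h
  simp only [coeff_jj] at this
  exact_mod_cast this

theorem exists_jj {c : CC} (h : sg c = c) : ∃ a, jj a = c := by
  refine ⟨PowerSeries.mk fun n => PowerSeries.mk fun m =>
    (PowerSeries.coeff m (PowerSeries.coeff n c)).re, ?_⟩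
  ext n m
  rw [coeff_jj, PowerSeries.coeff_mk, PowerSeries.coeff_mk]
  apply Complex.conj_eq_iff_re.1
  rw [← coeff_sg, h]

theorem jj_dvd {a b : A0} (h : jj a ∣ jj b) : a ∣ b := by
  obtain ⟨c, hc⟩ := h
  by_cases ha : jj a = 0
  · rw [ha, zero_mul] at hc
    have : b = 0 := jj_injective (by rw [hc, map_zero])
    rw [this]; exact dvd_zero a
  have h2 : sg c = c := by
    have := congrArg sg hc
    rw [map_mul, sg_jj, sg_jj, hc] at this
    exact (mul_left_cancel₀ ha this).symm
  obtain ⟨d, rfl⟩ := exists_jj h2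
  refine ⟨d, jj_injective ?_⟩
  rw [hc, map_mul]

theorem jj_isUnit {a : A0} (h : IsUnit (jj a)) : IsUnit a := by
  rw [isUnit_iff_dvd_one] at h ⊢
  rw [← map_one jj] at h
  exact jj_dvd h

/-- conjugation as an equivalence -/
def sgE : CC ≃+* CC := RingEquiv.ofRingHom sg sg (RingHom.ext sg_sg) (RingHom.ext sg_sg)

theorem norm_sumsq (c : CC) : ∃ n : A0, IsSumSq n ∧ jj n = c * sg c := by
  set h : CC := PowerSeries.C (PowerSeries.C (1 / 2 : ℂ)) with hh
  set i : CC := PowerSeries.C (PowerSeries.C Complex.I) with hi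
  have e1 : 2 * h = 1 := by
    have : (2 : CC) = PowerSeries.C (PowerSeries.C 2) := by simp only [map_ofNat]
    rw [this, hh, ← map_mul, ← map_mul]
    norm_num
  have e2 : i * i = -1 := by
    rw [hi, ← map_mul, ← map_mul, Complex.I_mul_I]
    simp
  have e3 : sg h = h := by
    rw [hh, sg]
    simp only [PowerSeries.map_C]
    congr 2
    rw [map_div₀, map_one, map_ofNat]
  have e4 : sg i = -i := by
    rw [hi, sg]
    simp [PowerSeries.map_C]
  obtain ⟨a, ha⟩ := exists_jj (c := (c + sg c) * h) (by
    rw [map_mul, map_add, sg_sg, e3]; ring)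
  obtain ⟨b, hb⟩ := exists_jj (c := (c - sg c) * (i * h)) (by
    rw [map_mul, map_mul, map_sub, sg_sg, e3, e4]; ring)
  refine ⟨a * a + b * b, (IsSumSq.mul_self a).add (IsSumSq.mul_self b), ?_⟩
  rw [map_add, map_mul, map_mul, ha, hb]
  linear_combination (c * sg c) * (2 * h + 1) * e1 + (c - sg c) * (c - sg c) * h * h * e2

theorem coe_prime {q : RC[X]} (hD : Dist q) (hq : Prime q) : Prime (q : CC) := by
  have h0 : (q : CC) ≠ 0 := by simpa using hD.monic.ne_zero
  rw [← Ideal.span_singleton_prime h0]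
  rw [← Ideal.Quotient.isDomain_iff_prime]
  have : (Ideal.span {q}).IsPrime := (Ideal.span_singleton_prime hq.ne_zero).2 hq
  exact hD.algEquivQuotient.symm.toMulEquiv.isDomain _

theorem dist_of_dvd {P q : RC[X]} (hP : Dist P) (hq : q.Monic) (h : q ∣ P) : Dist q := by
  refine ⟨⟨?_⟩, hq⟩
  intro n hn
  have h1 := Polynomial.map_dvd (IsLocalRing.residue RC) h
  have h2 : P.map (IsLocalRing.residue RC) = Polynomial.X ^ P.natDegree := hP.map_eq_X_pow
  rw [h2, dvd_prime_pow Polynomial.prime_X] at h1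
  obtain ⟨m, -, hm⟩ := h1
  have h3 := Polynomial.eq_of_monic_of_associated (hq.map _) (Polynomial.monic_X_pow m) hm
  have h4 : m = q.natDegree := by
    rw [← hq.natDegree_map (IsLocalRing.residue RC), h3, Polynomial.natDegree_X_pow]
  have h5 := congrArg (fun p => Polynomial.coeff p n) h3
  simp only [Polynomial.coeff_map, Polynomial.coeff_X_pow] at h5
  rw [if_neg (by omega)] at h5
  rwa [IsLocalRing.residue_eq_zero_iff] at h5

theorem sg_coe (q : RC[X]) : sg (q : CC) = (q.map (PowerSeries.map (starRingEnd ℂ)) : RC[X]) := by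
  ext n m
  rw [coeff_sg, Polynomial.coeff_coe, Polynomial.coeff_coe, Polynomial.coeff_map,
    PowerSeries.coeff_map]

theorem dist_sg {q : RC[X]} (hq : Dist q) : Dist (q.map (PowerSeries.map (starRingEnd ℂ))) := by
  refine ⟨⟨?_⟩, hq.monic.map _⟩
  intro n hn
  rw [hq.monic.natDegree_map] at hn
  have := hq.mem hn
  rw [mem_max_iff] at this ⊢
  rw [Polynomial.coeff_map, PowerSeries.X_dvd_iff] at *
  rw [← PowerSeries.coeff_zero_eq_constantCoeff_apply] at this ⊢
  rw [PowerSeries.coeff_map, this, map_zero]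

section quotient

variable {q : RC[X]}

theorem isAlgebraic_frac {B : Type*} [CommRing B] [IsDomain B] [Algebra RC B]
    [Algebra.IsIntegral RC B] : Algebra.IsAlgebraic RC (FractionRing B) := by
  constructor
  intro m
  obtain ⟨a, b, -, rfl⟩ := IsFractionRing.div_surjective (A := B) m
  have key : ∀ c : B, IsAlgebraic RC (algebraMap B (FractionRing B) c) := fun c =>
    ((Algebra.IsIntegral.isIntegral (R := RC) c).map
      (IsScalarTower.toAlgHom RC B (FractionRing B))).isAlgebraic
  rw [div_eq_mul_inv]
  exact (key a).mul (key b).inv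

theorem real_of_dist (hD : Dist q) (hq : Prime q) {q0 : A0} (hq0 : jj q0 = (q : CC)) :
    RealPrime q0 := by
  have hp : Prime (jj q0) := by rw [hq0]; exact coe_prime hD hq
  have hp0 : Prime q0 := by
    refine ⟨?_, ?_, ?_⟩
    · rintro rfl
      exact hp.ne_zero (map_zero _)
    · intro h
      exact hp.not_isUnit (h.map jj)
    · intro a b h
      have := map_dvd jj h
      rw [map_mul] at this
      exact (hp.dvd_or_dvd this).imp jj_dvd jj_dvd
  refine ⟨hp0, ?_⟩
  intro a s hs hdvd
  let I : Ideal CC := Ideal.span {(q : CC)}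
  have hI : I.IsPrime := (Ideal.span_singleton_prime (hq0 ▸ hp.ne_zero)).2 (hq0 ▸ hp)
  let B := CC ⧸ I
  have hfin : Module.Finite RC (RC[X] ⧸ Ideal.span {q}) := hD.monic.finite_quotient
  have hfinB : Module.Finite RC B := Module.Finite.equiv hD.algEquivQuotient.toLinearEquiv
  have hintegral : Algebra.IsIntegral RC B := inferInstance
  let M := FractionRing B
  have halg : Algebra.IsAlgebraic RC M := isAlgebraic_frac
  have hinjB : Function.Injective (algebraMap RC B) := by
    rw [injective_iff_map_eq_zero]
    intro r hr
    have h1 : (Ideal.Quotient.mk I) (PowerSeries.C r) = 0 := hr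
    rw [Ideal.Quotient.eq_zero_iff_mem, Ideal.mem_span_singleton, ← Polynomial.coe_C] at h1
    have h2 := dvd_of_coe_dvd hD h1
    by_contra hr0
    have h3 := Polynomial.natDegree_le_of_dvd h2 (by simpa using hr0)
    rw [Polynomial.natDegree_C] at h3
    have h4 := Polynomial.eq_one_of_monic_natDegree_zero hD.monic (Nat.le_zero.1 h3)
    exact hq.not_isUnit (h4 ▸ isUnit_one)
  have hinjM : Function.Injective (algebraMap B M) := IsFractionRing.injective B M
  have hfaith : FaithfulSMul RC M := by
    rw [faithfulSMul_iff_algebraMap_injective, IsScalarTower.algebraMap_eq RC B M]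
    exact hinjM.comp hinjB
  have hsq : sg (q : CC) = q := by rw [← hq0, sg_jj]
  let σB : B →+* B := Ideal.Quotient.lift I ((Ideal.Quotient.mk I).comp sg) (by
    intro c hc
    rw [RingHom.comp_apply, Ideal.Quotient.eq_zero_iff_mem]
    rw [Ideal.mem_span_singleton] at hc ⊢
    have := map_dvd sg hc
    rwa [hsq] at this)
  have hσmk : ∀ c, σB (Ideal.Quotient.mk I c) = Ideal.Quotient.mk I (sg c) := fun c => rfl
  have hσB : ∀ b, σB (σB b) = b := by
    intro b
    obtain ⟨c, rfl⟩ := Ideal.Quotient.mk_surjective b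
    rw [hσmk, hσmk, sg_sg]
  have hσinj : Function.Injective ((algebraMap B M).comp σB) :=
    hinjM.comp (Function.LeftInverse.injective hσB)
  let σM : M →+* M := IsFractionRing.lift hσinj
  have hσa : ∀ b, σM (algebraMap B M b) = algebraMap B M (σB b) := fun b =>
    IsFractionRing.lift_algebraMap hσinj b
  let ψ : A0 →+* M := (algebraMap B M).comp ((Ideal.Quotient.mk I).comp jj)
  have key := core_real (M := M) σM
    (by
      intro m
      obtain ⟨a, b, -, rfl⟩ := IsFractionRing.div_surjective (A := B) m
      rw [map_div₀, map_div₀, hσa, hσa, hσa, hσa, hσB, hσB])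
    (by
      intro r
      rw [IsScalarTower.algebraMap_apply RC B M, IsScalarTower.algebraMap_apply RC B M, hσa]
      congr 1
      change σB (Ideal.Quotient.mk I (PowerSeries.C r)) = Ideal.Quotient.mk I (PowerSeries.C _)
      rw [hσmk, sg, PowerSeries.map_C])
    ψ
    (by
      intro a
      change σM (algebraMap B M (Ideal.Quotient.mk I (jj a))) = _
      rw [hσa, hσmk, sg_jj]
      rfl)
    (a := a) hs
    (by
      change algebraMap B M (Ideal.Quotient.mk I (jj (a * a + s))) = 0
      have : Ideal.Quotient.mk I (jj (a * a + s)) = 0 := by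
        rw [Ideal.Quotient.eq_zero_iff_mem, Ideal.mem_span_singleton, ← hq0]
        exact map_dvd jj hdvd
      rw [this, map_zero])
  have h2 : algebraMap B M (Ideal.Quotient.mk I (jj a)) = 0 := key
  have h3 : Ideal.Quotient.mk I (jj a) = 0 := hinjM (by rw [h2, map_zero])
  rw [Ideal.Quotient.eq_zero_iff_mem, Ideal.mem_span_singleton, ← hq0] at h3
  exact jj_dvd h3

end quotient

theorem isSumSq_map {A B : Type*} [CommRing A] [CommRing B] (f : A →+* B) {s : A}
    (hs : IsSumSq s) : IsSumSq (f s) := by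
  induction hs using IsSumSq.rec' with
  | zero => rw [map_zero]; exact IsSumSq.zero
  | sq_add hx hs ih =>
    obtain ⟨c, rfl⟩ := hx
    rw [map_add, map_mul]
    exact (IsSumSq.mul_self _).add ih

theorem realPrime_X : RealPrime (PowerSeries.X : PowerSeries ℝ) := by
  refine ⟨PowerSeries.X_prime, ?_⟩
  intro a s hs h
  rw [PowerSeries.X_dvd_iff] at h ⊢
  rw [map_add, map_mul] at h
  have h1 : 0 ≤ PowerSeries.constantCoeff s := (isSumSq_map PowerSeries.constantCoeff hs).nonneg
  have h2 := mul_self_nonneg (PowerSeries.constantCoeff a)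
  exact mul_self_eq_zero.1 (by linarith)

theorem CX_dvd_iff (g : A0) : PowerSeries.C (PowerSeries.X : PowerSeries ℝ) ∣ g ↔
    PowerSeries.map PowerSeries.constantCoeff g = 0 := by
  constructor
  · rintro ⟨c, rfl⟩
    rw [map_mul, PowerSeries.map_C]
    simp
  · intro h
    have : ∀ n, ∃ c, PowerSeries.coeff n g = PowerSeries.X * c := by
      intro n
      have := congrArg (PowerSeries.coeff n) h
      rw [PowerSeries.coeff_map, map_zero] at this
      exact PowerSeries.X_dvd_iff.2 this
    choose c hc using this
    refine ⟨PowerSeries.mk c, ?_⟩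
    ext1 n
    rw [PowerSeries.coeff_C_mul, PowerSeries.coeff_mk, hc]

theorem realPrime_CX : RealPrime (PowerSeries.C (PowerSeries.X : PowerSeries ℝ)) := by
  refine ⟨⟨?_, ?_, ?_⟩, ?_⟩
  · intro h
    exact PowerSeries.X_ne_zero (PowerSeries.C_injective (by rw [h, map_zero]))
  · intro h
    have := h.map (PowerSeries.constantCoeff (R := PowerSeries ℝ))
    rw [PowerSeries.constantCoeff_C] at this
    exact PowerSeries.X_prime.not_isUnit this
  · intro a b h
    rw [CX_dvd_iff] at *
    rw [map_mul, mul_eq_zero] at h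
    rwa [CX_dvd_iff]
  · intro a s hs h
    rw [CX_dvd_iff] at *
    rw [map_add, map_mul] at h
    exact formally_real realPrime_X _ _ (isSumSq_map _ hs) h

theorem factor_A0 (g : A0) (hg : g ≠ 0) (hu : ¬ IsUnit g) :
    (∃ q, q ∣ g ∧ RealPrime q) ∨ (∃ n, n ∣ g ∧ ¬ IsUnit n ∧ IsSumSq n) := by
  by_cases hX : PowerSeries.C (PowerSeries.X : RC) ∣ jj g
  · left
    refine ⟨_, ?_, realPrime_CX⟩
    apply jj_dvd
    rw [jj, PowerSeries.map_C, PowerSeries.map_X]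
    exact hX
  obtain ⟨P, u, hPu⟩ := PowerSeries.exists_isWeierstrassFactorization (map_residue_ne_zero hX)
  have hP : Dist P := hPu.isDistinguishedAt
  have hPnu : ¬ IsUnit P := by
    intro h
    apply hu
    apply jj_isUnit
    rw [hPu.eq_mul]
    exact (h.map (Polynomial.coeToPowerSeries.ringHom (R := RC))).mul hPu.isUnit
  obtain ⟨q1, hq1, hq1P⟩ := WfDvdMonoid.exists_irreducible_factor hPnu hP.monic.ne_zero
  have hlead : IsUnit q1.leadingCoeff := by
    obtain ⟨r, hr⟩ := hq1P
    have := congrArg Polynomial.leadingCoeff hr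
    rw [hP.monic.leadingCoeff, Polynomial.leadingCoeff_mul] at this
    exact IsUnit.of_mul_eq_one _ this.symm
  obtain ⟨q, hqm, hqa⟩ : ∃ q : RC[X], q.Monic ∧ Associated q1 q := by
    obtain ⟨t, ht⟩ := hlead.exists_right_inv
    have htu : IsUnit t := IsUnit.of_mul_eq_one _ (by rwa [mul_comm] at ht)
    refine ⟨q1 * Polynomial.C t, Polynomial.monic_mul_C_of_leadingCoeff_mul_eq_one ht, ?_⟩
    exact associated_mul_unit_right _ _ (htu.map Polynomial.C)
  have hqp : Prime q := (hqa.prime_iff).1 hq1.prime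
  have hqP : q ∣ P := hqa.dvd_iff_dvd_left.1 hq1P
  have hD : Dist q := dist_of_dvd hP hqm hqP
  have hqg : (q : CC) ∣ jj g := by
    rw [hPu.eq_mul]
    obtain ⟨r, rfl⟩ := hqP
    rw [Polynomial.coe_mul, mul_assoc]
    exact dvd_mul_right _ _
  by_cases hs : sg (q : CC) = q
  · left
    obtain ⟨q0, hq0⟩ := exists_jj hs
    refine ⟨q0, jj_dvd (hq0 ▸ hqg), real_of_dist hD hqp hq0⟩
  · right
    obtain ⟨n, hn, hjn⟩ := norm_sumsq (q : CC)
    have hsp : Prime (sg (q : CC)) := (MulEquiv.prime_iff sgE.toMulEquiv).2 (coe_prime hD hqp)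
    refine ⟨n, ?_, ?_, hn⟩
    · apply jj_dvd
      rw [hjn]
      obtain ⟨c, hc⟩ := hqg
      have h1 : sg (q : CC) ∣ q * c := by
        rw [← hc, ← sg_jj, hc, map_mul]
        exact dvd_mul_right _ _
      rw [hc]
      apply mul_dvd_mul_left
      refine (hsp.dvd_or_dvd h1).resolve_left ?_
      intro h2
      apply hs
      rw [sg_coe] at h2 ⊢
      have h3 := dvd_of_coe_dvd (dist_sg hD) h2
      congr 1
      refine (Polynomial.eq_of_monic_of_dvd_of_natDegree_le (hqm.map _) hqm h3 ?_).symm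
      rw [hqm.natDegree_map]
    · intro h
      have h1 := h.map jj
      rw [hjn] at h1
      exact (coe_prime hD hqp).not_isUnit (isUnit_of_mul_isUnit_left h1)

theorem main_A0 (g h : A0) (hh : h ≠ 0) (hs : IsSumSq (h * h * g)) : IsSumSq g :=
  abstract_main units_A0 (fun a => formally_real realPrime_CX a) factor_A0 g h hh hs

end QuadSOS
namespace QuadSOS

section artin

/-- preorderings as sets -/
def IsPre {K : Type*} [Field K] (T : Set K) : Prop :=
  (∀ a ∈ T, ∀ b ∈ T, a + b ∈ T) ∧ (∀ a ∈ T, ∀ b ∈ T, a * b ∈ T) ∧ (∀ a : K, a * a ∈ T)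

theorem IsPre.div {K : Type*} [Field K] {T : Set K} (hT : IsPre T) {a b : K} (hb0 : b ≠ 0)
    (hb : b ∈ T) (h : b * a ∈ T) : a ∈ T := by
  have h1 := hT.2.1 _ (hT.2.1 _ hb _ h) _ (hT.2.2 b⁻¹)
  convert h1 using 1
  field_simp

theorem IsPre.all {K : Type*} [Field K] (h2 : (2 : K) ≠ 0) {T : Set K} (hT : IsPre T) {a : K}
    (ha0 : a ≠ 0) (ha : a ∈ T) (hna : -a ∈ T) (f : K) : f ∈ T := by
  have h1 : (-1 : K) ∈ T := by
    refine hT.div ha0 ha ?_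
    rwa [mul_neg, mul_one]
  have h3 := hT.1 _ (hT.2.2 ((f + 1) / 2)) _ (hT.2.1 _ h1 _ (hT.2.2 ((f - 1) / 2)))
  convert h3 using 1
  field_simp
  ring

theorem exists_ordering {K : Type*} [Field K] (h2 : (2 : K) ≠ 0) {T : Set K} (hT : IsPre T)
    {f : K} (hf : f ∉ T) : ∃ P : Set K, IsOrderingF P ∧ T ⊆ P ∧ f ∉ P := by
  obtain ⟨P, hTP, hmax⟩ := zorn_subset_nonempty {Q : Set K | IsPre Q ∧ f ∉ Q} (by
    intro c hc hchain hne
    refine ⟨⋃₀ c, ⟨⟨?_, ?_, ?_⟩, ?_⟩, fun s hs => Set.subset_sUnion_of_mem hs⟩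
    · rintro a ⟨Q, hQ, ha⟩ b ⟨R, hR, hb⟩
      rcases hchain.total hQ hR with h | h
      · exact ⟨R, hR, (hc hR).1.1 _ (h ha) _ hb⟩
      · exact ⟨Q, hQ, (hc hQ).1.1 _ ha _ (h hb)⟩
    · rintro a ⟨Q, hQ, ha⟩ b ⟨R, hR, hb⟩
      rcases hchain.total hQ hR with h | h
      · exact ⟨R, hR, (hc hR).1.2.1 _ (h ha) _ hb⟩
      · exact ⟨Q, hQ, (hc hQ).1.2.1 _ ha _ (h hb)⟩
    · intro a
      obtain ⟨Q, hQ⟩ := hne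
      exact ⟨Q, hQ, (hc hQ).1.2.2 a⟩
    · rintro ⟨Q, hQ, ha⟩
      exact (hc hQ).2 ha) T ⟨hT, hf⟩
  obtain ⟨hP, hfP⟩ := hmax.prop
  have h0 : (0 : K) ∈ P := by simpa using hP.2.2 0
  have h1 : (1 : K) ∈ P := by simpa using hP.2.2 1
  have hanti : ∀ a : K, a ∈ P → -a ∈ P → a = 0 := by
    intro a ha hna
    by_contra h
    exact hfP (hP.all h2 h ha hna f)
  have hext : ∀ a : K, a ∉ P → ∃ s ∈ P, ∃ t ∈ P, f = s + t * a := by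
    intro a ha
    by_contra hcon
    apply ha
    have hle : P ⊆ {x | ∃ s ∈ P, ∃ t ∈ P, x = s + t * a} := fun x hx => ⟨x, hx, 0, h0, by simp⟩
    refine hmax.le_of_ge (y := {x | ∃ s ∈ P, ∃ t ∈ P, x = s + t * a})
      ⟨⟨?_, ?_, ?_⟩, hcon⟩ hle ⟨0, h0, 1, h1, by simp⟩
    · rintro _ ⟨s, hs, t, ht, rfl⟩ _ ⟨s', hs', t', ht', rfl⟩
      exact ⟨s + s', hP.1 _ hs _ hs', t + t', hP.1 _ ht _ ht', by ring⟩
    · rintro _ ⟨s, hs, t, ht, rfl⟩ _ ⟨s', hs', t', ht', rfl⟩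
      exact ⟨s * s' + t * t' * (a * a),
        hP.1 _ (hP.2.1 _ hs _ hs') _ (hP.2.1 _ (hP.2.1 _ ht _ ht') _ (hP.2.2 a)),
        s * t' + t * s', hP.1 _ (hP.2.1 _ hs _ ht') _ (hP.2.1 _ ht _ hs'), by ring⟩
    · intro x
      exact hle (hP.2.2 x)
  refine ⟨P, ⟨hP.1, hP.2.1, ?_, hanti⟩, hTP, hfP⟩
  intro a
  by_contra hcon
  push Not at hcon
  obtain ⟨s, hs, t, ht, e⟩ := hext a hcon.1
  obtain ⟨s', hs', t', ht', e'⟩ := hext (-a) hcon.2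
  by_cases htt : t + t' = 0
  · have : t = 0 := hanti t ht (by rwa [← eq_neg_of_add_eq_zero_right htt])
    apply hfP
    rw [e, this]
    simpa using hs
  · apply hfP
    refine hP.div htt (hP.1 _ ht _ ht') ?_
    have : (t + t') * f = t' * s + t * s' := by linear_combination t' * e + t * e'
    rw [this]
    have hsum := hP.1 _ (hP.2.1 _ ht' _ hs) _ (hP.2.1 _ ht _ hs')
    exact hsum

/-- the quadratic module-like description of the preordering generated by two elements -/
def TT {A : Type*} [CommRing A] (p r : A) : Set A :=
  {f | ∃ σ₀ σ₁ σ₂ σ₃ : A, IsSumSq σ₀ ∧ IsSumSq σ₁ ∧ IsSumSq σ₂ ∧ IsSumSq σ₃ ∧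
        f = σ₀ + σ₁ * p + σ₂ * r + σ₃ * (p * r)}

theorem TT_add {A : Type*} [CommRing A] {p r : A} {a b : A} (ha : a ∈ TT p r) (hb : b ∈ TT p r) :
    a + b ∈ TT p r := by
  obtain ⟨s0, s1, s2, s3, h0, h1, h2, h3, rfl⟩ := ha
  obtain ⟨t0, t1, t2, t3, k0, k1, k2, k3, rfl⟩ := hb
  exact ⟨s0 + t0, s1 + t1, s2 + t2, s3 + t3, h0.add k0, h1.add k1, h2.add k2, h3.add k3, by ring⟩

theorem TT_pre {K : Type*} [Field K] (p r : K) : IsPre (TT p r) := by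
  refine ⟨fun a ha b hb => TT_add ha hb, ?_, ?_⟩
  · rintro _ ⟨s0, s1, s2, s3, h0, h1, h2, h3, rfl⟩ _ ⟨t0, t1, t2, t3, k0, k1, k2, k3, rfl⟩
    have hp := IsSumSq.mul_self p
    have hr := IsSumSq.mul_self r
    refine ⟨s0 * t0 + s1 * t1 * (p * p) + s2 * t2 * (r * r) + s3 * t3 * ((p * p) * (r * r)),
      s0 * t1 + s1 * t0 + (s2 * t3 + s3 * t2) * (r * r),
      s0 * t2 + s2 * t0 + (s1 * t3 + s3 * t1) * (p * p),
      s0 * t3 + s3 * t0 + s1 * t2 + s2 * t1, ?_, ?_, ?_, ?_, by ring⟩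
    · exact (((h0.mul k0).add ((h1.mul k1).mul hp)).add ((h2.mul k2).mul hr)).add
        ((h3.mul k3).mul (hp.mul hr))
    · exact ((h0.mul k1).add (h1.mul k0)).add (((h2.mul k3).add (h3.mul k2)).mul hr)
    · exact ((h0.mul k2).add (h2.mul k0)).add (((h1.mul k3).add (h3.mul k1)).mul hp)
    · exact (((h0.mul k3).add (h3.mul k0)).add (h1.mul k2)).add (h2.mul k1)
  · intro a
    exact ⟨a * a, 0, 0, 0, IsSumSq.mul_self a, IsSumSq.zero, IsSumSq.zero, IsSumSq.zero, by simp⟩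

theorem clear_denoms {s : FF} (hs : IsSumSq s) :
    ∃ d t : PS, d ≠ 0 ∧ IsSumSq t ∧ ι (d * d) * s = ι t := by
  induction hs using IsSumSq.rec' with
  | zero => exact ⟨1, 0, one_ne_zero, IsSumSq.zero, by simp⟩
  | sq_add hx hs ih =>
    obtain ⟨c, rfl⟩ := hx
    obtain ⟨d, t, hd, ht, e⟩ := ih
    obtain ⟨a, b, hb, rfl⟩ := IsFractionRing.div_surjective (A := PS) c
    have hb0 : b ≠ 0 := nonZeroDivisors.ne_zero hb
    have hbi : ι b ≠ 0 := by
      rw [Ne, IsFractionRing.to_map_eq_zero_iff]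
      exact hb0
    refine ⟨b * d, (a * d) * (a * d) + b * b * t, mul_ne_zero hb0 hd,
      (IsSumSq.mul_self _).add ((IsSumSq.mul_self b).mul ht), ?_⟩
    simp only [map_mul, map_add] at e ⊢
    rw [← e]
    field_simp

theorem artin_part (f : PS)
    (hf : ∀ P : Set FF, IsOrderingF P → (ι psX ∈ P ∧ ι psX ≠ 0) →
      (ι psY ∈ P ∧ ι psY ≠ 0) → ι f ∈ P) :
    ∃ h : PS, h ≠ 0 ∧ h * h * f ∈ TT psX psY := by
  have hX : ∀ i : Fin 2, ι (MvPowerSeries.X i : PS) ≠ 0 := by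
    intro i
    rw [Ne, IsFractionRing.to_map_eq_zero_iff]
    intro h
    have h1 := congrArg (MvPowerSeries.coeff (Finsupp.single i 1)) h
    rw [MvPowerSeries.coeff_index_single_self_X, map_zero] at h1
    exact one_ne_zero h1
  have hT : ι f ∈ TT (ι psX) (ι psY) := by
    by_contra hcon
    have h2 : (2 : FF) ≠ 0 := by
      have : (2 : FF) = ι (MvPowerSeries.C (2 : ℝ)) := by simp only [map_ofNat]
      rw [this, Ne, IsFractionRing.to_map_eq_zero_iff]
      intro h
      have := congrArg (MvPowerSeries.constantCoeff (σ := Fin 2) (R := ℝ)) h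
      simp at this
    obtain ⟨P, hP, hTP, hfP⟩ := exists_ordering h2 (TT_pre _ _) hcon
    apply hfP
    have z : IsSumSq (0 : FF) := IsSumSq.zero
    have o : IsSumSq (1 : FF) := by simpa using IsSumSq.mul_self (1 : FF)
    exact hf P hP ⟨hTP ⟨0, 1, 0, 0, z, o, z, z, by simp⟩, hX 0⟩
      ⟨hTP ⟨0, 0, 1, 0, z, z, o, z, by simp⟩, hX 1⟩
  obtain ⟨s0, s1, s2, s3, h0, h1, h2, h3, e⟩ := hT
  obtain ⟨d0, t0, n0, k0, e0⟩ := clear_denoms h0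
  obtain ⟨d1, t1, n1, k1, e1⟩ := clear_denoms h1
  obtain ⟨d2, t2, n2, k2, e2⟩ := clear_denoms h2
  obtain ⟨d3, t3, n3, k3, e3⟩ := clear_denoms h3
  refine ⟨d0 * d1 * d2 * d3, mul_ne_zero (mul_ne_zero (mul_ne_zero n0 n1) n2) n3,
    (d1 * d2 * d3) * (d1 * d2 * d3) * t0, (d0 * d2 * d3) * (d0 * d2 * d3) * t1,
    (d0 * d1 * d3) * (d0 * d1 * d3) * t2, (d0 * d1 * d2) * (d0 * d1 * d2) * t3,
    (IsSumSq.mul_self _).mul k0, (IsSumSq.mul_self _).mul k1, (IsSumSq.mul_self _).mul k2,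
    (IsSumSq.mul_self _).mul k3, ?_⟩
  apply IsFractionRing.injective PS FF
  change ι _ = ι _
  simp only [map_mul, map_add] at *
  rw [e, ← e0, ← e1, ← e2, ← e3]
  ring

end artin

section expand_part

/-- the substitution `x ↦ x², y ↦ y²` -/
def ex : PS →ₐ[ℝ] PS := MvPowerSeries.expand 2 two_ne_zero

/-- halving exponents -/
def half (n : Fin 2 →₀ ℕ) : Fin 2 →₀ ℕ := n.mapRange (fun k => k / 2) rfl

theorem half_apply (n : Fin 2 →₀ ℕ) (i : Fin 2) : half n i = n i / 2 := rfl

theorem coeff_par (ε : Fin 2 →₀ ℕ) (hε : ∀ i, ε i ≤ 1) (F : PS) (n : Fin 2 →₀ ℕ) :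
    MvPowerSeries.coeff n (MvPowerSeries.monomial ε (1 : ℝ) * ex F) =
      if n 0 % 2 = ε 0 ∧ n 1 % 2 = ε 1 then MvPowerSeries.coeff (half n) F else 0 := by
  classical
  have h0 := hε 0
  have h1 := hε 1
  rw [MvPowerSeries.coeff_monomial_mul]
  split_ifs with hle hpar hpar
  · have : n - ε = 2 • half n := by
      ext i
      fin_cases i
      · simp [half_apply]; omega
      · simp [half_apply]; omega
    rw [this, ex, MvPowerSeries.coeff_expand_smul, one_mul]
  · rw [one_mul]
    by_cases hp : n 0 % 2 = ε 0
    · have hq : ¬ n 1 % 2 = ε 1 := fun h => hpar ⟨hp, h⟩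
      refine MvPowerSeries.coeff_expand_of_not_dvd 2 two_ne_zero F (i := 1) ?_
      have := hle 1
      rw [Finsupp.tsub_apply]
      omega
    · refine MvPowerSeries.coeff_expand_of_not_dvd 2 two_ne_zero F (i := 0) ?_
      have := hle 0
      rw [Finsupp.tsub_apply]
      omega
  · exfalso
    apply hle
    intro i
    fin_cases i
    · simp; omega
    · simp; omega
  · rfl

/-- monomials with exponents given by a pair -/
def ee (a b : ℕ) : Fin 2 →₀ ℕ := Finsupp.single 0 a + Finsupp.single 1 b

theorem ee_zero (a b : ℕ) : ee a b 0 = a := by simp [ee]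

theorem ee_one (a b : ℕ) : ee a b 1 = b := by simp [ee]

theorem mon00 : (MvPowerSeries.monomial (ee 0 0) (1 : ℝ) : PS) = 1 := by
  simp [ee]

theorem mon10 : (MvPowerSeries.monomial (ee 1 0) (1 : ℝ) : PS) = psX := by
  simp [ee, MvPowerSeries.X]

theorem mon01 : (MvPowerSeries.monomial (ee 0 1) (1 : ℝ) : PS) = psY := by
  simp [ee, MvPowerSeries.X]

theorem mon11 : (MvPowerSeries.monomial (ee 1 1) (1 : ℝ) : PS) = psX * psY := by
  rw [psX, psY, MvPowerSeries.X, MvPowerSeries.X, MvPowerSeries.monomial_mul_monomial, one_mul]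
  rfl

theorem coeff_four (F0 F1 F2 F3 : PS) (n : Fin 2 →₀ ℕ) :
    MvPowerSeries.coeff n (ex F0 + psX * ex F1 + psY * ex F2 + psX * psY * ex F3) =
      if n 0 % 2 = 0 then
        (if n 1 % 2 = 0 then MvPowerSeries.coeff (half n) F0 else MvPowerSeries.coeff (half n) F2)
      else
        (if n 1 % 2 = 0 then MvPowerSeries.coeff (half n) F1
          else MvPowerSeries.coeff (half n) F3) := by
  have hb : ∀ a b : ℕ, a ≤ 1 → b ≤ 1 → ∀ i, ee a b i ≤ 1 := by
    intro a b ha hb i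
    fin_cases i
    · exact (ee_zero a b).trans_le ha
    · exact (ee_one a b).trans_le hb
  have c0 := coeff_par (ee 0 0) (hb _ _ (by simp) (by simp)) F0 n
  have c1 := coeff_par (ee 1 0) (hb _ _ (by simp) (by simp)) F1 n
  have c2 := coeff_par (ee 0 1) (hb _ _ (by simp) (by simp)) F2 n
  have c3 := coeff_par (ee 1 1) (hb _ _ (by simp) (by simp)) F3 n
  rw [mon00, one_mul] at c0
  rw [mon10] at c1
  rw [mon01] at c2
  rw [mon11] at c3
  rw [map_add, map_add, map_add, c0, c1, c2, c3]
  simp only [ee_zero, ee_one]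
  rcases Nat.mod_two_eq_zero_or_one (n 0) with h | h <;>
    rcases Nat.mod_two_eq_zero_or_one (n 1) with h' | h' <;> simp [h, h']

theorem exists_four (a : PS) : ∃ a0 a1 a2 a3 : PS,
    a = ex a0 + psX * ex a1 + psY * ex a2 + psX * psY * ex a3 := by
  let G (i j : ℕ) : PS := fun m => MvPowerSeries.coeff (2 • m + ee i j) a
  refine ⟨G 0 0, G 1 0, G 0 1, G 1 1, ?_⟩
  ext n
  rw [coeff_four]
  have key : ∀ i j : ℕ, n 0 % 2 = i → n 1 % 2 = j →
      MvPowerSeries.coeff (half n) (G i j) = MvPowerSeries.coeff n a := by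
    intro i j hi hj
    change MvPowerSeries.coeff (2 • half n + ee i j) a = _
    congr 2
    ext k
    fin_cases k
    · simp [half_apply, ee_zero]; omega
    · simp [half_apply, ee_one]; omega
  rcases Nat.mod_two_eq_zero_or_one (n 0) with h | h <;>
    rcases Nat.mod_two_eq_zero_or_one (n 1) with h' | h' <;> simp [h, h', key _ _ h h']

theorem unique_four {f F0 F1 F2 F3 : PS}
    (h : ex f = ex F0 + psX * ex F1 + psY * ex F2 + psX * psY * ex F3) : f = F0 := by
  have h' : ex f + psX * ex 0 + psY * ex 0 + psX * psY * ex 0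
      = ex F0 + psX * ex F1 + psY * ex F2 + psX * psY * ex F3 := by
    rw [← h, map_zero]; ring
  ext m
  have e := congrArg (MvPowerSeries.coeff (2 • m)) h'
  rw [coeff_four, coeff_four] at e
  have hm : half (2 • m) = m := by
    ext k
    simp [half_apply]
  simpa [hm] using e

theorem ex_X (i : Fin 2) : ex (MvPowerSeries.X i) = MvPowerSeries.X i * MvPowerSeries.X i := by
  rw [ex, MvPowerSeries.expand_X, sq]

theorem sumsq_four {s : PS} (hs : IsSumSq s) : ∃ F0 F1 F2 F3 : PS, F0 ∈ TT psX psY ∧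
    s = ex F0 + psX * ex F1 + psY * ex F2 + psX * psY * ex F3 := by
  induction hs using IsSumSq.rec' with
  | zero =>
    refine ⟨0, 0, 0, 0, ⟨0, 0, 0, 0, IsSumSq.zero, IsSumSq.zero, IsSumSq.zero, IsSumSq.zero, ?_⟩, ?_⟩
    · simp
    · simp
  | sq_add hx hs ih =>
    obtain ⟨c, rfl⟩ := hx
    obtain ⟨F0, F1, F2, F3, hF, rfl⟩ := ih
    obtain ⟨a0, a1, a2, a3, rfl⟩ := exists_four c
    refine ⟨(a0 * a0 + (a1 * a1) * psX + (a2 * a2) * psY + (a3 * a3) * (psX * psY)) + F0,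
      (2 * a0 * a1 + 2 * psY * a2 * a3) + F1, (2 * a0 * a2 + 2 * psX * a1 * a3) + F2,
      (2 * a0 * a3 + 2 * a1 * a2) + F3,
      TT_add ⟨_, _, _, _, IsSumSq.mul_self a0, IsSumSq.mul_self a1, IsSumSq.mul_self a2,
        IsSumSq.mul_self a3, rfl⟩ hF, ?_⟩
    simp only [map_add, map_mul, ex_X, map_ofNat]
    ring

end expand_part

section transport

/-- `ℝ[[x,y]] ≅ ℝ[[x]][[y]]` -/
def eqv : PS ≃+* A0 :=
  (MvPowerSeries.finSuccEquiv ℝ 1).toRingEquiv.trans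
    (let e : MvPowerSeries (Fin 1) ℝ ≃+* PowerSeries ℝ :=
      (MvPowerSeries.renameEquiv ℝ (Equiv.ofUnique (Fin 1) Unit)).toRingEquiv
    RingEquiv.ofRingHom (PowerSeries.map e.toRingHom) (PowerSeries.map e.symm.toRingHom)
      (by ext a n; simp) (by ext a n; simp))

theorem main_PS (g h : PS) (hh : h ≠ 0) (hs : IsSumSq (h * h * g)) : IsSumSq g := by
  have h1 := isSumSq_map eqv.toRingHom hs
  have h2 : IsSumSq (eqv g) := by
    apply main_A0 (eqv g) (eqv h)
    · simpa using hh
    · simpa using h1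
  simpa using isSumSq_map eqv.symm.toRingHom h2

end transport

theorem final (f : PS) (h : PS) (hh : h ≠ 0) (hs : h * h * f ∈ TT psX psY) : f ∈ TT psX psY := by
  obtain ⟨s0, s1, s2, s3, h0, h1, h2, h3, e⟩ := hs
  have hex : ex h ≠ 0 := by
    intro h0
    apply hh
    refine unique_four (F1 := 0) (F2 := 0) (F3 := 0) ?_
    rw [h0]
    simp
  have hS : IsSumSq (ex h * ex h * ex f) := by
    rw [← map_mul, ← map_mul, e]
    simp only [map_add, map_mul, ex_X]
    have key := fun {s : PS} (hs : IsSumSq s) => isSumSq_map ex.toRingHom hs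
    exact (((key h0).add ((key h1).mul (IsSumSq.mul_self _))).add
      ((key h2).mul (IsSumSq.mul_self _))).add
      ((key h3).mul ((IsSumSq.mul_self _).mul (IsSumSq.mul_self _)))
  obtain ⟨F0, F1, F2, F3, hF, e2⟩ := sumsq_four (main_PS _ _ hex hS)
  rwa [unique_four e2]

theorem sumsq_mem {A : Type*} [CommRing A] (S : Set A) {s : A} (hs : IsSumSq s) :
    s ∈ Subsemiring.closure (S ∪ {a | ∃ b, a = b ^ 2}) := by
  induction hs using IsSumSq.rec' with
  | zero => exact zero_mem _
  | sq_add hx hs ih =>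
    obtain ⟨c, rfl⟩ := hx
    exact add_mem (Subsemiring.subset_closure (Or.inr ⟨c, (sq c).symm⟩)) ih

end QuadSOS

/-- If `f ∈ ℝ[[x,y]]` is nonnegative at every ordering of `ℝ((x,y))`
at which both `x` and `y` are positive, then `f` lies in the preordering of `ℝ[[x,y]]`
generated by `x` and `y`; equivalently, `f = σ₀ + σ₁·x + σ₂·y + σ₃·x·y` with the `σᵢ`
sums of squares in `ℝ[[x,y]]`. -/
theorem psd_quadrant_implies_preordering_xy (f : PS)
    (hf : ∀ P : Set FF, IsOrderingF P → (ι psX ∈ P ∧ ι psX ≠ 0) →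
      (ι psY ∈ P ∧ ι psY ≠ 0) → ι f ∈ P) :
    f ∈ preorderingGen {psX, psY} ∧
      ∃ σ₀ σ₁ σ₂ σ₃ : PS, IsSumSq σ₀ ∧ IsSumSq σ₁ ∧ IsSumSq σ₂ ∧ IsSumSq σ₃ ∧
        f = σ₀ + σ₁ * psX + σ₂ * psY + σ₃ * (psX * psY) := by
  obtain ⟨h, hh, hs⟩ := QuadSOS.artin_part f hf
  have hmem : f ∈ QuadSOS.TT psX psY := QuadSOS.final f h hh hs
  refine ⟨?_, hmem⟩
  obtain ⟨s0, s1, s2, s3, h0, h1, h2, h3, rfl⟩ := hmem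
  have hX : psX ∈ Subsemiring.closure (({psX, psY} : Set PS) ∪ {a | ∃ b, a = b ^ 2}) :=
    Subsemiring.subset_closure (Or.inl (by simp))
  have hY : psY ∈ Subsemiring.closure (({psX, psY} : Set PS) ∪ {a | ∃ b, a = b ^ 2}) :=
    Subsemiring.subset_closure (Or.inl (by simp))
  have key := fun {s : PS} (hs : IsSumSq s) => QuadSOS.sumsq_mem {psX, psY} hs
  exact add_mem (add_mem (add_mem (key h0) (mul_mem (key h1) hX)) (mul_mem (key h2) hY))
    (mul_mem (key h3) (mul_mem hX hY))
end
end

section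
/- Let f ∈ ℝ[[x,y]] be a formal power series in two variables and let n be a positive integer. If f is nonnegative at every ordering of the field ℝ((x,y)) at which y > 0 and x^{2n} − y > 0, then f lies in the preordering of ℝ[[x,y]] generated by y and x^{2n} − y. -/
noncomputable section

open MvPowerSeries MvPolynomial

/-! ### Part 1: orderings and square roots -/

theorem cusp_exists_ordering {F : Type*} [Field F] (h2 : (2 : F) ≠ 0) (T : Set F)
    (hadd : ∀ a ∈ T, ∀ b ∈ T, a + b ∈ T) (hmul : ∀ a ∈ T, ∀ b ∈ T, a * b ∈ T)
    (hsq : ∀ a : F, a ^ 2 ∈ T) (f : F) (hf : f ∉ T) :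
    ∃ P : Set F, IsOrderingF P ∧ T ⊆ P ∧ f ∉ P := by
  let 𝒮 : Set (Set F) := {Q | T ⊆ Q ∧ (∀ a ∈ Q, ∀ b ∈ Q, a + b ∈ Q) ∧
    (∀ a ∈ Q, ∀ b ∈ Q, a * b ∈ Q) ∧ f ∉ Q}
  obtain ⟨P, hTP, hP⟩ := zorn_subset_nonempty 𝒮 (by
    intro c hc hch hne
    refine ⟨⋃₀ c, ⟨?_, ?_, ?_, ?_⟩, fun s hs => Set.subset_sUnion_of_mem hs⟩
    · obtain ⟨s, hs⟩ := hne
      exact (hc hs).1.trans (Set.subset_sUnion_of_mem hs)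
    · rintro a ⟨s, hs, has⟩ b ⟨t, ht, hbt⟩
      rcases hch.total hs ht with h | h
      · exact ⟨t, ht, (hc ht).2.1 a (h has) b hbt⟩
      · exact ⟨s, hs, (hc hs).2.1 a has b (h hbt)⟩
    · rintro a ⟨s, hs, has⟩ b ⟨t, ht, hbt⟩
      rcases hch.total hs ht with h | h
      · exact ⟨t, ht, (hc ht).2.2.1 a (h has) b hbt⟩
      · exact ⟨s, hs, (hc hs).2.2.1 a has b (h hbt)⟩
    · rintro ⟨s, hs, hfs⟩
      exact (hc hs).2.2.2 hfs) T ⟨subset_rfl, hadd, hmul, hf⟩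
  obtain ⟨⟨-, padd, pmul, pf⟩, hmax⟩ := hP
  have psq : ∀ a : F, a ^ 2 ∈ P := fun a => hTP (hsq a)
  have hneg1 : (-1 : F) ∉ P := by
    intro h
    apply pf
    have := padd _ (psq ((f + 1) / 2)) _ (pmul _ h _ (psq ((f - 1) / 2)))
    convert this using 1
    field_simp
    ring
  have hsupp : ∀ a : F, a ∈ P → -a ∈ P → a = 0 := by
    intro a ha hna
    by_contra h0
    apply hneg1
    have := pmul _ (pmul _ ha _ hna) _ (psq a⁻¹)
    convert this using 1
    field_simp
  have hext : ∀ a : F, a ∉ P → ∃ p ∈ P, ∃ q ∈ P, f = p + a * q := by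
    intro a ha
    by_contra hcon
    let Q : Set F := {z | ∃ p ∈ P, ∃ q ∈ P, z = p + a * q}
    have hzero : (0 : F) ∈ P := by simpa using psq 0
    have hone : (1 : F) ∈ P := by simpa using psq 1
    have hPQ : P ⊆ Q := fun p hp => ⟨p, hp, 0, hzero, by ring⟩
    have hQ : Q ∈ 𝒮 := by
      refine ⟨hTP.trans hPQ, ?_, ?_, hcon⟩
      · rintro _ ⟨p, hp, q, hq, rfl⟩ _ ⟨p', hp', q', hq', rfl⟩
        exact ⟨_, padd _ hp _ hp', _, padd _ hq _ hq', by ring⟩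
      · rintro _ ⟨p, hp, q, hq, rfl⟩ _ ⟨p', hp', q', hq', rfl⟩
        exact ⟨_, padd _ (pmul _ hp _ hp') _ (pmul _ (psq a) _ (pmul _ hq _ hq')), _,
          padd _ (pmul _ hp _ hq') _ (pmul _ hq _ hp'), by ring⟩
    have : Q ⊆ P := hmax hQ hPQ
    exact ha (this ⟨0, hzero, 1, hone, by ring⟩)
  refine ⟨P, ⟨padd, pmul, ?_, hsupp⟩, hTP, pf⟩
  intro a
  by_contra! hcon
  obtain ⟨p, hp, q, hq, h1⟩ := hext a hcon.1
  obtain ⟨p', hp', q', hq', h3⟩ := hext (-a) hcon.2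
  have key : (q + q') * f = q' * p + q * p' := by
    have e1 : q' * f = q' * p + a * q * q' := by rw [h1]; ring
    have e2 : q * f = q * p' - a * q * q' := by rw [h3]; ring
    linear_combination e1 + e2
  have hmem : (q + q') * f ∈ P := by
    rw [key]; exact padd _ (pmul _ hq' _ hp) _ (pmul _ hq _ hp')
  by_cases hqq : q + q' = 0
  · have hq0 : q = 0 := hsupp q hq (by rwa [show -q = q' by linear_combination -hqq])
    apply pf
    rw [h1, hq0]; simpa using hp
  · apply pf
    have := pmul _ (pmul _ hmem _ (padd _ hq _ hq')) _ (psq (q + q')⁻¹)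
    convert this using 1
    field_simp

/-- Elements with constant term `1` are squares. -/
theorem cusp_sqrt_one {τ S : Type*} [CommRing S] [Algebra ℝ S] (u : MvPowerSeries τ S)
    (hu : MvPowerSeries.constantCoeff u = 1) :
    ∃ v : MvPowerSeries τ S, u = v ^ 2 := by
  have hs : PowerSeries.HasSubst (u - 1) :=
    PowerSeries.HasSubst.of_constantCoeff_zero (by simp [hu])
  let b : PowerSeries ℝ := PowerSeries.binomialSeries ℝ (1 / 2 : ℝ)
  have hb : b ^ 2 = 1 + PowerSeries.X := by
    have h1 : b * b = PowerSeries.binomialSeries ℝ ((1 / 2 : ℝ) + 1 / 2) :=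
      (PowerSeries.binomialSeries_add (1 / 2 : ℝ) (1 / 2 : ℝ)).symm
    have h2 := PowerSeries.binomialSeries_nat (R := ℝ) (A := ℝ) 1
    rw [pow_two, h1]
    norm_num at h2 ⊢
    exact h2
  refine ⟨PowerSeries.substAlgHom hs b, ?_⟩
  rw [← map_pow, hb, map_add, map_one, PowerSeries.substAlgHom_X]
  ring

theorem cusp_sqrt_pos {τ : Type*} (u : MvPowerSeries τ ℝ)
    (hu : 0 < MvPowerSeries.constantCoeff u) :
    ∃ v : MvPowerSeries τ ℝ, u = v ^ 2 := by
  set c := MvPowerSeries.constantCoeff u with hc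
  obtain ⟨v, hv⟩ := cusp_sqrt_one (MvPowerSeries.C c⁻¹ * u) (by
    simp [← hc, hu.ne'])
  refine ⟨MvPowerSeries.C (Real.sqrt c) * v, ?_⟩
  rw [mul_pow, ← hv, ← map_pow, Real.sq_sqrt hu.le, ← mul_assoc, ← map_mul,
    mul_inv_cancel₀ hu.ne', map_one, one_mul]

/-! ### Part 2: diagonal quadratic forms -/

/-- Sums of elements `c * v ^ 2` with `c ∈ S`. -/
def cuspRep {E : Type*} [CommRing E] (S : Set E) : AddSubmonoid E :=
  AddSubmonoid.closure {z | ∃ c ∈ S, ∃ v, z = c * v ^ 2}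

theorem cuspRep_mem {E : Type*} [CommRing E] {S : Set E} {c : E} (hc : c ∈ S) (v : E) :
    c * v ^ 2 ∈ cuspRep S := AddSubmonoid.subset_closure ⟨c, hc, v, rfl⟩

theorem cuspRep_family {E : Type*} [CommRing E] {S : Set E} {z : E} (hz : z ∈ cuspRep S) :
    ∃ (ι : Type) (_ : Fintype ι) (c v : ι → E), (∀ i, c i ∈ S) ∧ z = ∑ i, c i * v i ^ 2 := by
  induction hz using AddSubmonoid.closure_induction with
  | mem x hx =>
    obtain ⟨c, hc, v, rfl⟩ := hx
    exact ⟨Unit, inferInstance, fun _ => c, fun _ => v, fun _ => hc, by simp⟩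
  | zero => exact ⟨Empty, inferInstance, fun _ => 0, fun _ => 0, fun i => i.elim, by simp⟩
  | add x y _ _ hx hy =>
    obtain ⟨ι, _, c, v, hc, rfl⟩ := hx
    obtain ⟨κ, _, d, w, hd, rfl⟩ := hy
    refine ⟨ι ⊕ κ, inferInstance, Sum.elim c d, Sum.elim v w, ?_, by simp⟩
    rintro (i | i)
    · exact hc i
    · exact hd i

theorem cuspRep_sum {E : Type*} [CommRing E] {S : Set E} {ι : Type*} [Fintype ι] (c v : ι → E)
    (hc : ∀ i, c i ∈ S) : ∑ i, c i * v i ^ 2 ∈ cuspRep S :=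
  AddSubmonoid.sum_mem _ fun i _ => cuspRep_mem (hc i) (v i)

theorem cuspRep_sq_mul {E : Type*} [CommRing E] {S : Set E} {z : E} (w : E)
    (hz : z ∈ cuspRep S) : w ^ 2 * z ∈ cuspRep S := by
  induction hz using AddSubmonoid.closure_induction with
  | mem x hx =>
    obtain ⟨c, hc, v, rfl⟩ := hx
    rw [show w ^ 2 * (c * v ^ 2) = c * (w * v) ^ 2 by ring]
    exact cuspRep_mem hc _
  | zero => simp [zero_mem]
  | add x y _ _ hx hy => rw [mul_add]; exact add_mem hx hy

theorem cuspRep_mul {E : Type*} [CommRing E] {S : Set E}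
    (hS : ∀ c ∈ S, ∀ d ∈ S, c * d ∈ cuspRep S) {y z : E} (hy : y ∈ cuspRep S)
    (hz : z ∈ cuspRep S) : y * z ∈ cuspRep S := by
  induction hy using AddSubmonoid.closure_induction with
  | mem x hx =>
    obtain ⟨c, hc, v, rfl⟩ := hx
    induction hz using AddSubmonoid.closure_induction with
    | mem x hx =>
      obtain ⟨d, hd, w, rfl⟩ := hx
      rw [show c * v ^ 2 * (d * w ^ 2) = (v * w) ^ 2 * (c * d) by ring]
      exact cuspRep_sq_mul _ (hS c hc d hd)
    | zero => simp [zero_mem]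
    | add x y _ _ hx hy => rw [mul_add]; exact add_mem hx hy
  | zero => simp [zero_mem]
  | add x y _ _ hx hy => rw [add_mul]; exact add_mem hx hy

theorem cuspRep_mul_one {E : Type*} [CommRing E] (w : E) :
    ∀ c ∈ ({1, w} : Set E), ∀ d ∈ ({1, w} : Set E), c * d ∈ cuspRep ({1, w} : Set E) := by
  have h1 : (1 : E) ∈ ({1, w} : Set E) := by simp
  have hw : w ∈ ({1, w} : Set E) := by simp
  rintro c (rfl | rfl) d (rfl | rfl)
  · simpa using cuspRep_mem h1 1
  · simpa using cuspRep_mem hw 1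
  · simpa using cuspRep_mem hw 1
  · simpa [pow_two] using cuspRep_mem h1 d

theorem cuspRep_sq_unit {E : Type*} [CommRing E] (t v : E) :
    v ^ 2 ∈ cuspRep ({t, 1 - t} : Set E) := by
  rw [show v ^ 2 = t * v ^ 2 + (1 - t) * v ^ 2 by ring]
  exact add_mem (cuspRep_mem (by simp) _) (cuspRep_mem (by simp) _)

theorem cuspRep_mul_unit {E : Type*} [CommRing E] (t : E) :
    ∀ c ∈ ({t, 1 - t} : Set E), ∀ d ∈ ({t, 1 - t} : Set E),
      c * d ∈ cuspRep ({t, 1 - t} : Set E) := by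
  have h : t * (1 - t) ∈ cuspRep ({t, 1 - t} : Set E) := by
    rw [show t * (1 - t) = t * (1 - t) ^ 2 + (1 - t) * t ^ 2 by ring]
    exact add_mem (cuspRep_mem (by simp) _) (cuspRep_mem (by simp) _)
  rintro c (rfl | rfl) d (rfl | rfl)
  · simpa [pow_two] using cuspRep_sq_unit d d
  · exact h
  · rw [mul_comm]; exact h
  · simpa [pow_two] using cuspRep_sq_unit t (1 - t)

/-- `Pts` is a family of real points of `V(π)`, dense in it, at which `S` is positive. -/
structure CuspPts {E : Type*} [CommRing E] (π : E) (S : Set E) (Pts : Set (E →+* ℝ)) : Prop where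
  vanish : ∀ p ∈ Pts, p π = 0
  pos : ∀ p ∈ Pts, ∀ c ∈ S, 0 < p c
  dvd : ∀ z, (∀ p ∈ Pts, p z = 0) → π ∣ z

theorem CuspPts.dvd_of_dvd {E : Type*} [CommRing E] {π : E} {S : Set E} {Pts : Set (E →+* ℝ)}
    (h : CuspPts π S Pts) {ι : Type*} [Fintype ι] (c v : ι → E) (hc : ∀ i, c i ∈ S)
    (hd : π ∣ ∑ i, c i * v i ^ 2) (i : ι) : π ∣ v i := by
  apply h.dvd
  intro p hp
  obtain ⟨w, hw⟩ := hd
  have h0 : ∑ i, p (c i) * p (v i) ^ 2 = 0 := by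
    have := congrArg p hw
    simpa [h.vanish p hp] using this
  rw [Finset.sum_eq_zero_iff_of_nonneg
    (fun i _ => mul_nonneg (h.pos p hp _ (hc i)).le (sq_nonneg _))] at h0
  have := h0 i (Finset.mem_univ i)
  simpa [(h.pos p hp _ (hc i)).ne'] using this

theorem CuspPts.pow_dvd {E : Type*} [CommRing E] [IsDomain E] {π : E} (hπ : π ≠ 0) {S : Set E}
    {Pts : Set (E →+* ℝ)} (h : CuspPts π S Pts) {ι : Type*} [Fintype ι] (c v : ι → E)
    (hc : ∀ i, c i ∈ S) (h0 : ∑ i, c i * v i ^ 2 = 0) (k : ℕ) (i : ι) : π ^ k ∣ v i := by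
  induction k generalizing v i with
  | zero => simp
  | succ k ih =>
    choose w hw using fun i => h.dvd_of_dvd c v hc (by rw [h0]; exact dvd_zero _) i
    have hw0 : ∑ i, c i * w i ^ 2 = 0 := by
      have : π ^ 2 * ∑ i, c i * w i ^ 2 = 0 := by
        rw [← h0, Finset.mul_sum]
        refine Finset.sum_congr rfl fun i _ => ?_
        rw [hw i]; ring
      exact (mul_eq_zero.mp this).resolve_left (pow_ne_zero _ hπ)
    rw [hw i, pow_succ']
    exact mul_dvd_mul_left _ (ih w hw0 i)

theorem CuspPts.cancel {E : Type*} [CommRing E] [IsDomain E] {π : E} (hπ : π ≠ 0) {S : Set E}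
    {Pts : Set (E →+* ℝ)} (h : CuspPts π S Pts) (G : E) (s : ℕ)
    (hG : π ^ (2 * s) * G ∈ cuspRep S) : G ∈ cuspRep S := by
  induction s with
  | zero => simpa using hG
  | succ s ih =>
    apply ih
    obtain ⟨ι, _, c, v, hc, hz⟩ := cuspRep_family hG
    choose w hw using fun i => h.dvd_of_dvd c v hc
      (by rw [← hz]; exact (dvd_pow_self _ (by omega)).mul_right _) i
    have : π ^ (2 * s) * G = ∑ i, c i * w i ^ 2 := by
      apply mul_left_cancel₀ (pow_ne_zero 2 hπ)
      rw [← mul_assoc, ← pow_add, show 2 + 2 * s = 2 * (s + 1) by ring, hz, Finset.mul_sum]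
      refine Finset.sum_congr rfl fun i _ => ?_
      rw [hw i]; ring
    rw [this]
    exact cuspRep_sum c w hc

theorem CuspPts.cancel_odd {E : Type*} [CommRing E] [IsDomain E] {π : E} (hπ : π ≠ 0) {S : Set E}
    {Pts : Set (E →+* ℝ)} (h : CuspPts π S Pts) (G : E) (s : ℕ)
    (hG : π ^ s * G ∈ cuspRep S) (hnd : ¬ π ∣ G) : Even s ∧ G ∈ cuspRep S := by
  rcases Nat.even_or_odd' s with ⟨k, rfl | rfl⟩
  · exact ⟨by simp, h.cancel hπ G k hG⟩
  · exfalso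
    have h1 := h.cancel hπ (π * G) k (by rwa [← mul_assoc, ← pow_succ])
    obtain ⟨ι, _, c, v, hc, hz⟩ := cuspRep_family h1
    choose w hw using fun i => h.dvd_of_dvd c v hc (by rw [← hz]; exact dvd_mul_right _ _) i
    apply hnd
    refine ⟨∑ i, c i * w i ^ 2, mul_left_cancel₀ hπ ?_⟩
    rw [hz, ← mul_assoc, Finset.mul_sum]
    refine Finset.sum_congr rfl fun i _ => ?_
    rw [hw i]; ring

/-! ### Part 3: Cassels–Pfister -/

theorem cusp_pseudo_div {R : Type*} [CommRing R] [IsDomain R] (D : Polynomial R) (hD : D ≠ 0)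
    (a : Polynomial R) : ∃ l : R, l ≠ 0 ∧ ∃ b r : Polynomial R,
      Polynomial.C l * a = D * b + r ∧ r.degree < D.degree := by
  suffices H : ∀ n : ℕ, ∀ a : Polynomial R, a.degree < n → ∃ l : R, l ≠ 0 ∧
      ∃ b r : Polynomial R, Polynomial.C l * a = D * b + r ∧ r.degree < D.degree from
    H (a.natDegree + 1) a (by
      refine lt_of_le_of_lt Polynomial.degree_le_natDegree ?_
      exact_mod_cast Nat.lt_succ_self _)
  intro n
  induction n with
  | zero =>
    intro a ha
    have : a = 0 := by
      rw [← Polynomial.degree_eq_bot]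
      exact_mod_cast Nat.WithBot.lt_zero_iff.mp (by simpa using ha)
    exact ⟨1, one_ne_zero, 0, 0, by simp [this], by
      simpa [bot_lt_iff_ne_bot, Polynomial.degree_eq_bot] using hD⟩
  | succ n ih =>
    intro a ha
    by_cases hlt : a.degree < D.degree
    · exact ⟨1, one_ne_zero, 0, a, by simp, hlt⟩
    have ha0 : a ≠ 0 := by
      rintro rfl
      apply hlt
      simpa [bot_lt_iff_ne_bot, Polynomial.degree_eq_bot] using hD
    have hle : D.natDegree ≤ a.natDegree := by
      rw [not_lt] at hlt
      exact Polynomial.natDegree_le_natDegree hlt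
    set a' := Polynomial.C D.leadingCoeff * a -
      Polynomial.C a.leadingCoeff * Polynomial.X ^ (a.natDegree - D.natDegree) * D with ha'
    have hlD : D.leadingCoeff ≠ 0 := by simpa using hD
    have hla : a.leadingCoeff ≠ 0 := by simpa using ha0
    have hdeg : a'.degree < a.degree := by
      have e1 : (Polynomial.C D.leadingCoeff * a).degree = a.degree :=
        Polynomial.degree_C_mul hlD
      rw [← e1]
      apply Polynomial.degree_sub_lt_left
      · rw [e1, mul_assoc, Polynomial.degree_C_mul hla, Polynomial.degree_mul,
          Polynomial.degree_X_pow, Polynomial.degree_eq_natDegree ha0,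
          Polynomial.degree_eq_natDegree hD]
        norm_cast
        omega
      · exact mul_ne_zero (by simpa using hD) ha0
      · simp only [Polynomial.leadingCoeff_mul, Polynomial.leadingCoeff_C,
          Polynomial.leadingCoeff_X_pow, mul_one]
        exact mul_comm _ _
    obtain ⟨l, hl, b, r, hbr, hr⟩ := ih a' (by
      have : a.degree ≤ n := by
        rw [Polynomial.degree_eq_natDegree ha0] at ha ⊢
        norm_cast at ha ⊢
        omega
      exact lt_of_lt_of_le hdeg this)
    refine ⟨l * D.leadingCoeff, mul_ne_zero hl hlD,
      b + Polynomial.C l * (Polynomial.C a.leadingCoeff *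
        Polynomial.X ^ (a.natDegree - D.natDegree)), r, ?_, hr⟩
    rw [map_mul]
    rw [ha'] at hbr
    linear_combination hbr

theorem cusp_pseudo_div_family {R : Type*} [CommRing R] [IsDomain R] (D : Polynomial R)
    (hD : D ≠ 0) {ι : Type*} [Fintype ι] (a : ι → Polynomial R) :
    ∃ l : R, l ≠ 0 ∧ ∃ b r : ι → Polynomial R,
      ∀ i, Polynomial.C l * a i = D * b i + r i ∧ (r i).degree < D.degree := by
  classical
  choose l hl b r h hr using fun i => cusp_pseudo_div D hD (a i)
  refine ⟨∏ i, l i, Finset.prod_ne_zero_iff.mpr fun i _ => hl i,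
    fun i => Polynomial.C (∏ j ∈ Finset.univ.erase i, l j) * b i,
    fun i => Polynomial.C (∏ j ∈ Finset.univ.erase i, l j) * r i, fun i => ⟨?_, ?_⟩⟩
  · rw [← Finset.mul_prod_erase Finset.univ l (Finset.mem_univ i), map_mul]
    linear_combination Polynomial.C (∏ j ∈ Finset.univ.erase i, l j) * h i
  · rw [Polynomial.degree_C_mul]
    · exact hr i
    · exact Finset.prod_ne_zero_iff.mpr fun j _ => hl j

theorem cusp_cassels_pfister {R : Type*} [CommRing R] [IsDomain R] {ι : Type*} [Fintype ι]
    (c : ι → Polynomial R) (hc : ∀ i, (c i).natDegree ≤ 1)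
    (haniso : ∀ v : ι → Polynomial R, ∑ i, c i * v i ^ 2 = 0 → ∀ i, v i = 0)
    (Q : Polynomial R) (n : ℕ) : ∀ (D : Polynomial R), D ≠ 0 → D.natDegree ≤ n →
      ∀ a : ι → Polynomial R, D ^ 2 * Q = ∑ i, c i * a i ^ 2 →
      ∃ (δ : R) (a' : ι → Polynomial R), δ ≠ 0 ∧ Polynomial.C δ ^ 2 * Q = ∑ i, c i * a' i ^ 2 := by
  induction n with
  | zero =>
    intro D hD hdeg a ha
    rw [Polynomial.eq_C_of_natDegree_le_zero hdeg] at ha hD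
    exact ⟨_, a, by simpa using hD, ha⟩
  | succ n ih =>
    intro D hD hdeg a ha
    obtain ⟨l, hl, b, r, hbr⟩ := cusp_pseudo_div_family D hD a
    have hlC : Polynomial.C l ≠ 0 := by simpa using hl
    set L := Polynomial.C l with hL
    set β := ∑ i, c i * b i ^ 2 with hβ
    set B := ∑ i, c i * (L * a i) * b i with hB
    have hLa : ∑ i, c i * (L * a i) ^ 2 = D ^ 2 * (L ^ 2 * Q) := by
      rw [show D ^ 2 * (L ^ 2 * Q) = L ^ 2 * (D ^ 2 * Q) by ring, ha, Finset.mul_sum]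
      exact Finset.sum_congr rfl fun i _ => by ring
    set D' := D * β - 2 * B + D * (L ^ 2 * Q) with hD'
    have hr : ∑ i, c i * r i ^ 2 = D * D' := by
      have : ∑ i, c i * r i ^ 2
          = ∑ i, c i * (L * a i) ^ 2 - 2 * D * B + D ^ 2 * β := by
        rw [hB, hβ, Finset.mul_sum, Finset.mul_sum, ← Finset.sum_sub_distrib,
          ← Finset.sum_add_distrib]
        refine Finset.sum_congr rfl fun i _ => ?_
        have : r i = L * a i - D * b i := by linear_combination -(hbr i).1
        rw [this]; ring
      rw [this, hLa, hD']; ring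
    by_cases hall : ∀ i, r i = 0
    · refine ⟨l, b, hl, ?_⟩
      apply mul_left_cancel₀ (pow_ne_zero 2 hD)
      rw [← hLa, Finset.mul_sum]
      refine Finset.sum_congr rfl fun i _ => ?_
      rw [(hbr i).1, hall i]; ring
    · have hD'0 : D' ≠ 0 := by
        intro h0
        exact hall (haniso r (by rw [hr, h0, mul_zero]))
      have hD0 : D.natDegree ≠ 0 := by
        intro h0
        apply hall
        intro i
        have h1 := (hbr i).2
        rw [Polynomial.degree_eq_natDegree hD, h0] at h1
        rw [← Polynomial.degree_eq_bot]
        exact_mod_cast Nat.WithBot.lt_zero_iff.mp (by simpa using h1)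
      have hdr : ∀ i, (r i).natDegree ≤ D.natDegree - 1 := by
        intro i
        by_cases h0 : r i = 0
        · simp [h0]
        · have := Polynomial.natDegree_lt_natDegree h0 (hbr i).2
          omega
      have hsum : (∑ i, c i * r i ^ 2).natDegree ≤ 1 + 2 * (D.natDegree - 1) := by
        apply Polynomial.natDegree_sum_le_of_forall_le
        intro i _
        refine Polynomial.natDegree_mul_le.trans ?_
        have := Polynomial.natDegree_pow_le (p := r i) (n := 2)
        have := hdr i
        have := hc i
        omega
      rw [hr, Polynomial.natDegree_mul hD hD'0] at hsum
      refine ih (L * D') (mul_ne_zero hlC hD'0) ?_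
        (fun i => L * a i * (β - L ^ 2 * Q) - 2 * b i * (B - D * (L ^ 2 * Q))) ?_
      · rw [hL, Polynomial.natDegree_C_mul hl]; omega
      · have : ∑ i, c i * (L * a i * (β - L ^ 2 * Q) - 2 * b i * (B - D * (L ^ 2 * Q))) ^ 2
            = (β - L ^ 2 * Q) ^ 2 * (∑ i, c i * (L * a i) ^ 2)
              - 4 * (β - L ^ 2 * Q) * (B - D * (L ^ 2 * Q)) * B
              + 4 * (B - D * (L ^ 2 * Q)) ^ 2 * β := by
          conv_rhs => rw [hB, hβ]
          simp only [Finset.mul_sum]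
          rw [← Finset.sum_sub_distrib, ← Finset.sum_add_distrib]
          refine Finset.sum_congr rfl fun i _ => ?_
          ring
        rw [this, hLa, hD']
        ring

/-! ### Part 4: the ring `ℝ[t][[x]]` -/

/-- `ℝ[[x]]`. -/
abbrev CuspR : Type := PowerSeries ℝ

/-- `ℝ[t][[x]]`. -/
abbrev CuspB : Type := PowerSeries (Polynomial ℝ)

/-- The element `t` of `ℝ[t][[x]]`. -/
abbrev cuspT : CuspB := PowerSeries.C Polynomial.X

theorem cuspPts_B : CuspPts (PowerSeries.X : CuspB) {cuspT, 1 - cuspT}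
    {p | ∃ s : ℝ, 0 < s ∧ s < 1 ∧ p = (Polynomial.evalRingHom s).comp PowerSeries.constantCoeff}
    where
  vanish := by rintro _ ⟨s, _, _, rfl⟩; simp
  pos := by
    rintro _ ⟨s, h0, h1, rfl⟩ c (rfl | rfl)
    · simpa using h0
    · simpa using h1
  dvd := by
    intro z hz
    rw [PowerSeries.X_dvd_iff]
    apply Polynomial.eq_zero_of_infinite_isRoot
    refine (Set.Ioo_infinite (zero_lt_one' ℝ)).mono ?_
    intro s hs
    have := hz _ ⟨s, hs.1, hs.2, rfl⟩
    simpa [Polynomial.IsRoot] using this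

theorem cuspPts_RX : CuspPts (Polynomial.C PowerSeries.X : Polynomial CuspR) {1, Polynomial.X}
    {p | ∃ s : ℝ, 0 < s ∧ p = (Polynomial.evalRingHom s).comp
      (Polynomial.mapRingHom PowerSeries.constantCoeff)} where
  vanish := by rintro _ ⟨s, _, rfl⟩; simp
  pos := by
    rintro _ ⟨s, h0, rfl⟩ c (rfl | rfl)
    · simp
    · simpa using h0
  dvd := by
    intro z hz
    rw [Polynomial.C_dvd_iff_dvd_coeff]
    have h0 : z.map PowerSeries.constantCoeff = 0 := by
      apply Polynomial.eq_zero_of_infinite_isRoot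
      refine (Set.Ioi_infinite (0 : ℝ)).mono ?_
      intro s hs
      have := hz _ ⟨s, hs, rfl⟩
      simpa [Polynomial.IsRoot] using this
    intro i
    rw [PowerSeries.X_dvd_iff]
    have := congrArg (fun p => Polynomial.coeff p i) h0
    simpa using this

theorem cuspPts_R : CuspPts (PowerSeries.X : CuspR) {1} {PowerSeries.constantCoeff} where
  vanish := by rintro _ rfl; simp
  pos := by rintro _ rfl _ rfl; simp
  dvd := by
    intro z hz
    rw [PowerSeries.X_dvd_iff]
    exact hz _ rfl

theorem cusp_R_eq_zero (z : CuspR) (h : ∀ k, (PowerSeries.X : CuspR) ^ k ∣ z) : z = 0 := by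
  ext k
  simpa using (PowerSeries.X_pow_dvd_iff.mp (h (k + 1))) k (Nat.lt_succ_self k)

theorem cusp_aniso_R {ι : Type*} [Fintype ι] (v : ι → CuspR) (h : ∑ i, v i ^ 2 = 0) (i : ι) :
    v i = 0 :=
  cusp_R_eq_zero _ fun k => cuspPts_R.pow_dvd PowerSeries.X_ne_zero (fun _ => 1) v
    (fun _ => rfl) (by simpa using h) k i

theorem cusp_aniso_RX {ι : Type*} [Fintype ι] (c v : ι → Polynomial CuspR)
    (hc : ∀ i, c i ∈ ({1, Polynomial.X} : Set (Polynomial CuspR)))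
    (h : ∑ i, c i * v i ^ 2 = 0) (i : ι) : v i = 0 := by
  ext1 n
  rw [Polynomial.coeff_zero]
  apply cusp_R_eq_zero
  intro k
  have := cuspPts_RX.pow_dvd (by simp [PowerSeries.X_ne_zero]) c v hc h k i
  rw [← map_pow, Polynomial.C_dvd_iff_dvd_coeff] at this
  exact this n

/-- The inclusion `ℝ[[x]][t] → ℝ[t][[x]]`. -/
def cuspJ : Polynomial CuspR →+* CuspB :=
  Polynomial.eval₂RingHom (PowerSeries.map Polynomial.C) cuspT

theorem cuspJ_C (c : CuspR) : cuspJ (Polynomial.C c) = PowerSeries.map Polynomial.C c := by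
  simp [cuspJ]

theorem cuspJ_X : cuspJ Polynomial.X = cuspT := by
  simp [cuspJ]

theorem cuspJ_coeff (P : Polynomial CuspR) (k i : ℕ) :
    (PowerSeries.coeff k (cuspJ P)).coeff i = PowerSeries.coeff k (P.coeff i) := by
  induction P using Polynomial.induction_on' with
  | add p q hp hq => simp [hp, hq]
  | monomial n a =>
    rw [← Polynomial.C_mul_X_pow_eq_monomial, map_mul, map_pow, cuspJ_C, cuspJ_X, ← map_pow,
      PowerSeries.coeff_mul_C, PowerSeries.coeff_map, Polynomial.coeff_C_mul_X_pow,
      Polynomial.coeff_C_mul_X_pow]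
    split_ifs <;> simp

theorem cuspJ_inj : Function.Injective cuspJ := by
  intro P Q h
  ext i k
  rw [← cuspJ_coeff, ← cuspJ_coeff, h]

theorem cuspJ_natDegree (P : Polynomial CuspR) (k : ℕ) :
    (PowerSeries.coeff k (cuspJ P)).natDegree ≤ P.natDegree := by
  rw [Polynomial.natDegree_le_iff_coeff_eq_zero]
  intro i hi
  rw [cuspJ_coeff, Polynomial.coeff_eq_zero_of_natDegree_lt hi, map_zero]

theorem cuspJ_lift (b : CuspB) (E : ℕ) (h : ∀ k, (PowerSeries.coeff k b).natDegree ≤ E) :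
    ∃ P : Polynomial CuspR, cuspJ P = b ∧ P.natDegree ≤ E := by
  let P : Polynomial CuspR := ∑ i ∈ Finset.range (E + 1),
    Polynomial.monomial i (PowerSeries.mk fun k => (PowerSeries.coeff k b).coeff i)
  have hP : ∀ i, P.coeff i =
      if i < E + 1 then (PowerSeries.mk fun k => (PowerSeries.coeff k b).coeff i) else 0 := by
    intro i
    simp only [P, Polynomial.finsetSum_coeff, Polynomial.coeff_monomial]
    simp
  refine ⟨P, ?_, ?_⟩
  · ext k i
    rw [cuspJ_coeff, hP]
    split_ifs with hi
    · simp
    · rw [map_zero, Polynomial.coeff_eq_zero_of_natDegree_lt]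
      have := h k
      omega
  · rw [Polynomial.natDegree_le_iff_coeff_eq_zero]
    intro i hi
    rw [hP, if_neg (by omega)]

theorem cusp_coeff_mul (a b : CuspB) (k : ℕ) : PowerSeries.coeff k (a * b) =
    (∑ i ∈ Finset.range k, PowerSeries.coeff i a * PowerSeries.coeff (k - i) b)
      + PowerSeries.coeff k a * PowerSeries.coeff 0 b := by
  rw [PowerSeries.coeff_mul, Finset.Nat.sum_antidiagonal_eq_sum_range_succ
    (fun i j => PowerSeries.coeff i a * PowerSeries.coeff j b), Finset.sum_range_succ, Nat.sub_self]

theorem cusp_coeff_zero_mul (a b : CuspB) : PowerSeries.coeff 0 (a * b) =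
    PowerSeries.coeff 0 a * PowerSeries.coeff 0 b := by
  simp [PowerSeries.coeff_zero_eq_constantCoeff]

/-- The coefficients of the quotient in the division of `a` by `F`. -/
def cuspDivSeq (F a : CuspB) : ℕ → Polynomial ℝ
  | k => (PowerSeries.coeff k a - ∑ i : Fin k, cuspDivSeq F a i * PowerSeries.coeff (k - i) F) /
      PowerSeries.coeff 0 F
  decreasing_by exact i.2

theorem cusp_div (F a : CuspB) (hF : PowerSeries.coeff 0 F ≠ 0) :
    ∃ α r : CuspB, a = F * α + r ∧
      ∀ k, (PowerSeries.coeff k r).degree < (PowerSeries.coeff 0 F).degree := by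
  let α : CuspB := PowerSeries.mk (cuspDivSeq F a)
  refine ⟨α, a - F * α, by ring, ?_⟩
  intro k
  have h1 : PowerSeries.coeff k (a - F * α) =
      (PowerSeries.coeff k a - ∑ i : Fin k, cuspDivSeq F a i * PowerSeries.coeff (k - i) F) %
        PowerSeries.coeff 0 F := by
    rw [map_sub, mul_comm, cusp_coeff_mul]
    have h2 : PowerSeries.coeff k α = (PowerSeries.coeff k a - ∑ i : Fin k,
        cuspDivSeq F a i * PowerSeries.coeff (k - i) F) / PowerSeries.coeff 0 F := by
      simp only [α, PowerSeries.coeff_mk]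
      rw [cuspDivSeq]
    rw [h2, Finset.sum_range, EuclideanDomain.mod_eq_sub_mul_div]
    simp only [α, PowerSeries.coeff_mk]
    ring
  rw [h1]
  exact Polynomial.degree_mod_lt _ hF

theorem cusp_filt (M S G : CuspB) (h : M * S = G) (D : ℕ)
    (hM0 : PowerSeries.coeff 0 M ≠ 0) (hD : (PowerSeries.coeff 0 M).natDegree = D)
    (hM : ∀ k, (PowerSeries.coeff k M).natDegree ≤ D) (b : ℕ → ℕ) (hb : Monotone b)
    (hG : ∀ k, (PowerSeries.coeff k G).natDegree ≤ b k) (k : ℕ) :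
    PowerSeries.coeff k S = 0 ∨ (PowerSeries.coeff k S).natDegree + D ≤ b k := by
  induction k using Nat.strong_induction_on with
  | _ k ih =>
    by_cases h0 : PowerSeries.coeff k S = 0
    · exact Or.inl h0
    right
    have h1 : PowerSeries.coeff k S * PowerSeries.coeff 0 M = PowerSeries.coeff k G -
        ∑ i ∈ Finset.range k, PowerSeries.coeff i S * PowerSeries.coeff (k - i) M := by
      rw [← h, mul_comm M S, cusp_coeff_mul]; ring
    rw [← hD, ← Polynomial.natDegree_mul h0 hM0, h1]
    refine (Polynomial.natDegree_sub_le _ _).trans (max_le (hG k) ?_)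
    apply Polynomial.natDegree_sum_le_of_forall_le
    intro i hi
    rw [Finset.mem_range] at hi
    rcases ih i hi with h2 | h2
    · simp [h2]
    · refine Polynomial.natDegree_mul_le.trans ?_
      have := hM (k - i)
      have := hb hi.le
      omega

theorem cusp_weierstrass (G : CuspB) (hG : PowerSeries.coeff 0 G ≠ 0) :
    ∃ (U : CuspB) (P : Polynomial CuspR), PowerSeries.constantCoeff U = 1 ∧ G = U * cuspJ P ∧
      P.natDegree ≤ (PowerSeries.coeff 0 G).natDegree ∧
      PowerSeries.coeff 0 (cuspJ P) = PowerSeries.coeff 0 G := by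
  set q := (PowerSeries.coeff 0 G).natDegree with hq
  obtain ⟨α, r, h, hr⟩ := cusp_div G (PowerSeries.C (Polynomial.X ^ q)) hG
  rw [Polynomial.degree_eq_natDegree hG, ← hq] at hr
  have h0 : Polynomial.X ^ q = PowerSeries.coeff 0 G * PowerSeries.coeff 0 α +
      PowerSeries.coeff 0 r := by
    have := congrArg (PowerSeries.coeff 0) h
    simpa using this
  have hdeg : (PowerSeries.coeff 0 G * PowerSeries.coeff 0 α).degree = (q : WithBot ℕ) := by
    rw [show PowerSeries.coeff 0 G * PowerSeries.coeff 0 α =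
      Polynomial.X ^ q - PowerSeries.coeff 0 r by rw [h0]; ring,
      Polynomial.degree_sub_eq_left_of_degree_lt (by simpa using hr 0), Polynomial.degree_X_pow]
  have hα0 : PowerSeries.coeff 0 α ≠ 0 := by
    intro h1
    rw [h1, mul_zero, Polynomial.degree_zero] at hdeg
    exact absurd hdeg (by simp)
  have hαd : (PowerSeries.coeff 0 α).natDegree = 0 := by
    have h1 := Polynomial.natDegree_eq_of_degree_eq_some hdeg
    rw [Polynomial.natDegree_mul hG hα0] at h1
    omega
  obtain ⟨a, ha⟩ := Polynomial.natDegree_eq_zero.mp hαd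
  have ha0 : a ≠ 0 := by rintro rfl; apply hα0; rw [← ha, map_zero]
  have hαu : IsUnit α := by
    rw [PowerSeries.isUnit_iff_constantCoeff, ← PowerSeries.coeff_zero_eq_constantCoeff_apply, ← ha]
    exact (Ne.isUnit ha0).map Polynomial.C
  obtain ⟨α', hα'⟩ := hαu.exists_right_inv
  obtain ⟨P, hP, hPd⟩ := cuspJ_lift (PowerSeries.C (Polynomial.C a⁻¹) * (G * α)) q (by
    intro k
    rw [PowerSeries.coeff_C_mul]
    refine (Polynomial.natDegree_C_mul_le _ _).trans ?_
    rw [show G * α = PowerSeries.C (Polynomial.X ^ q) - r by rw [h]; ring, map_sub]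
    refine (Polynomial.natDegree_sub_le _ _).trans (max_le ?_ ?_)
    · rw [PowerSeries.coeff_C]; split_ifs <;> simp
    · exact Polynomial.natDegree_le_of_degree_le (hr k).le)
  have hC : (PowerSeries.C (Polynomial.C a) : CuspB) * PowerSeries.C (Polynomial.C a⁻¹) = 1 := by
    rw [← map_mul, ← map_mul, mul_inv_cancel₀ ha0, map_one, map_one]
  refine ⟨PowerSeries.C (Polynomial.C a) * α', P, ?_, ?_, hPd, ?_⟩
  · have := congrArg (PowerSeries.coeff 0) hα'
    rw [cusp_coeff_zero_mul, ← ha] at this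
    simpa using this
  · rw [hP]
    linear_combination -G * hα' - G * α * α' * hC
  · rw [hP, PowerSeries.coeff_C_mul, cusp_coeff_zero_mul, ← ha,
      mul_comm (PowerSeries.coeff 0 G), ← mul_assoc, ← map_mul, inv_mul_cancel₀ ha0, map_one,
      one_mul]

/-! ### Part 5: the blow-up homomorphism `x ↦ x`, `y ↦ x ^ N * t` -/

/-- The exponent of `x ^ i * y ^ j`. -/
def cuspM (i j : ℕ) : Fin 2 →₀ ℕ := Finsupp.single 0 i + Finsupp.single 1 j

@[simp] theorem cuspM_zero (i j : ℕ) : cuspM i j 0 = i := by simp [cuspM]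
@[simp] theorem cuspM_one (i j : ℕ) : cuspM i j 1 = j := by simp [cuspM]

theorem cuspM_eq (d : Fin 2 →₀ ℕ) : d = cuspM (d 0) (d 1) := by
  ext i; fin_cases i <;> simp

theorem cusp_ext {f g : PS}
    (h : ∀ i j, MvPowerSeries.coeff (cuspM i j) f = MvPowerSeries.coeff (cuspM i j) g) : f = g := by
  ext d
  rw [cuspM_eq d]
  exact h _ _

/-- The substitution `x ↦ x`, `y ↦ x ^ N * t`. -/
def cuspSub (N : ℕ) : Fin 2 → MvPowerSeries Unit (Polynomial ℝ) :=
  ![(PowerSeries.X : CuspB), (PowerSeries.X ^ N * cuspT : CuspB)]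

theorem cusp_hasSubst (N : ℕ) (hN : N ≠ 0) : MvPowerSeries.HasSubst (cuspSub N) := by
  apply MvPowerSeries.hasSubst_of_constantCoeff_zero
  intro s
  fin_cases s
  · exact PowerSeries.constantCoeff_X
  · change PowerSeries.constantCoeff (PowerSeries.X ^ N * cuspT : CuspB) = 0
    simp [hN]

/-- The homomorphism `x ↦ x`, `y ↦ x ^ N * t`. -/
def cuspPhi (N : ℕ) (hN : N ≠ 0) : PS →ₐ[ℝ] CuspB := MvPowerSeries.substAlgHom (cusp_hasSubst N hN)

theorem cuspPhi_X (N : ℕ) (hN : N ≠ 0) : cuspPhi N hN psX = PowerSeries.X := by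
  rw [cuspPhi, psX, MvPowerSeries.substAlgHom_X]; rfl

theorem cuspPhi_Y (N : ℕ) (hN : N ≠ 0) : cuspPhi N hN psY = PowerSeries.X ^ N * cuspT := by
  rw [cuspPhi, psY, MvPowerSeries.substAlgHom_X]; rfl

theorem cuspPhi_coeff (N : ℕ) (hN : N ≠ 0) (f : PS) (k j : ℕ) :
    (PowerSeries.coeff k (cuspPhi N hN f)).coeff j =
      if N * j ≤ k then MvPowerSeries.coeff (cuspM (k - N * j) j) f else 0 := by
  have h0 := MvPowerSeries.coeff_subst (cusp_hasSubst N hN) f (Finsupp.single () k)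
  have hfin := MvPowerSeries.coeff_subst_finite (cusp_hasSubst N hN) f (Finsupp.single () k)
  have h1 : PowerSeries.coeff k (cuspPhi N hN f) = ∑ᶠ d : Fin 2 →₀ ℕ, MvPowerSeries.coeff d f •
      PowerSeries.coeff k (d.prod fun s e => (cuspSub N s : CuspB) ^ e) := by
    refine Eq.trans ?_ h0
    simp only [cuspPhi, MvPowerSeries.substAlgHom_apply]
    rfl
  have hterm : ∀ d : Fin 2 →₀ ℕ, (MvPowerSeries.coeff d f •
      PowerSeries.coeff k (d.prod fun s e => (cuspSub N s : CuspB) ^ e)).coeff j =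
      if (d 0 + N * d 1 = k ∧ d 1 = j) then MvPowerSeries.coeff d f else 0 := by
    intro d
    rw [Finsupp.prod_fintype _ _ (by simp), Fin.prod_univ_two]
    rw [show cuspSub N 0 = (PowerSeries.X : CuspB) from rfl,
      show cuspSub N 1 = (PowerSeries.X ^ N * cuspT : CuspB) from rfl]
    rw [mul_pow, ← pow_mul, ← mul_assoc, ← pow_add, ← map_pow, PowerSeries.coeff_mul_C,
      PowerSeries.coeff_X_pow, Polynomial.coeff_smul]
    split_ifs with h2 h3 h3
    · simp [← h3.2]
    · have : d 1 ≠ j := fun h => h3 ⟨h2.symm, h⟩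
      simp [Polynomial.coeff_X_pow, this.symm]
    · exact absurd h3.1.symm h2
    · simp
  rw [h1]
  have h2 := (Polynomial.lcoeff ℝ j).toAddMonoidHom.map_finsum hfin
  refine Eq.trans h2 ?_
  refine (finsum_congr (fun d => hterm d)).trans ?_
  split_ifs with hk
  · rw [finsum_eq_single _ (cuspM (k - N * j) j)]
    · simp; omega
    · intro d hd
      rw [if_neg]
      rintro ⟨h3, h4⟩
      apply hd
      rw [cuspM_eq d, h4]
      congr 1
      rw [h4] at h3; omega
  · refine Eq.trans (finsum_congr fun d => ?_) finsum_zero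
    rw [if_neg]
    rintro ⟨h3, rfl⟩
    omega

theorem cuspPhi_coeff' (N : ℕ) (hN : N ≠ 0) (f : PS) (i j : ℕ) :
    MvPowerSeries.coeff (cuspM i j) f =
    (PowerSeries.coeff (i + N * j) (cuspPhi N hN f)).coeff j := by
  rw [cuspPhi_coeff, if_pos (by omega), Nat.add_sub_cancel]

theorem cuspPhi_inj (N : ℕ) (hN : N ≠ 0) : Function.Injective (cuspPhi N hN) := by
  intro f g h
  apply cusp_ext
  intro i j
  rw [cuspPhi_coeff' N hN, cuspPhi_coeff' N hN, h]

theorem cuspPhi_natDegree (N : ℕ) (hN : N ≠ 0) (f : PS) (k : ℕ) :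
    (PowerSeries.coeff k (cuspPhi N hN f)).natDegree ≤ k / N := by
  rw [Polynomial.natDegree_le_iff_coeff_eq_zero]
  intro j hj
  rw [cuspPhi_coeff, if_neg]
  rw [Nat.div_lt_iff_lt_mul (by omega)] at hj
  rw [mul_comm]; omega

/-- Criterion to lie in the image of `cuspPhi`. -/
theorem cuspPhi_lift (N : ℕ) (hN : N ≠ 0) (b : CuspB)
    (hb : ∀ k, (PowerSeries.coeff k b).natDegree ≤ k / N) : ∃ f, cuspPhi N hN f = b := by
  let f : PS := fun d => (PowerSeries.coeff (d 0 + N * d 1) b).coeff (d 1)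
  refine ⟨f, ?_⟩
  ext k j
  rw [cuspPhi_coeff]
  split_ifs with h
  · change (PowerSeries.coeff (cuspM (k - N * j) j 0 + N * cuspM (k - N * j) j 1) b).coeff
      (cuspM (k - N * j) j 1) = _
    rw [cuspM_zero, cuspM_one, Nat.sub_add_cancel h]
  · rw [Polynomial.coeff_eq_zero_of_natDegree_lt]
    refine (hb k).trans_lt ?_
    rw [Nat.div_lt_iff_lt_mul (by omega), mul_comm]
    omega

/-- The inclusion `ℝ[[x]] → ℝ[[x,y]]`. -/
def cuspTheta : CuspR →ₐ[ℝ] PS := PowerSeries.substAlgHom (PowerSeries.HasSubst.X (S := ℝ) (0 : Fin 2))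

theorem cuspTheta_coeff (c : CuspR) (i j : ℕ) : MvPowerSeries.coeff (cuspM i j) (cuspTheta c) =
    if j = 0 then PowerSeries.coeff i c else 0 := by
  rw [cuspTheta, PowerSeries.coe_substAlgHom, PowerSeries.coeff_subst_single]
  have : cuspM i j = Finsupp.single 0 i ↔ j = 0 := by
    constructor
    · intro h
      have := DFunLike.congr_fun h 1
      simpa using this
    · rintro rfl; simp [cuspM]
  simp [this]

theorem cuspTheta_X : cuspTheta PowerSeries.X = psX := by
  simp [cuspTheta, PowerSeries.substAlgHom_X]

theorem cuspPhi_theta (N : ℕ) (hN : N ≠ 0) (c : CuspR) :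
    cuspPhi N hN (cuspTheta c) = PowerSeries.map Polynomial.C c := by
  ext k j
  rw [cuspPhi_coeff, cuspTheta_coeff, PowerSeries.coeff_map, Polynomial.coeff_C]
  by_cases hj : j = 0
  · subst hj; simp
  · simp [hj]
/-! ### Part 6: the Artin step -/

theorem cusp_artin (n : ℕ) (hn : 0 < n) (hN : 2 * n ≠ 0) (f : PS)
    (hf : ∀ P : Set FF, IsOrderingF P → (ι psY ∈ P ∧ ι psY ≠ 0) →
      (ι (psX ^ (2 * n) - psY) ∈ P ∧ ι (psX ^ (2 * n) - psY) ≠ 0) → ι f ∈ P) :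
    ∃ h : PS, h ≠ 0 ∧
      (cuspPhi (2 * n) hN h) ^ 2 * cuspPhi (2 * n) hN f ∈ cuspRep {cuspT, 1 - cuspT} := by
  have hinj : Function.Injective ι := IsFractionRing.injective PS FF
  have hPhi := cuspPhi_inj (2 * n) hN
  let φ := cuspPhi (2 * n) hN
  let T : Set FF := {z | ∃ h a : PS, h ≠ 0 ∧ (ι h) ^ 2 * z = ι a ∧
    φ a ∈ cuspRep {cuspT, 1 - cuspT}}
  have hTι : ∀ a : PS, φ a ∈ cuspRep {cuspT, 1 - cuspT} → ι a ∈ T := by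
    intro a ha
    exact ⟨1, a, one_ne_zero, by simp, ha⟩
  have hX : (PowerSeries.X : CuspB) ^ (2 * n) = (PowerSeries.X ^ n) ^ 2 := by
    rw [mul_comm, pow_mul]
  have hφY : φ psY = PowerSeries.X ^ (2 * n) * cuspT := cuspPhi_Y _ hN
  have hφG : φ (psX ^ (2 * n) - psY) = PowerSeries.X ^ (2 * n) * (1 - cuspT) := by
    rw [map_sub, map_pow, hφY, show φ psX = PowerSeries.X from cuspPhi_X _ hN]; ring
  have hT0 : (cuspT : CuspB) ≠ 0 := by
    intro h
    have := congrArg PowerSeries.constantCoeff h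
    simp at this
  have hT1 : (1 - cuspT : CuspB) ≠ 0 := by
    intro h
    have := congrArg (fun z => Polynomial.eval 0 (PowerSeries.constantCoeff z)) h
    simp at this
  have hXne : (PowerSeries.X : CuspB) ^ (2 * n) ≠ 0 := pow_ne_zero _ PowerSeries.X_ne_zero
  have hY0 : ι psY ≠ 0 := by
    rw [Ne, map_eq_zero_iff ι hinj, ← map_eq_zero_iff φ hPhi, hφY]
    exact mul_ne_zero hXne hT0
  have hG0 : ι (psX ^ (2 * n) - psY) ≠ 0 := by
    rw [Ne, map_eq_zero_iff ι hinj, ← map_eq_zero_iff φ hPhi, hφG]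
    exact mul_ne_zero hXne hT1
  have hYT : ι psY ∈ T := by
    apply hTι
    rw [hφY, hX, mul_comm]
    exact cuspRep_mem (by simp) _
  have hGT : ι (psX ^ (2 * n) - psY) ∈ T := by
    apply hTι
    rw [hφG, hX, mul_comm]
    exact cuspRep_mem (by simp) _
  have hfT : ι f ∈ T := by
    by_contra hfT
    have h2F : (2 : FF) ≠ 0 := by
      rw [show (2 : FF) = ι 2 from (map_ofNat ι 2).symm, Ne, map_eq_zero_iff ι hinj]
      intro h
      have := congrArg MvPowerSeries.constantCoeff h
      rw [map_ofNat, map_zero] at this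
      norm_num at this
    obtain ⟨P, hP, hTP, hfP⟩ := cusp_exists_ordering h2F T (by
        rintro z ⟨h, a, h0, h1, h2⟩ w ⟨h', a', h0', h1', h2'⟩
        refine ⟨h * h', h' ^ 2 * a + h ^ 2 * a', mul_ne_zero h0 h0', ?_, ?_⟩
        · simp only [map_mul, map_add, map_pow]
          rw [← h1, ← h1']; ring
        · simp only [map_mul, map_add, map_pow]
          exact add_mem (cuspRep_sq_mul _ h2) (cuspRep_sq_mul _ h2')) (by
        rintro z ⟨h, a, h0, h1, h2⟩ w ⟨h', a', h0', h1', h2'⟩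
        refine ⟨h * h', a * a', mul_ne_zero h0 h0', ?_, ?_⟩
        · simp only [map_mul]
          rw [← h1, ← h1']; ring
        · rw [map_mul]
          exact cuspRep_mul (cuspRep_mul_unit _) h2 h2') (by
        intro z
        obtain ⟨a, h, hh, rfl⟩ := IsFractionRing.div_surjective (A := PS) z
        have hh0 : h ≠ 0 := nonZeroDivisors.ne_zero hh
        have hh1 : ι h ≠ 0 := by rwa [Ne, map_eq_zero_iff ι hinj]
        refine ⟨h, a ^ 2, hh0, ?_, ?_⟩
        · change (ι h) ^ 2 * (ι a / ι h) ^ 2 = ι (a ^ 2)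
          rw [map_pow]; field_simp
        · rw [map_pow]; exact cuspRep_sq_unit _ _) (ι f) hfT
    exact hfP (hf P hP ⟨hTP hYT, hY0⟩ ⟨hTP hGT, hG0⟩)
  obtain ⟨h, a, h0, h1, h2⟩ := hfT
  refine ⟨h, h0, ?_⟩
  have h3 : h ^ 2 * f = a := by
    apply hinj
    rw [map_mul, map_pow, h1]
  change φ h ^ 2 * φ f ∈ _
  rw [← map_pow, ← map_mul, h3]
  exact h2

/-! ### Part 7: units of the blow-up -/

theorem cusp_split_y (F : PS) : ∃ (α : CuspR) (F' : PS), F = cuspTheta α + psY * F' ∧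
    (∀ i, PowerSeries.coeff i α = MvPowerSeries.coeff (cuspM i 0) F) ∧
    (∀ i j, MvPowerSeries.coeff (cuspM i j) F' = MvPowerSeries.coeff (cuspM i (j + 1)) F) := by
  let F' : PS := fun d => MvPowerSeries.coeff (cuspM (d 0) (d 1 + 1)) F
  have hF' : ∀ i j, MvPowerSeries.coeff (cuspM i j) F' =
      MvPowerSeries.coeff (cuspM i (j + 1)) F := by
    intro i j
    change MvPowerSeries.coeff (cuspM (cuspM i j 0) (cuspM i j 1 + 1)) F = _
    simp
  refine ⟨PowerSeries.mk fun i => MvPowerSeries.coeff (cuspM i 0) F, F', ?_, ?_, hF'⟩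
  · apply cusp_ext
    intro i j
    rw [map_add, cuspTheta_coeff]
    rcases j with _ | j
    · rw [if_pos rfl, show psY = MvPowerSeries.monomial (Finsupp.single 1 1) (1 : ℝ) from rfl, mul_comm, MvPowerSeries.coeff_mul_monomial, if_neg]
      · simp
      · intro h; have := h 1; simp at this
    · rw [if_neg (Nat.succ_ne_zero j), show psY = MvPowerSeries.monomial (Finsupp.single 1 1) (1 : ℝ) from rfl, mul_comm, MvPowerSeries.coeff_mul_monomial, if_pos]
      · rw [show cuspM i (j + 1) - Finsupp.single 1 1 = cuspM i j by
          ext s; fin_cases s <;> simp, hF']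
        simp
      · intro s; fin_cases s <;> simp
  · intro i; simp

/-- The preordering. -/
abbrev cuspPre (N : ℕ) : Subsemiring PS :=
  Subsemiring.closure ({psY, psX ^ N - psY} ∪ {a | ∃ b, a = b ^ 2})

theorem cuspPre_Y (N : ℕ) : psY ∈ cuspPre N := Subsemiring.subset_closure (by simp)
theorem cuspPre_G (N : ℕ) : psX ^ N - psY ∈ cuspPre N := Subsemiring.subset_closure (by simp)
theorem cuspPre_sq (N : ℕ) (b : PS) : b ^ 2 ∈ cuspPre N :=
  Subsemiring.subset_closure (Or.inr ⟨b, rfl⟩)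

theorem cuspPre_unit (N : ℕ) (b : PS) (hb : 0 < MvPowerSeries.constantCoeff b) :
    b ∈ cuspPre N := by
  obtain ⟨v, rfl⟩ := cusp_sqrt_pos b hb
  exact cuspPre_sq N v

theorem cuspPre_even (N : ℕ) (b : PS) (r : ℕ) (hr : Even r) : b ^ r ∈ cuspPre N := by
  obtain ⟨s, rfl⟩ := hr
  rw [← two_mul, mul_comm, pow_mul]
  exact cuspPre_sq N _

theorem cusp_unit_mem (N : ℕ) (hN : Even N) (hN0 : N ≠ 0) (r : ℕ) : Even r → ∀ (ε : ℝ), 0 < ε →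
    ∀ F : PS, (∀ i j, i + N * j ≤ r → MvPowerSeries.coeff (cuspM i j) F = 0) →
    MvPowerSeries.C ε * psX ^ r + F ∈ cuspPre N := by
  induction r using Nat.strong_induction_on with
  | _ r ih =>
  intro hr ε hε F hF
  obtain ⟨α, F', hFF, hα, hF'⟩ := cusp_split_y F
  obtain ⟨β, hβ⟩ : (PowerSeries.X : CuspR) ^ (r + 1) ∣ α := by
    rw [PowerSeries.X_pow_dvd_iff]
    intro m hm
    rw [hα]
    exact hF _ _ (by omega)
  have hx : cuspTheta α = psX ^ r * (psX * cuspTheta β) := by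
    rw [hβ, map_mul, map_pow, cuspTheta_X]; ring
  have hC : (MvPowerSeries.C ε : PS) = MvPowerSeries.C (ε / 2) + MvPowerSeries.C (ε / 2) := by
    rw [← map_add]; congr 1; ring
  have h1 : psX ^ r * (MvPowerSeries.C (ε / 2) + psX * cuspTheta β) ∈ cuspPre N := by
    refine mul_mem (cuspPre_even _ _ _ hr) (cuspPre_unit _ _ ?_)
    simp; exact hε
  rcases le_or_gt N r with hrN | hrN
  · have h2 := ih (r - N) (by omega) (by
      rw [Nat.even_sub hrN]; tauto) (ε / 2) (by positivity) F' (by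
      intro i j hij
      rw [hF']
      apply hF
      rw [mul_add]; omega)
    have h3 : MvPowerSeries.C (ε / 2) * psX ^ (r - N) * (psX ^ N - psY) ∈ cuspPre N := by
      refine mul_mem (mul_mem (cuspPre_unit _ _ ?_) (cuspPre_even _ _ _ ?_)) (cuspPre_G _)
      · simp; exact hε
      · rw [Nat.even_sub hrN]; tauto
    have h4 : MvPowerSeries.C ε * psX ^ r + F =
        psX ^ r * (MvPowerSeries.C (ε / 2) + psX * cuspTheta β) +
        MvPowerSeries.C (ε / 2) * psX ^ (r - N) * (psX ^ N - psY) +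
        psY * (MvPowerSeries.C (ε / 2) * psX ^ (r - N) + F') := by
      rw [hFF, hx, hC]
      have : psX ^ r = psX ^ (r - N) * psX ^ N := by rw [← pow_add, Nat.sub_add_cancel hrN]
      linear_combination MvPowerSeries.C (ε / 2) * this
    rw [h4]
    exact add_mem (add_mem h1 h3) (mul_mem (cuspPre_Y _) h2)
  · set c : ℝ := |MvPowerSeries.constantCoeff F'| + 1 with hc
    have hc0 : 0 < c := by positivity
    have h3 : psX ^ r * (MvPowerSeries.C (ε / 2) - MvPowerSeries.C c * psX ^ (N - r)) ∈
        cuspPre N := by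
      refine mul_mem (cuspPre_even _ _ _ hr) (cuspPre_unit _ _ ?_)
      have : N - r ≠ 0 := by omega
      simp [this]; exact hε
    have h5 : MvPowerSeries.C c * (psX ^ N - psY) ∈ cuspPre N :=
      mul_mem (cuspPre_unit _ _ (by simpa using hc0)) (cuspPre_G _)
    have h6 : psY * (MvPowerSeries.C c + F') ∈ cuspPre N := by
      refine mul_mem (cuspPre_Y _) (cuspPre_unit _ _ ?_)
      have := neg_abs_le (MvPowerSeries.constantCoeff F')
      simp only [map_add, MvPowerSeries.constantCoeff_C]
      linarith
    have h4 : MvPowerSeries.C ε * psX ^ r + F =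
        psX ^ r * (MvPowerSeries.C (ε / 2) + psX * cuspTheta β) +
        psX ^ r * (MvPowerSeries.C (ε / 2) - MvPowerSeries.C c * psX ^ (N - r)) +
        MvPowerSeries.C c * (psX ^ N - psY) + psY * (MvPowerSeries.C c + F') := by
      rw [hFF, hx, hC]
      have : psX ^ N = psX ^ r * psX ^ (N - r) := by
        rw [← pow_add]; congr 1; omega
      linear_combination - MvPowerSeries.C c * this
    rw [h4]
    exact add_mem (add_mem (add_mem h1 h3) h5) h6
/-! ### Part 8: homogeneous evaluation -/

/-- `∑ θ (A_j) a ^ j b ^ (L - j)`. -/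
def cuspEv {R E : Type*} [CommRing R] [CommRing E] (θ : R →+* E) (a b : E) (L : ℕ) :
    Polynomial R →+ E where
  toFun A := ∑ j ∈ Finset.range (L + 1), θ (A.coeff j) * a ^ j * b ^ (L - j)
  map_zero' := by simp
  map_add' A B := by simp [add_mul, Finset.sum_add_distrib]

section Ev

variable {R E : Type*} [CommRing R] [CommRing E] (θ : R →+* E) (a b : E)

theorem cuspEv_apply (L : ℕ) (A : Polynomial R) : cuspEv θ a b L A =
    ∑ j ∈ Finset.range (L + 1), θ (A.coeff j) * a ^ j * b ^ (L - j) := rfl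

theorem cuspEv_monomial (L j : ℕ) (h : j ≤ L) (c : R) :
    cuspEv θ a b L (Polynomial.monomial j c) = θ c * a ^ j * b ^ (L - j) := by
  rw [cuspEv_apply, Finset.sum_eq_single j]
  · simp
  · intro i _ hi
    rw [Polynomial.coeff_monomial, if_neg (Ne.symm hi)]; simp
  · intro h1
    exact absurd (Finset.mem_range.mpr (by omega)) h1

theorem cuspEv_mul (K L : ℕ) (A B : Polynomial R) (hA : A.natDegree ≤ K) (hB : B.natDegree ≤ L) :
    cuspEv θ a b (K + L) (A * B) = cuspEv θ a b K A * cuspEv θ a b L B := by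
  have h1 := Polynomial.as_sum_range' A (K + 1) (by omega)
  have h2 := Polynomial.as_sum_range' B (L + 1) (by omega)
  conv_lhs => rw [h1, h2]
  rw [Finset.sum_mul_sum, map_sum, cuspEv_apply, cuspEv_apply, Finset.sum_mul_sum]
  refine Finset.sum_congr rfl fun i hi => ?_
  rw [map_sum]
  refine Finset.sum_congr rfl fun j hj => ?_
  rw [Finset.mem_range] at hi hj
  rw [Polynomial.monomial_mul_monomial, cuspEv_monomial _ _ _ _ _ (by omega), map_mul,
    show K + L - (i + j) = (K - i) + (L - j) by omega]
  ring

theorem cuspEv_one_one : cuspEv θ a b 1 1 = b := by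
  have := cuspEv_monomial θ a b 1 0 (by omega) 1
  simpa using this

theorem cuspEv_one_X : cuspEv θ a b 1 Polynomial.X = a := by
  have := cuspEv_monomial θ a b 1 1 (by omega) 1
  rw [Polynomial.monomial_one_one_eq_X] at this
  simpa using this

theorem cuspEv_C (c : R) : cuspEv θ a b 0 (Polynomial.C c) = θ c := by
  have := cuspEv_monomial θ a b 0 0 (by omega) c
  simpa using this

theorem cuspEv_pow (k : ℕ) (A : Polynomial R) (hA : A.natDegree ≤ 1) :
    cuspEv θ a b k (A ^ k) = cuspEv θ a b 1 A ^ k := by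
  induction k with
  | zero => simpa using cuspEv_C θ a b 1
  | succ k ih =>
    rw [pow_succ, cuspEv_mul _ _ _ _ _ _ _ _ hA, ih, pow_succ]
    refine Polynomial.natDegree_pow_le.trans ?_
    nlinarith

theorem cuspEv_comp (q : ℕ) (P : Polynomial R) :
    cuspEv θ a b q (cuspEv Polynomial.C Polynomial.X (1 + Polynomial.X) q P) =
      cuspEv θ a (a + b) q P := by
  rw [cuspEv_apply Polynomial.C, map_sum, cuspEv_apply]
  refine Finset.sum_congr rfl fun j hj => ?_
  rw [Finset.mem_range] at hj
  obtain ⟨k, rfl⟩ := Nat.exists_eq_add_of_le (show j ≤ q by omega)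
  have h1 : (1 + Polynomial.X : Polynomial R).natDegree ≤ 1 := by
    refine (Polynomial.natDegree_add_le _ _).trans (max_le (by simp) Polynomial.natDegree_X_le)
  have h2 : (Polynomial.C (P.coeff j) * Polynomial.X ^ j).natDegree ≤ j :=
    Polynomial.natDegree_C_mul_X_pow_le _ _
  have h3 : ((1 + Polynomial.X : Polynomial R) ^ k).natDegree ≤ k := by
    refine Polynomial.natDegree_pow_le.trans ?_
    nlinarith
  rw [Nat.add_sub_cancel_left, cuspEv_mul _ _ _ _ _ _ _ h2 h3, Polynomial.C_mul_X_pow_eq_monomial,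
    cuspEv_monomial _ _ _ _ _ le_rfl, cuspEv_pow _ _ _ _ _ h1, map_add, cuspEv_one_one,
    cuspEv_one_X, add_comm a b, Nat.sub_self, pow_zero, mul_one]

end Ev

/-- Homogenization followed by `(t, 1) ↦ (w, 1 + w)`. -/
abbrev cuspHom (R : Type*) [CommRing R] (L : ℕ) : Polynomial R →+ Polynomial R :=
  cuspEv Polynomial.C Polynomial.X (1 + Polynomial.X) L

theorem cuspHom_ne_zero {R : Type*} [CommRing R] (L : ℕ) (A : Polynomial R) (hA : A ≠ 0)
    (hL : A.natDegree ≤ L) : cuspHom R L A ≠ 0 := by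
  intro h
  have h1 := cuspEv_comp (Polynomial.C : R →+* Polynomial R) Polynomial.X (1 - Polynomial.X) L A
  rw [show cuspEv Polynomial.C Polynomial.X (1 + Polynomial.X) L A = 0 from h, map_zero,
    show (Polynomial.X + (1 - Polynomial.X) : Polynomial R) = 1 by ring, cuspEv_apply] at h1
  apply hA
  rw [Polynomial.as_sum_range' A (L + 1) (by omega), h1]
  refine Finset.sum_congr rfl fun j _ => ?_
  rw [one_pow, mul_one, Polynomial.C_mul_X_pow_eq_monomial]

theorem cuspHom_natDegree {R : Type*} [CommRing R] (L : ℕ) (A : Polynomial R) :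
    (cuspHom R L A).natDegree ≤ L := by
  rw [cuspEv_apply]
  apply Polynomial.natDegree_sum_le_of_forall_le
  intro j hj
  rw [Finset.mem_range] at hj
  have h1 : (1 + Polynomial.X : Polynomial R).natDegree ≤ 1 := by
    refine (Polynomial.natDegree_add_le _ _).trans (max_le (by simp) Polynomial.natDegree_X_le)
  have h2 : ((1 + Polynomial.X : Polynomial R) ^ (L - j)).natDegree ≤ L - j := by
    refine Polynomial.natDegree_pow_le.trans ?_
    nlinarith
  have h3 : (Polynomial.C (A.coeff j) * Polynomial.X ^ j).natDegree ≤ j :=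
    Polynomial.natDegree_C_mul_X_pow_le _ _
  refine Polynomial.natDegree_mul_le.trans ?_
  omega

theorem cuspHom_map {R S : Type*} [CommRing R] [CommRing S] (f : R →+* S) (L : ℕ)
    (A : Polynomial R) : (cuspHom R L A).map f = cuspHom S L (A.map f) := by
  rw [cuspEv_apply, cuspEv_apply, Polynomial.map_sum]
  refine Finset.sum_congr rfl fun j _ => ?_
  simp

theorem cuspHom_rep {R : Type*} [CommRing R] (ρ : Polynomial R)
    (hρ : ρ ∈ cuspRep ({Polynomial.X, 1 - Polynomial.X} : Set (Polynomial R))) :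
    ∃ e0, ∀ e, e0 ≤ e → cuspHom R (2 * e + 1) ρ ∈
      cuspRep ({1, Polynomial.X} : Set (Polynomial R)) := by
  induction hρ using AddSubmonoid.closure_induction with
  | mem z hz =>
    obtain ⟨c, hc, v, rfl⟩ := hz
    refine ⟨v.natDegree, fun e he => ?_⟩
    have hc1 : c.natDegree ≤ 1 := by
      rcases hc with rfl | rfl
      · exact Polynomial.natDegree_X_le
      · refine (Polynomial.natDegree_sub_le _ _).trans (max_le (by simp) Polynomial.natDegree_X_le)
    rw [pow_two, show 2 * e + 1 = 1 + (e + e) by ring, cuspEv_mul _ _ _ _ _ _ _ hc1,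
      cuspEv_mul _ _ _ _ _ _ _ he he, ← pow_two]
    · apply cuspRep_mem
      rcases hc with rfl | rfl
      · rw [cuspEv_one_X]; simp
      · rw [map_sub, cuspEv_one_X, cuspEv_one_one]; simp
    · refine Polynomial.natDegree_mul_le.trans ?_
      omega
  | zero => exact ⟨0, fun e _ => by rw [map_zero]; exact zero_mem _⟩
  | add z w _ _ hz hw =>
    obtain ⟨e1, h1⟩ := hz
    obtain ⟨e2, h2⟩ := hw
    refine ⟨max e1 e2, fun e he => ?_⟩
    rw [map_add]
    exact add_mem (h1 e (le_trans (le_max_left _ _) he)) (h2 e (le_trans (le_max_right _ _) he))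

theorem cuspHom_unit (s : ℕ) (S : Polynomial CuspR)
    (hS : S.map PowerSeries.constantCoeff = 1) :
    cuspHom CuspR s S ∈ cuspRep ({1, Polynomial.X} : Set (Polynomial CuspR)) := by
  have hmap : (cuspHom CuspR s S).map PowerSeries.constantCoeff =
      (1 + Polynomial.X) ^ s := by
    rw [cuspHom_map, hS]
    have := cuspEv_monomial (Polynomial.C : ℝ →+* _) Polynomial.X (1 + Polynomial.X) s 0
      (by omega) 1
    simpa using this
  rw [Polynomial.as_sum_range' (cuspHom CuspR s S) (s + 1)
    (Nat.lt_succ_of_le (cuspHom_natDegree s S))]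
  refine sum_mem fun i hi => ?_
  rw [Finset.mem_range] at hi
  have h1 : PowerSeries.constantCoeff ((cuspHom CuspR s S).coeff i) = (s.choose i : ℝ) := by
    rw [← Polynomial.coeff_map, hmap, Polynomial.coeff_one_add_X_pow]
  obtain ⟨v, hv⟩ : ∃ v : CuspR, (cuspHom CuspR s S).coeff i = v ^ 2 := by
    apply cusp_sqrt_pos (τ := Unit)
    change 0 < PowerSeries.constantCoeff ((cuspHom CuspR s S).coeff i)
    rw [h1]
    exact_mod_cast Nat.choose_pos (by omega)
  rw [hv, ← Polynomial.C_mul_X_pow_eq_monomial]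
  rcases Nat.even_or_odd' i with ⟨k, rfl | rfl⟩
  · rw [show Polynomial.C (v ^ 2) * Polynomial.X ^ (2 * k) =
      1 * (Polynomial.C v * Polynomial.X ^ k) ^ 2 by rw [map_pow]; ring]
    exact cuspRep_mem (by simp) _
  · rw [show Polynomial.C (v ^ 2) * Polynomial.X ^ (2 * k + 1) =
      Polynomial.X * (Polynomial.C v * Polynomial.X ^ k) ^ 2 by rw [map_pow]; ring]
    exact cuspRep_mem (by simp) _

theorem cusp_X_factor {S : Type*} [CommRing S] (z : PowerSeries S) (hz : z ≠ 0) :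
    ∃ (k : ℕ) (G : PowerSeries S), z = PowerSeries.X ^ k * G ∧ PowerSeries.coeff 0 G ≠ 0 := by
  obtain ⟨k, hk⟩ := ENat.ne_top_iff_exists.mp (by rwa [Ne, PowerSeries.order_eq_top] : z.order ≠ ⊤)
  have h1 := PowerSeries.order_eq_nat.mp hk.symm
  obtain ⟨G, hG⟩ := PowerSeries.X_pow_dvd_iff.mpr h1.2
  refine ⟨k, G, hG, ?_⟩
  have h2 := h1.1
  rw [hG] at h2
  simpa [PowerSeries.coeff_X_pow_mul'] using h2

theorem cusp_repQ (P D S ρ : Polynomial CuspR) (q : ℕ) (hq : P.natDegree ≤ q) (hD : D ≠ 0)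
    (hS : S.map PowerSeries.constantCoeff = 1)
    (hρ : ρ ∈ cuspRep ({Polynomial.X, 1 - Polynomial.X} : Set (Polynomial CuspR)))
    (h : D ^ 2 * P * S = ρ) :
    cuspHom CuspR q P ∈ cuspRep ({1, Polynomial.X} : Set (Polynomial CuspR)) := by
  obtain ⟨e0, he0⟩ := cuspHom_rep ρ hρ
  set d := D.natDegree with hd
  obtain ⟨e, s, hes, hs, hee⟩ : ∃ e s : ℕ, 2 * e + 1 = d + d + q + s ∧ S.natDegree ≤ s ∧ e0 ≤ e :=
    ⟨e0 + d + q + S.natDegree, 2 * (e0 + d + q + S.natDegree) + 1 - (d + d + q), by omega,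
      by omega, by omega⟩
  have h1 := he0 e hee
  have hDD : (D * D).natDegree ≤ d + d := Polynomial.natDegree_mul_le
  rw [← h, pow_two, hes, cuspEv_mul _ _ _ _ _ _ _ (Polynomial.natDegree_mul_le.trans (by omega)) hs,
    cuspEv_mul _ _ _ _ _ _ _ hDD hq, cuspEv_mul _ _ _ _ _ _ _ le_rfl le_rfl] at h1
  have h2 := cuspRep_mul (cuspRep_mul_one _) h1 (cuspHom_unit s S hS)
  have hS0 : S ≠ 0 := by rintro rfl; simp at hS
  have hD' : cuspHom CuspR d D * cuspHom CuspR s S ≠ 0 :=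
    mul_ne_zero (cuspHom_ne_zero _ _ hD le_rfl) (cuspHom_ne_zero _ _ hS0 hs)
  obtain ⟨ι', _, c, v, hc, hv⟩ := cuspRep_family h2
  obtain ⟨δ, v', hδ, hv'⟩ := cusp_cassels_pfister c (by
      intro i
      rcases hc i with h3 | h3
      · rw [h3]; simp
      · rw [h3]; exact Polynomial.natDegree_X_le) (fun v hv i => cusp_aniso_RX c v hc hv i)
    (cuspHom CuspR q P) _ _ hD' le_rfl v (by rw [← hv]; ring)
  obtain ⟨k, G, rfl, hG⟩ := cusp_X_factor δ hδ
  have hGu : IsUnit G := by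
    rw [PowerSeries.isUnit_iff_constantCoeff, ← PowerSeries.coeff_zero_eq_constantCoeff_apply]
    exact Ne.isUnit hG
  obtain ⟨G', hG'⟩ := hGu.exists_right_inv
  apply cuspPts_RX.cancel (by simp [PowerSeries.X_ne_zero]) _ k
  have h3 : (Polynomial.C PowerSeries.X) ^ (2 * k) * cuspHom CuspR q P =
      Polynomial.C G' ^ 2 * ∑ i, c i * v' i ^ 2 := by
    rw [← hv']
    have h4 : (Polynomial.C G * Polynomial.C G' : Polynomial CuspR) = 1 := by
      rw [← map_mul, hG', map_one]
    rw [map_mul, map_pow]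
    have h5 : (Polynomial.C G * Polynomial.C G' : Polynomial CuspR) ^ 2 = 1 := by
      rw [h4, one_pow]
    linear_combination -(Polynomial.C PowerSeries.X) ^ (2 * k) * cuspHom CuspR q P * h5
  rw [h3]
  exact cuspRep_sq_mul _ (cuspRep_sum _ _ hc)

theorem cusp_degree_bound {ι' : Type*} [Fintype ι'] (c v : ι' → Polynomial CuspR)
    (hc : ∀ i, c i ∈ ({1, Polynomial.X} : Set (Polynomial CuspR))) (q : ℕ)
    (hq : (∑ i, c i * v i ^ 2).natDegree ≤ q) (i : ι') : (c i * v i ^ 2).natDegree ≤ q := by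
  by_contra hi
  obtain ⟨k, _, hk⟩ := Finset.exists_max_image Finset.univ (fun i => (c i * v i ^ 2).natDegree)
    ⟨i, Finset.mem_univ i⟩
  set M := (c k * v k ^ 2).natDegree with hM
  have hMq : q < M := lt_of_lt_of_le (not_le.mp hi) (hk i (Finset.mem_univ i))
  have hmon : ∀ i, (c i).Monic := by
    intro i
    rcases hc i with h3 | h3
    · rw [h3]; exact Polynomial.monic_one
    · rw [h3]; exact Polynomial.monic_X
  have h1 : ∑ i, (if (c i * v i ^ 2).natDegree = M then (v i).leadingCoeff else 0) ^ 2 = 0 := by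
    refine Eq.trans ?_ (Polynomial.coeff_eq_zero_of_natDegree_lt (lt_of_le_of_lt hq hMq))
    rw [Polynomial.finsetSum_coeff]
    refine Finset.sum_congr rfl fun i _ => ?_
    split_ifs with h2
    · rw [← h2]
      change _ = (c i * v i ^ 2).leadingCoeff
      rw [Polynomial.leadingCoeff_mul, hmon i, one_mul, Polynomial.leadingCoeff_pow]
    · rw [Polynomial.coeff_eq_zero_of_natDegree_lt
        (lt_of_le_of_ne (hk i (Finset.mem_univ i)) h2)]
      simp
  have h2 := cusp_aniso_R _ h1 k
  rw [if_pos rfl, Polynomial.leadingCoeff_eq_zero] at h2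
  rw [h2] at hM
  simp at hM
  omega

theorem cusp_ev_mem {E : Type*} [CommRing E] (θ : CuspR →+* E) (a b : E) (T : Subsemiring E)
    (ha : a ∈ T) (hb : b ∈ T) (hsq : ∀ z : E, z ^ 2 ∈ T) (q : ℕ) (Q : Polynomial CuspR)
    (hQ : Q ∈ cuspRep ({1, Polynomial.X} : Set (Polynomial CuspR))) (hq : Q.natDegree ≤ q) :
    cuspEv θ a b q Q ∈ T := by
  obtain ⟨ι', _, c, v, hc, rfl⟩ := cuspRep_family hQ
  rw [map_sum]
  refine sum_mem fun i _ => ?_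
  have hd := cusp_degree_bound c v hc q hq i
  generalize hw : v i = w at *
  by_cases hw0 : w = 0
  · rw [hw0]; simp
  rcases hc i with h3 | h3
  · rw [h3, one_mul, Polynomial.natDegree_pow] at hd
    rw [h3]
    rcases Nat.even_or_odd' q with ⟨e, rfl | rfl⟩
    · rw [one_mul, pow_two, two_mul, cuspEv_mul _ _ _ _ _ _ _ (by omega) (by omega), ← pow_two]
      exact hsq _
    · rw [pow_two, show 2 * e + 1 = 1 + (e + e) by ring, cuspEv_mul _ _ _ _ _ _ _ (by simp),
        cuspEv_mul _ _ _ _ _ _ _ (by omega) (by omega), ← pow_two, cuspEv_one_one]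
      · exact mul_mem hb (hsq _)
      · refine Polynomial.natDegree_mul_le.trans ?_; omega
  · rw [h3, Polynomial.natDegree_mul Polynomial.X_ne_zero (pow_ne_zero _ hw0),
      Polynomial.natDegree_pow, Polynomial.natDegree_X] at hd
    rw [h3]
    rcases Nat.even_or_odd' q with ⟨e, rfl | rfl⟩
    · obtain ⟨e, rfl⟩ : ∃ e', e = e' + 1 := ⟨e - 1, by omega⟩
      rw [pow_two, show Polynomial.X * (w * w) = 1 * (Polynomial.X * (w * w)) by ring,
        show 2 * (e + 1) = 1 + (1 + (e + e)) by ring, cuspEv_mul _ _ _ _ _ _ _ (by simp),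
        cuspEv_mul _ _ _ _ _ _ _ Polynomial.natDegree_X_le,
        cuspEv_mul _ _ _ _ _ _ _ (by omega) (by omega), ← pow_two, cuspEv_one_one, cuspEv_one_X]
      · exact mul_mem hb (mul_mem ha (hsq _))
      · refine Polynomial.natDegree_mul_le.trans ?_; omega
      · refine Polynomial.natDegree_mul_le.trans ?_
        have : (w * w).natDegree ≤ e + e := by
          refine Polynomial.natDegree_mul_le.trans ?_; omega
        rw [Polynomial.natDegree_X]; omega
    · rw [pow_two, show 2 * e + 1 = 1 + (e + e) by ring,
        cuspEv_mul _ _ _ _ _ _ _ Polynomial.natDegree_X_le,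
        cuspEv_mul _ _ _ _ _ _ _ (by omega) (by omega), ← pow_two, cuspEv_one_X]
      · exact mul_mem ha (hsq _)
      · refine Polynomial.natDegree_mul_le.trans ?_; omega
/-! ### Part 9: reduction to polynomials and conclusion -/

theorem cusp_reduce_rep (M0 : Polynomial CuspR) (hM0 : PowerSeries.coeff 0 (cuspJ M0) ≠ 0)
    (z : CuspB) (hz : z ∈ cuspRep ({cuspT, 1 - cuspT} : Set CuspB)) :
    ∃ L0, ∀ L, L0 ≤ L → ∃ ρ ∈ cuspRep ({Polynomial.X, 1 - Polynomial.X} : Set (Polynomial CuspR)),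
      ∃ β : CuspB, cuspT ^ (2 * L) * z =
        cuspJ ρ + PowerSeries.X * cuspJ (M0 * Polynomial.X ^ (2 * L)) * β := by
  induction hz using AddSubmonoid.closure_induction with
  | mem z hz =>
    obtain ⟨c, hc, v, rfl⟩ := hz
    refine ⟨(PowerSeries.coeff 0 v).natDegree + 1, fun L hL => ?_⟩
    set M := cuspJ (M0 * Polynomial.X ^ (2 * L)) with hM
    have hMc : PowerSeries.coeff 0 M = PowerSeries.coeff 0 (cuspJ M0) * Polynomial.X ^ (2 * L) := by
      rw [hM, map_mul, cusp_coeff_zero_mul, map_pow, cuspJ_X, ← map_pow, PowerSeries.coeff_zero_C]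
    have hMc0 : PowerSeries.coeff 0 M ≠ 0 := by
      rw [hMc]; exact mul_ne_zero hM0 (pow_ne_zero _ Polynomial.X_ne_zero)
    obtain ⟨α, r, h1, h2⟩ := cusp_div M (v * cuspT ^ L) hMc0
    have hα : PowerSeries.coeff 0 α = 0 := by
      by_contra hα
      have h3 : PowerSeries.coeff 0 M * PowerSeries.coeff 0 α =
          PowerSeries.coeff 0 v * Polynomial.X ^ L - PowerSeries.coeff 0 r := by
        have := congrArg (PowerSeries.coeff 0) h1
        rw [map_add, cusp_coeff_zero_mul, cusp_coeff_zero_mul, ← map_pow,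
          PowerSeries.coeff_zero_C] at this
        rw [this]; ring
      have h4 : (PowerSeries.coeff 0 M * PowerSeries.coeff 0 α).degree <
          (PowerSeries.coeff 0 M).degree := by
        rw [h3]
        refine lt_of_le_of_lt (Polynomial.degree_sub_le _ _) (max_lt ?_ (h2 0))
        rw [Polynomial.degree_eq_natDegree hMc0, hMc,
          Polynomial.natDegree_mul hM0 (pow_ne_zero _ Polynomial.X_ne_zero),
          Polynomial.natDegree_X_pow]
        refine lt_of_le_of_lt Polynomial.degree_le_natDegree ?_
        have : (PowerSeries.coeff 0 v * Polynomial.X ^ L).natDegree ≤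
            (PowerSeries.coeff 0 v).natDegree + L := by
          refine Polynomial.natDegree_mul_le.trans ?_
          rw [Polynomial.natDegree_X_pow]
        exact_mod_cast (by omega : (PowerSeries.coeff 0 v * Polynomial.X ^ L).natDegree <
          (PowerSeries.coeff 0 (cuspJ M0)).natDegree + 2 * L)
      exact absurd h4 (not_lt.mpr (Polynomial.degree_le_mul_left _ hα))
    obtain ⟨α', rfl⟩ : PowerSeries.X ∣ α := by
      rw [PowerSeries.X_dvd_iff, ← PowerSeries.coeff_zero_eq_constantCoeff_apply, hα]
    obtain ⟨r', rfl, _⟩ := cuspJ_lift r (PowerSeries.coeff 0 M).natDegree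
      (fun k => Polynomial.natDegree_le_natDegree (h2 k).le)
    obtain ⟨c', hc', rfl⟩ : ∃ c' ∈ ({Polynomial.X, 1 - Polynomial.X} : Set (Polynomial CuspR)),
        cuspJ c' = c := by
      rcases hc with rfl | rfl
      · exact ⟨_, by simp, cuspJ_X⟩
      · exact ⟨1 - Polynomial.X, by simp, by rw [map_sub, map_one, cuspJ_X]⟩
    refine ⟨c' * r' ^ 2, cuspRep_mem hc' _, cuspJ c' * (2 * cuspJ r' * α' +
      PowerSeries.X * M * α' ^ 2), ?_⟩
    rw [show cuspT ^ (2 * L) * (cuspJ c' * v ^ 2) = cuspJ c' * (v * cuspT ^ L) ^ 2 by ring, h1,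
      map_mul, map_pow]
    ring
  | zero => exact ⟨0, fun e _ => ⟨0, zero_mem _, 0, by simp⟩⟩
  | add z w _ _ hz hw =>
    obtain ⟨e1, h1⟩ := hz
    obtain ⟨e2, h2⟩ := hw
    refine ⟨max e1 e2, fun L hL => ?_⟩
    obtain ⟨ρ, hρ, β, h3⟩ := h1 L (le_trans (le_max_left _ _) hL)
    obtain ⟨ρ', hρ', β', h4⟩ := h2 L (le_trans (le_max_right _ _) hL)
    refine ⟨ρ + ρ', add_mem hρ hρ', β + β', ?_⟩
    rw [mul_add, h3, h4, map_add]; ring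

theorem cusp_reduce (M0 : Polynomial CuspR) (hM0 : PowerSeries.coeff 0 (cuspJ M0) ≠ 0)
    (hd : M0.natDegree ≤ (PowerSeries.coeff 0 (cuspJ M0)).natDegree)
    (hz : cuspJ M0 ∈ cuspRep ({cuspT, 1 - cuspT} : Set CuspB)) :
    ∃ (L : ℕ) (S : Polynomial CuspR), S.map PowerSeries.constantCoeff = 1 ∧
      M0 * Polynomial.X ^ (2 * L) * S ∈
        cuspRep ({Polynomial.X, 1 - Polynomial.X} : Set (Polynomial CuspR)) := by
  obtain ⟨L, hL⟩ := cusp_reduce_rep M0 hM0 _ hz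
  obtain ⟨ρ, hρ, β, h⟩ := hL L le_rfl
  set M := cuspJ (M0 * Polynomial.X ^ (2 * L)) with hM
  have hMc : PowerSeries.coeff 0 M = PowerSeries.coeff 0 (cuspJ M0) * Polynomial.X ^ (2 * L) := by
    rw [hM, map_mul, cusp_coeff_zero_mul, map_pow, cuspJ_X, ← map_pow, PowerSeries.coeff_zero_C]
  have hMc0 : PowerSeries.coeff 0 M ≠ 0 := by
    rw [hMc]; exact mul_ne_zero hM0 (pow_ne_zero _ Polynomial.X_ne_zero)
  have hMM : M = cuspT ^ (2 * L) * cuspJ M0 := by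
    rw [hM, map_mul, map_pow, cuspJ_X]; ring
  have h1 : M * (1 - PowerSeries.X * β) = cuspJ ρ := by
    rw [← hMM] at h
    linear_combination h
  have h2 := cusp_filt M (1 - PowerSeries.X * β) (cuspJ ρ) h1 _ hMc0 rfl (by
    intro k
    refine (cuspJ_natDegree _ k).trans ?_
    rw [hMc, Polynomial.natDegree_mul hM0 (pow_ne_zero _ Polynomial.X_ne_zero),
      Polynomial.natDegree_X_pow]
    refine Polynomial.natDegree_mul_le.trans ?_
    rw [Polynomial.natDegree_X_pow]
    omega) (fun _ => ρ.natDegree) (fun _ _ _ => le_rfl) (cuspJ_natDegree ρ)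
  obtain ⟨S, hS, _⟩ := cuspJ_lift (1 - PowerSeries.X * β) ρ.natDegree (by
    intro k
    rcases h2 k with h3 | h3
    · rw [h3]; simp
    · omega)
  refine ⟨L, S, ?_, ?_⟩
  · ext i
    rw [Polynomial.coeff_map, ← PowerSeries.coeff_zero_eq_constantCoeff_apply, ← cuspJ_coeff, hS]
    simp
  · convert hρ using 1
    apply cuspJ_inj
    rw [map_mul, hS, ← hM, h1]

theorem cusp_main (N : ℕ) (hN : N ≠ 0) (hNe : Even N) (f h : PS) (hf0 : f ≠ 0) (hh0 : h ≠ 0)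
    (hrep : (cuspPhi N hN h) ^ 2 * cuspPhi N hN f ∈ cuspRep ({cuspT, 1 - cuspT} : Set CuspB)) :
    f ∈ cuspPre N := by
  have hinj := cuspPhi_inj N hN
  obtain ⟨m, F, hF, hF0⟩ := cusp_X_factor (cuspPhi N hN f)
    (by rwa [Ne, map_eq_zero_iff _ hinj])
  obtain ⟨e, h', hh', hh'0⟩ := cusp_X_factor (cuspPhi N hN h)
    (by rwa [Ne, map_eq_zero_iff _ hinj])
  rw [hF, hh', show (PowerSeries.X ^ e * h') ^ 2 * (PowerSeries.X ^ m * F) =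
    PowerSeries.X ^ (2 * e + m) * (h' ^ 2 * F) by ring] at hrep
  obtain ⟨hme, hrep⟩ := cuspPts_B.cancel_odd PowerSeries.X_ne_zero _ _ hrep (by
    rw [PowerSeries.X_dvd_iff, ← PowerSeries.coeff_zero_eq_constantCoeff_apply,
      cusp_coeff_zero_mul, pow_two, cusp_coeff_zero_mul]
    exact mul_ne_zero (mul_ne_zero hh'0 hh'0) hF0)
  have hm : Even m := by
    rw [Nat.even_add] at hme
    exact hme.mp (even_two_mul e)
  obtain ⟨U, P, hU, hFU, hPd, hP0⟩ := cusp_weierstrass F hF0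
  obtain ⟨V, H, hV, hhV, hHd, hH0⟩ := cusp_weierstrass h' hh'0
  set q := (PowerSeries.coeff 0 F).natDegree with hq
  obtain ⟨W, hW⟩ : ∃ W : CuspB, U = W ^ 2 := cusp_sqrt_one (τ := Unit) U hU
  have hUu : IsUnit U := by
    rw [PowerSeries.isUnit_iff_constantCoeff, hU]; exact isUnit_one
  have hVu : IsUnit V := by
    rw [PowerSeries.isUnit_iff_constantCoeff, hV]; exact isUnit_one
  have hWu : IsUnit W := by
    rw [hW] at hUu
    exact (isUnit_pow_iff two_ne_zero).mp hUu
  obtain ⟨I, hI⟩ := (hVu.mul hWu).exists_right_inv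
  have hrep2 : cuspJ (H ^ 2 * P) ∈ cuspRep ({cuspT, 1 - cuspT} : Set CuspB) := by
    have h1 := cuspRep_sq_mul I hrep
    convert h1 using 1
    rw [hhV, hFU, hW, map_mul, map_pow]
    have h2 : (V * W * I) ^ 2 = 1 := by rw [hI, one_pow]
    linear_combination - cuspJ H ^ 2 * cuspJ P * h2
  have hc0 : PowerSeries.coeff 0 (cuspJ (H ^ 2 * P)) =
      PowerSeries.coeff 0 h' ^ 2 * PowerSeries.coeff 0 F := by
    rw [map_mul, map_pow, cusp_coeff_zero_mul, pow_two, cusp_coeff_zero_mul, hH0, hP0, pow_two]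
  have hc1 : PowerSeries.coeff 0 (cuspJ (H ^ 2 * P)) ≠ 0 := by
    rw [hc0]
    exact mul_ne_zero (pow_ne_zero _ hh'0) hF0
  obtain ⟨L, S, hS, hρ⟩ := cusp_reduce (H ^ 2 * P) hc1 (by
    rw [hc0, Polynomial.natDegree_mul (pow_ne_zero _ hh'0) hF0, Polynomial.natDegree_pow]
    refine Polynomial.natDegree_mul_le.trans ?_
    rw [Polynomial.natDegree_pow]
    omega) hrep2
  have hHne : H ≠ 0 := by
    rintro rfl
    rw [map_zero, map_zero] at hH0
    exact hh'0 hH0.symm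
  have hQ := cusp_repQ P (H * Polynomial.X ^ L) S _ q hPd
    (mul_ne_zero hHne (pow_ne_zero _ Polynomial.X_ne_zero)) hS hρ (by ring)
  have hPA := cusp_ev_mem cuspTheta.toRingHom psY (psX ^ N - psY) (cuspPre N) (cuspPre_Y N)
    (cuspPre_G N) (cuspPre_sq N) q _ hQ (cuspHom_natDegree q P)
  rw [cuspEv_comp, show psY + (psX ^ N - psY) = psX ^ N by ring] at hPA
  set PA := cuspEv cuspTheta.toRingHom psY (psX ^ N) q P with hPAdef
  have hφPA : cuspPhi N hN PA = PowerSeries.X ^ (N * q) * cuspJ P := by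
    rw [hPAdef, cuspEv_apply, map_sum, cuspJ, Polynomial.coe_eval₂RingHom,
      Polynomial.eval₂_eq_sum_range' _ (Nat.lt_succ_of_le hPd), Finset.mul_sum]
    refine Finset.sum_congr rfl fun j hj => ?_
    rw [Finset.mem_range] at hj
    rw [map_mul, map_mul, map_pow, map_pow, map_pow, cuspPhi_X, cuspPhi_Y]
    rw [show cuspPhi N hN (cuspTheta.toRingHom (P.coeff j)) = _ from cuspPhi_theta N hN _]
    obtain ⟨k, hk⟩ := Nat.exists_eq_add_of_le (show j ≤ q by omega)
    rw [hk, Nat.add_sub_cancel_left]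
    ring
  have hUdeg := cusp_filt (cuspJ P) U F (by rw [hFU]; ring) q (by rwa [hP0]) (by rw [hP0])
    (fun k => (cuspJ_natDegree P k).trans hPd) (fun k => (k + m) / N)
    (fun a b hab => Nat.div_le_div_right (by omega)) (by
      intro k
      have h1 := cuspPhi_natDegree N hN f (k + m)
      rw [hF, PowerSeries.coeff_X_pow_mul] at h1
      exact h1)
  have hqm : N * q ≤ m := by
    rcases hUdeg 0 with h1 | h1
    · rw [PowerSeries.coeff_zero_eq_constantCoeff_apply, hU] at h1
      exact absurd h1 one_ne_zero
    · have h2 : q ≤ (0 + m) / N := by omega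
      rw [Nat.le_div_iff_mul_le (by omega), mul_comm] at h2
      omega
  obtain ⟨r, hr⟩ := Nat.exists_eq_add_of_le hqm
  have hre : Even r := by
    rw [hr, Nat.even_add] at hm
    exact hm.mp (hNe.mul_right q)
  obtain ⟨FU, hFUφ⟩ := cuspPhi_lift N hN (PowerSeries.X ^ r * U) (by
    intro k
    rw [PowerSeries.coeff_X_pow_mul']
    split_ifs with hk
    · rcases hUdeg (k - r) with h1 | h1
      · rw [h1]; simp
      · rw [show k - r + m = k + N * q by omega, Nat.add_mul_div_left _ _ (by omega)] at h1
        omega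
    · simp)
  have hfeq : f = FU * PA := by
    apply hinj
    rw [map_mul, hFUφ, hφPA, hF, hr, hFU]; ring
  rw [hfeq]
  refine mul_mem ?_ hPA
  have h1 := cusp_unit_mem N hNe hN r hre 1 one_pos (FU - psX ^ r) (by
    intro i j hij
    rw [cuspPhi_coeff' N hN, map_sub, hFUφ, map_pow, cuspPhi_X]
    obtain ⟨U', hU'⟩ : PowerSeries.X ∣ U - 1 := by
      rw [PowerSeries.X_dvd_iff]; simp [hU]
    rw [show PowerSeries.X ^ r * U - PowerSeries.X ^ r = PowerSeries.X ^ (r + 1) * U' by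
      rw [pow_succ, mul_assoc, ← hU']; ring, PowerSeries.coeff_X_pow_mul', if_neg (by omega)]
    simp)
  rw [map_one, one_mul, add_sub_cancel] at h1
  exact h1
/-- Let `n ≥ 1`. If `f ∈ ℝ[[x,y]]` is nonnegative at every ordering of
`ℝ((x,y))` at which `y > 0` and `x^(2n) − y > 0`, then `f` lies in the preordering of
`ℝ[[x,y]]` generated by `y` and `x^(2n) − y`. -/
theorem psd_cusp_even_implies_preordering (n : ℕ) (hn : 0 < n) (f : PS)
    (hf : ∀ P : Set FF, IsOrderingF P → (ι psY ∈ P ∧ ι psY ≠ 0) →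
      (ι (psX ^ (2 * n) - psY) ∈ P ∧ ι (psX ^ (2 * n) - psY) ≠ 0) → ι f ∈ P) :
    f ∈ preorderingGen {psY, psX ^ (2 * n) - psY} := by

  have hN : 2 * n ≠ 0 := by omega
  by_cases hf0 : f = 0
  · rw [hf0]
    exact zero_mem (cuspPre (2 * n))
  obtain ⟨h, hh0, hrep⟩ := cusp_artin n hn hN f hf
  exact cusp_main (2 * n) hN (even_two_mul n) f h hf0 hh0 hrep
end
end
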